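/- arXiv:1403.6930 — 3 statements merged into one kernel-verified Lean document; each statement's English description precedes it below -/
import Mathlib

section
/- Let k be an algebraically closed field of characteristic zero, and let R and B be affine domains over k such that B is an R-algebra whose structure map R → B is injective (so that the corresponding morphism Spec B → Spec R is dominant), and suppose there exists a nonzero element s ∈ R such that for every maximal ideal m of R with s ∉ m the fiber ring B/mB is an integral domain (general fibers are irreducible and reduced). Let D be an R-derivation of B such that for every maximal ideal m of R the induced derivation D_m on B/mB is locally nilpotent, i.e., for every b ∈ B there exists n ≥ 1 with Dⁿ(b) ∈ mB. Then D is locally nilpotent on B. -/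
/-- A derivation `D` is locally nilpotent if for every `b` there is `n ≥ 1`
with `Dⁿ(b) = 0`. -/
def Derivation.IsLocallyNilpotent {R B : Type*} [CommRing R] [CommRing B] [Algebra R B]
    (D : Derivation R B B) : Prop :=
  ∀ b : B, ∃ n : ℕ, 1 ≤ n ∧ (⇑D)^[n] b = 0

open Polynomial

theorem Submodule.exists_finset_eq_sum_of_natDegree {K : Type*} [Field K]
    (W : Submodule K K[X]) [FiniteDimensional K W] :
    ∃ (Z : Finset ℕ) (q : ℕ → K[X]), Z.card ≤ Module.finrank K W ∧
      (∀ l, (q l).natDegree = l ∧ (q l).coeff l = 1) ∧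
      ∀ p ∈ W, ∃ c : ℕ → K, p = ∑ l ∈ Z, c l • q l := by
  classical
  let Z' : Set ℕ := {l | ∃ p ∈ W, p ≠ 0 ∧ p.natDegree = l}
  have hex : ∀ l, ∃ q : K[X], (q.Monic ∧ q.natDegree = l) ∧ (l ∈ Z' → q ∈ W) := by
    intro l
    by_cases hl : l ∈ Z'
    · obtain ⟨p, hpW, hp0, hpl⟩ := hl
      refine ⟨C p.leadingCoeff⁻¹ * p, ⟨?_, ?_⟩, fun _ => ?_⟩
      · rw [mul_comm]; exact monic_mul_leadingCoeff_inv hp0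
      · rw [natDegree_C_mul (inv_ne_zero (leadingCoeff_ne_zero.2 hp0)), hpl]
      · rw [← smul_eq_C_mul]; exact W.smul_mem _ hpW
    · exact ⟨X ^ l, ⟨monic_X_pow l, natDegree_X_pow l⟩, fun h => absurd h hl⟩
  choose q hq hqW using hex
  let S : Polynomial.Sequence K := ⟨q, fun i => by
    rw [degree_eq_natDegree (hq i).1.ne_zero, (hq i).2]⟩
  have hli : LinearIndependent K (fun l : Z' => (⟨q l, hqW l l.2⟩ : W)) := by
    apply LinearIndependent.of_comp W.subtype
    exact S.linearIndependent.comp (fun l : Z' => (l : ℕ)) Subtype.val_injective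
  have hfin : Finite Z' := hli.finite
  have hZf : Z'.Finite := Set.toFinite _
  refine ⟨hZf.toFinset, q, ?_, fun l => ⟨(hq l).2, ?_⟩, ?_⟩
  · have : Fintype Z' := Fintype.ofFinite _
    have h := hli.fintype_card_le_finrank
    rwa [← Nat.card_eq_fintype_card, Nat.card_coe_set_eq, Set.ncard_eq_toFinset_card _ hZf] at h
  · have := (hq l).1.coeff_natDegree
    rwa [(hq l).2] at this
  · intro p
    induction hn : p.natDegree using Nat.strong_induction_on generalizing p with
    | _ n ih =>
      intro hp
      by_cases hp0 : p = 0
      · exact ⟨0, by simp [hp0]⟩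
      have hnZ : n ∈ Z' := ⟨p, hp, hp0, hn⟩
      have hlc : p.leadingCoeff ≠ 0 := leadingCoeff_ne_zero.2 hp0
      have key : ∃ c : ℕ → K, p - p.leadingCoeff • q n = ∑ l ∈ hZf.toFinset, c l • q l := by
        have hmem : p - p.leadingCoeff • q n ∈ W := W.sub_mem hp (W.smul_mem _ (hqW n hnZ))
        by_cases h0 : p - p.leadingCoeff • q n = 0
        · exact ⟨0, by simp [h0]⟩
        refine ih _ ?_ _ rfl hmem
        have hd : (p.leadingCoeff • q n).natDegree = n := by
          rw [natDegree_smul _ hlc, (hq n).2]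
        have hlt : (p - p.leadingCoeff • q n).degree < p.degree := by
          apply degree_sub_lt_left
          · rw [degree_eq_natDegree hp0, degree_eq_natDegree, hd, hn]
            exact smul_ne_zero hlc (hq n).1.ne_zero
          · exact hp0
          · rw [smul_eq_C_mul, leadingCoeff_mul, leadingCoeff_C, (hq n).1.leadingCoeff, mul_one]
        exact (natDegree_lt_natDegree h0 hlt).trans_eq hn
      obtain ⟨c, hc⟩ := key
      refine ⟨fun l => c l + if l = n then p.leadingCoeff else 0, ?_⟩
      simp only [add_smul, Finset.sum_add_distrib, ← hc, ite_smul, zero_smul]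
      rw [Finset.sum_ite_eq' hZf.toFinset n]
      simp [hnZ]

namespace Polynomial

variable {K : Type*} [Field K]

/-- The Euler operator `X * d/dX`. -/
noncomputable def euler (K : Type*) [Field K] : Module.End K K[X] :=
  (LinearMap.mulLeft K X) ∘ₗ derivative

theorem coeff_aeval_euler (G p : K[X]) (l : ℕ) :
    (aeval (euler K) G p).coeff l = G.eval (l : K) * p.coeff l := by
  have h1 : ∀ p : K[X], (euler K p).coeff l = (l : K) * p.coeff l := by
    intro p
    cases l with
    | zero => simp [euler]
    | succ l => simp [euler, coeff_derivative, mul_comm]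
  have h2 : ∀ (n : ℕ) (p : K[X]), ((euler K ^ n) p).coeff l = (l : K) ^ n * p.coeff l := by
    intro n
    induction n with
    | zero => simp
    | succ n ih => intro p; rw [pow_succ, Module.End.mul_apply, ih, h1]; ring
  induction G using Polynomial.induction_on' with
  | add a b ha hb => simp [ha, hb, add_mul]
  | monomial n a => simp [aeval_monomial, h2, Module.algebraMap_end_apply, mul_assoc]

theorem aeval_euler_descPochhammer (p : K[X]) (j : ℕ) :
    aeval (euler K) (descPochhammer K j) p = X ^ j * derivative^[j] p := by
  ext l
  rw [coeff_aeval_euler, descPochhammer_eval_eq_descFactorial, coeff_X_pow_mul']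
  split_ifs with h
  · rw [coeff_iterate_derivative, Nat.sub_add_cancel h, nsmul_eq_mul]
  · rw [Nat.descFactorial_of_lt (not_le.1 h)]; simp

theorem natDegree_aeval_euler_le (G p : K[X]) :
    (aeval (euler K) G p).natDegree ≤ p.natDegree := by
  refine natDegree_le_iff_coeff_eq_zero.2 fun l hl => ?_
  rw [coeff_aeval_euler, coeff_eq_zero_of_natDegree_lt hl, mul_zero]

theorem mem_span_descPochhammer (G : K[X]) (m : ℕ) (hG : G.natDegree ≤ m) :
    G ∈ Submodule.span K (descPochhammer K '' Set.Iio (m + 1)) := by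
  let S : Polynomial.Sequence K := ⟨descPochhammer K, fun i => by
    rw [degree_eq_natDegree (monic_descPochhammer K i).ne_zero, descPochhammer_natDegree]⟩
  have := S.span_degreeLT (m := m + 1) (fun i _ => by
    rw [show (S i) = descPochhammer K i from rfl, (monic_descPochhammer K i).leadingCoeff]
    exact isUnit_one)
  change Submodule.span K (descPochhammer K '' Set.Iio (m + 1)) = _ at this
  rw [this, mem_degreeLT]
  exact (degree_le_of_natDegree_le hG).trans_lt (by exact_mod_cast Nat.lt_succ_self m)

theorem false_of_aeval_euler [CharZero K] (W : Submodule K K[X]) [FiniteDimensional K W] {g N n : ℕ}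
    (hg : Module.finrank K W ≤ g) (s : Finset ℕ) (p : ℕ → K[X]) (hp : ∀ i ∈ s, p i ∈ W)
    (α β γ : K) (hγ : γ ≠ 0)
    (hdeg : ∀ G : K[X], G.natDegree ≤ g + 2 →
      (∑ i ∈ s, X ^ i * aeval (euler K) G (p i)).natDegree ≤ N)
    (hcoeff : ∀ G : K[X], G.natDegree ≤ g + 2 →
      (∑ i ∈ s, X ^ i * aeval (euler K) G (p i)).coeff N =
        α * G.eval (n : K) + β * G.eval ((n : K) - 1) + γ * (derivative G).eval (n : K)) :
    False := by
  classical
  obtain ⟨Z, q, hZ, hq, hW⟩ := W.exists_finset_eq_sum_of_natDegree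
  have hc : ∀ i, ∃ c : ℕ → K, i ∈ s → p i = ∑ l ∈ Z, c l • q l := by
    intro i
    by_cases hi : i ∈ s
    · obtain ⟨c, hc⟩ := hW _ (hp i hi); exact ⟨c, fun _ => hc⟩
    · exact ⟨0, fun h => absurd h hi⟩
  choose c hc using hc
  let f : ℕ → K[X] := fun l => ∑ i ∈ s, C (c i l) * X ^ i
  have hA : ∀ G : K[X], ∑ i ∈ s, X ^ i * aeval (euler K) G (p i) =
      ∑ l ∈ Z, f l * aeval (euler K) G (q l) := by
    intro G
    simp only [f, Finset.sum_mul]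
    rw [Finset.sum_comm]
    refine Finset.sum_congr rfl fun i hi => ?_
    rw [hc i hi, map_sum, Finset.mul_sum]
    refine Finset.sum_congr rfl fun l _ => ?_
    rw [map_smul, smul_eq_C_mul]; ring
  have hAcoeff : ∀ d, (∀ l ∈ Z, f l ≠ 0 → (f l).natDegree + l ≤ d) → ∀ G : K[X],
      (∑ i ∈ s, X ^ i * aeval (euler K) G (p i)).coeff d =
        ∑ l ∈ Z, if l ≤ d then (f l).coeff (d - l) * G.eval (l : K) else 0 := by
    intro d hd G
    rw [hA, finsetSum_coeff]
    refine Finset.sum_congr rfl fun l hl => ?_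
    by_cases h0 : f l = 0
    · simp [h0]
    have h := hd l hl h0
    rw [if_pos (by omega)]
    conv_lhs => rw [show d = (d - l) + l by omega]
    rw [coeff_mul_add_eq_of_natDegree_le (by omega)
      ((natDegree_aeval_euler_le G (q l)).trans (hq l).1.le), coeff_aeval_euler, (hq l).2, mul_one]
  have hdegprod : ∀ T : Finset ℕ, (∏ l ∈ T, (X - C (l : K))).natDegree = T.card := by
    intro T
    rw [natDegree_prod_of_monic _ _ fun l _ => monic_X_sub_C _]
    simp only [natDegree_X_sub_C, Finset.sum_const, smul_eq_mul, mul_one]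
  have hstep : ∀ d, (∀ l ∈ Z, f l ≠ 0 → (f l).natDegree + l ≤ N + d) →
      ∀ l ∈ Z, f l ≠ 0 → (f l).natDegree + l ≤ N := by
    intro d
    induction d with
    | zero => intro h; exact h
    | succ d ih =>
      intro h
      refine ih fun l hl h0 => ?_
      by_contra hcon
      have hl' := h l hl h0
      have heq : (f l).natDegree = N + (d + 1) - l := by omega
      let G : K[X] := ∏ l' ∈ Z.erase l, (X - C (l' : K))
      have hGd : G.natDegree ≤ g + 2 := by
        rw [hdegprod]
        exact (Finset.card_erase_le.trans hZ).trans (hg.trans (by omega))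
      have h1 := coeff_eq_zero_of_natDegree_lt (n := N + (d + 1)) ((hdeg G hGd).trans_lt (by omega))
      rw [hAcoeff _ h, Finset.sum_eq_single_of_mem l hl, if_pos (by omega), ← heq] at h1
      · refine mul_ne_zero (leadingCoeff_ne_zero.2 h0) ?_ h1
        rw [eval_prod, Finset.prod_ne_zero_iff]
        intro l' hl'
        rw [eval_sub, eval_X, eval_C, sub_ne_zero]
        exact_mod_cast (Finset.ne_of_mem_erase hl').symm
      · intro l' hl' hne
        have : G.eval (l' : K) = 0 := by
          rw [eval_prod]
          exact Finset.prod_eq_zero (Finset.mem_erase.2 ⟨hne, hl'⟩) (by simp)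
        simp [this]
  have hN : ∀ l ∈ Z, f l ≠ 0 → (f l).natDegree + l ≤ N :=
    hstep (∑ l ∈ Z, ((f l).natDegree + l)) fun l hl _ =>
      (Finset.single_le_sum (f := fun l => (f l).natDegree + l) (fun _ _ => Nat.zero_le _) hl).trans
        (Nat.le_add_left _ _)
  let T : Finset ℕ := Z.filter fun l => l ≠ n ∧ l + 1 ≠ n
  let H : K[X] := ∏ l ∈ T, (X - C (l : K))
  let G : K[X] := (X - C (n : K)) * ((X - C ((n : K) - 1)) * H)
  have hGd : G.natDegree ≤ g + 2 := by
    refine natDegree_mul_le.trans ?_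
    have h1 := natDegree_mul_le (p := X - C ((n : K) - 1)) (q := H)
    have h2 : H.natDegree ≤ g := by
      rw [hdegprod]; exact (Finset.card_filter_le _ _).trans (hZ.trans hg)
    rw [natDegree_X_sub_C] at h1 ⊢
    omega
  have h1 := hcoeff G hGd
  rw [hAcoeff _ hN, Finset.sum_eq_zero] at h1
  · have e1 : G.eval (n : K) = 0 := by simp [G]
    have e2 : G.eval ((n : K) - 1) = 0 := by simp [G]
    have e3 : (derivative G).eval (n : K) = H.eval (n : K) := by simp [G]
    rw [e1, e2, e3, mul_zero, mul_zero, zero_add, zero_add] at h1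
    refine mul_ne_zero hγ ?_ h1.symm
    rw [eval_prod, Finset.prod_ne_zero_iff]
    intro l hl
    rw [eval_sub, eval_X, eval_C, sub_ne_zero]
    exact_mod_cast (Finset.mem_filter.1 hl).2.1.symm
  · intro l hl
    have : G.eval (l : K) = 0 := by
      by_cases h1 : l = n
      · simp [G, h1]
      by_cases h2 : l + 1 = n
      · simp [G, ← h2]
      · have : H.eval (l : K) = 0 := by
          rw [eval_prod]
          exact Finset.prod_eq_zero (Finset.mem_filter.2 ⟨hl, h1, h2⟩) (by simp)
        simp [G, this]
    simp [this]

end Polynomial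

namespace Polynomial

variable {K : Type*} [Field K]

theorem false_of_iterate_derivative [CharZero K] (W : Submodule K K[X]) [FiniteDimensional K W]
    {g : ℕ} (hg : Module.finrank K W ≤ g) (s : Finset ℕ) (p : ℕ → K[X]) (hp : ∀ i ∈ s, p i ∈ W)
    (y q : K[X]) (hq : q ≠ 0) (hn : g + 3 ≤ y.natDegree) (Y ε : ℕ → K[X])
    (hY : ∀ j, Y j = derivative^[j] y)
    (hε : ∀ j, ε j = ∑ i ∈ s, X ^ i * derivative^[j] (p i))
    (hdeg : ∀ j ≤ g + 2, (ε j).natDegree ≤ q.natDegree + y.natDegree - j)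
    (hnum : ∀ j ≤ g + 1, (Y 0 * Y 1 * Y j * ε (j + 1) - Y 0 * Y 1 * Y (j + 1) * ε j
      + Y 1 * Y (j + 1) * Y j * ε 0 - Y 0 * Y (j + 1) * Y j * ε 1
      + C (j : K) * (q * (Y j * Y j) * (Y 1 * Y 1))).coeff
        (q.natDegree + ((y.natDegree - j) + (y.natDegree - j))
          + ((y.natDegree - 1) + (y.natDegree - 1))) = 0) : False := by
  set n := y.natDegree with hn_def
  set Δ := q.natDegree with hΔ_def
  have hy0 : y ≠ 0 := by rintro rfl; simp at hn_def; omega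
  set c := y.leadingCoeff with hc
  set cq := q.leadingCoeff with hcq
  have hc0 : c ≠ 0 := leadingCoeff_ne_zero.2 hy0
  have hcq0 : cq ≠ 0 := leadingCoeff_ne_zero.2 hq
  have hn0 : (n : K) ≠ 0 := by exact_mod_cast (by omega : n ≠ 0)
  let N : ℕ → K := fun j => (n.descFactorial j : K)
  have hN0 : ∀ j ≤ n, N j ≠ 0 := fun j hj => by
    have : n.descFactorial j ≠ 0 := fun h => by
      rw [Nat.descFactorial_eq_zero_iff_lt] at h; omega
    exact Nat.cast_ne_zero.2 this
  have hNs : ∀ j ≤ n, N (j + 1) = ((n : K) - j) * N j := fun j hj => by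
    simp only [N, Nat.descFactorial_succ]; push_cast [hj]; ring
  have hNz : N 0 = 1 := by simp [N]
  have hN1 : N 1 = n := by simp [N]
  let w : ℕ → K := fun j => (ε j).coeff (Δ + n - j)
  have hYd : ∀ j, (Y j).natDegree ≤ n - j := fun j => by
    rw [hY]; exact natDegree_iterate_derivative _ _
  have hYc : ∀ j ≤ n, (Y j).coeff (n - j) = N j * c := fun j hj => by
    rw [hY, coeff_iterate_derivative, Nat.sub_add_cancel hj, nsmul_eq_mul]; rfl
  have hw : ∀ j ≤ g + 1, w (j + 1) = ((n : K) - j) * w j - ((n : K) - j) * N j * w 0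
      + ((n : K) - j) * N j * w 1 / n - j * n * N j * c * cq := by
    intro j hj
    have hrec := hnum j hj
    have hm : ∀ (a b d e : ℕ), a ≤ n → b ≤ n → d ≤ n → e ≤ g + 2 → a + b + d + e = 2 * j + 2 →
        (Y a * Y b * Y d * ε e).coeff (Δ + ((n - j) + (n - j)) + ((n - 1) + (n - 1))) =
          N a * c * (N b * c) * (N d * c) * w e := by
      intro a b d e ha hb hd he hs
      rw [show Δ + ((n - j) + (n - j)) + ((n - 1) + (n - 1)) =
        (n - a) + (n - b) + (n - d) + (Δ + n - e) by omega]
      have e1 : (Y a * Y b).natDegree ≤ (n - a) + (n - b) :=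
        natDegree_mul_le_of_le (hYd a) (hYd b)
      rw [coeff_mul_add_eq_of_natDegree_le (natDegree_mul_le_of_le e1 (hYd d)) (hdeg e he),
        coeff_mul_add_eq_of_natDegree_le e1 (hYd d), coeff_mul_add_eq_of_natDegree_le (hYd a)
        (hYd b), hYc a ha, hYc b hb, hYc d hd]
    have hm' : (q * (Y j * Y j) * (Y 1 * Y 1)).coeff
        (Δ + ((n - j) + (n - j)) + ((n - 1) + (n - 1))) =
          cq * (N j * c * (N j * c)) * (N 1 * c * (N 1 * c)) := by
      have e2 : (Y j * Y j).natDegree ≤ (n - j) + (n - j) := natDegree_mul_le_of_le (hYd j) (hYd j)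
      have e3 : (Y 1 * Y 1).natDegree ≤ (n - 1) + (n - 1) := natDegree_mul_le_of_le (hYd 1) (hYd 1)
      rw [coeff_mul_add_eq_of_natDegree_le (natDegree_mul_le_of_le le_rfl e2) e3,
        coeff_mul_add_eq_of_natDegree_le le_rfl e2, coeff_mul_add_eq_of_natDegree_le (hYd j) (hYd j),
        coeff_mul_add_eq_of_natDegree_le (hYd 1) (hYd 1), hYc j (by omega), hYc 1 (by omega)]
      rfl
    rw [coeff_add, coeff_sub, coeff_add, coeff_sub, coeff_C_mul, hm', hm 0 1 j (j + 1),
      hm 0 1 (j + 1) j, hm 1 (j + 1) j 0, hm 0 (j + 1) j 1, hNs j (by omega), hN1, hNz] at hrec <;>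
        try omega
    have hNj := hN0 j (by omega)
    have hfac : c ^ 3 * n * N j ≠ 0 := mul_ne_zero (mul_ne_zero (pow_ne_zero _ hc0) hn0) hNj
    refine mul_left_cancel₀ hfac ?_
    obtain ⟨v, hv⟩ : ∃ v, w 1 = n * v := ⟨w 1 / n, (mul_div_cancel₀ _ hn0).symm⟩
    rw [hv] at hrec ⊢
    rw [show ((n : K) - j) * N j * (n * v) / n = ((n : K) - j) * N j * v by field_simp]
    linear_combination hrec
  let γ : K := - (n : K) ^ 2 * c * cq
  let β : K := γ - w 1 + n * w 0
  let α : K := w 0 - β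
  have hγ : γ ≠ 0 := mul_ne_zero (mul_ne_zero (neg_ne_zero.2 (pow_ne_zero _ hn0)) hc0) hcq0
  have hΛ : ∀ j ≤ g + 2, α * (descPochhammer K j).eval (n : K)
      + β * (descPochhammer K j).eval ((n : K) - 1)
      + γ * (derivative (descPochhammer K j)).eval (n : K) = w j := by
    have h1 : ∀ j, (descPochhammer K j).eval (n : K) = N j := fun j =>
      descPochhammer_eval_eq_descFactorial K n j
    have h2 : ∀ j ≤ n, (descPochhammer K j).eval ((n : K) - 1) = N j * (n - j) / n := by
      intro j
      induction j with
      | zero => intro _; simp [hNz, hn0]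
      | succ j ih =>
        intro hj
        rw [descPochhammer_succ_right, eval_mul, ih (by omega), hNs j (by omega)]
        simp only [eval_sub, eval_X, eval_natCast]
        push_cast; ring
    intro j
    induction j with
    | zero => intro _; simp [α]
    | succ j ih =>
      intro hj
      have ih := ih (by omega)
      rw [hw j (by omega), ← ih, h1, h1, h2 j (by omega), h2 (j + 1) (by omega),
        descPochhammer_succ_right, derivative_mul, eval_add, eval_mul, eval_mul, h1,
        hNs j (by omega)]
      simp only [derivative_sub, derivative_X, derivative_natCast, eval_sub, eval_X,
        eval_natCast, eval_one, sub_zero, α, β, γ]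
      push_cast
      field_simp
      ring
  have key : ∀ G : K[X], G.natDegree ≤ g + 2 →
      (∑ i ∈ s, X ^ i * aeval (euler K) G (p i)).natDegree ≤ Δ + n ∧
      (∑ i ∈ s, X ^ i * aeval (euler K) G (p i)).coeff (Δ + n) =
        α * G.eval (n : K) + β * G.eval ((n : K) - 1) + γ * (derivative G).eval (n : K) := by
    intro G hG
    have hmem := mem_span_descPochhammer G _ hG
    clear hG
    induction hmem using Submodule.span_induction with
    | mem G hG =>
      obtain ⟨j, hj, rfl⟩ := hG
      have hj' : j ≤ g + 2 := Nat.lt_succ_iff.1 hj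
      have hA : ∑ i ∈ s, X ^ i * aeval (euler K) (descPochhammer K j) (p i) = X ^ j * ε j := by
        rw [hε, Finset.mul_sum]
        refine Finset.sum_congr rfl fun i _ => ?_
        rw [aeval_euler_descPochhammer]; ring
      rw [hA, hΛ j hj']
      constructor
      · refine natDegree_mul_le.trans ?_
        have := hdeg j hj'
        rw [natDegree_X_pow]
        omega
      · rw [coeff_X_pow_mul', if_pos (by omega)]
    | zero => simp
    | add a b _ _ ha hb =>
      simp only [map_add, LinearMap.add_apply, mul_add, Finset.sum_add_distrib, coeff_add,
        eval_add, ha.2, hb.2]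
      exact ⟨natDegree_add_le_of_degree_le ha.1 hb.1, by ring⟩
    | smul r a _ ha =>
      have : ∑ i ∈ s, X ^ i * aeval (euler K) (r • a) (p i) =
          r • ∑ i ∈ s, X ^ i * aeval (euler K) a (p i) := by
        rw [Finset.smul_sum]
        refine Finset.sum_congr rfl fun i _ => ?_
        rw [map_smul, LinearMap.smul_apply, mul_smul_comm]
      rw [this, coeff_smul, ha.2, derivative_smul, eval_smul, eval_smul, eval_smul]
      refine ⟨(natDegree_smul_le _ _).trans ha.1, ?_⟩
      simp only [smul_eq_mul]; ring
  exact false_of_aeval_euler W hg s p hp α β γ hγ (fun G hG => (key G hG).1)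
    fun G hG => (key G hG).2

end Polynomial

namespace Derivation

section Fibre

variable {k R B : Type*} [Field k] [CommRing R] [CommRing B] [Algebra k B] [Algebra R B]

theorem iterate_mem_map (D : Derivation R B B) (m : Ideal R) {b : B} (n : ℕ)
    (hb : b ∈ m.map (algebraMap R B)) : D^[n] b ∈ m.map (algebraMap R B) := by
  induction n generalizing b with
  | zero => exact hb
  | succ n ih =>
    rw [Function.iterate_succ_apply]
    refine ih ?_
    refine Submodule.span_induction (p := fun x _ => D x ∈ m.map (algebraMap R B))
      ?_ ?_ ?_ ?_ hb
    · rintro x ⟨r, -, rfl⟩; simp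
    · simp
    · intro x y _ _ hx hy; rw [map_add]; exact add_mem hx hy
    · intro a x hx hDx
      rw [smul_eq_mul, leibniz]
      exact add_mem (Ideal.mul_mem_left _ _ hDx) (Ideal.mul_mem_right _ _ hx)

theorem exists_forall_iterate_mem_map (D : Derivation R B B) (m : Ideal R)
    (hD : ∀ b, ∃ n : ℕ, 1 ≤ n ∧ D^[n] b ∈ m.map (algebraMap R B)) (b : B) :
    ∃ n : ℕ, ∀ i ≥ n, D^[i] b ∈ m.map (algebraMap R B) := by
  obtain ⟨n, -, hn⟩ := hD b
  refine ⟨n, fun i hi => ?_⟩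
  obtain ⟨j, rfl⟩ := Nat.exists_eq_add_of_le' hi
  rw [Function.iterate_add_apply]
  exact iterate_mem_map D m j hn

theorem iterate_algebraMap_mul (D : Derivation R B B) (r : R) (b : B) (n : ℕ) :
    D^[n] (algebraMap R B r * b) = algebraMap R B r * D^[n] b := by
  induction n generalizing b with
  | zero => rfl
  | succ n ih => rw [Function.iterate_succ_apply, leibniz]; simp [ih]

theorem iterate_map_add' (D : Derivation R B B) (a b : B) (n : ℕ) :
    D^[n] (a + b) = D^[n] a + D^[n] b := by
  induction n generalizing a b with
  | zero => rfl
  | succ n ih => simp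

theorem exists_forall_iterate_mem_map_sq (D : Derivation R B B) (m : Ideal R)
    (hD : ∀ b, ∃ n : ℕ, 1 ≤ n ∧ D^[n] b ∈ m.map (algebraMap R B)) (b : B) :
    ∃ n : ℕ, ∀ i ≥ n, D^[i] b ∈ m.map (algebraMap R B) ^ 2 := by
  set J := m.map (algebraMap R B) with hJ
  have key : ∀ x ∈ J, ∀ c, ∃ n : ℕ, ∀ i ≥ n, D^[i] (c * x) ∈ J ^ 2 := by
    intro x hx
    refine Submodule.span_induction
      (p := fun x _ => ∀ c, ∃ n : ℕ, ∀ i ≥ n, D^[i] (c * x) ∈ J ^ 2) ?_ ?_ ?_ ?_ hx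
    · rintro x ⟨r, hr, rfl⟩ c
      obtain ⟨n, hn⟩ := exists_forall_iterate_mem_map D m hD c
      refine ⟨n, fun i hi => ?_⟩
      rw [mul_comm, iterate_algebraMap_mul, sq]
      exact Ideal.mul_mem_mul (Ideal.mem_map_of_mem _ hr) (hn i hi)
    · intro c
      refine ⟨0, fun i _ => ?_⟩
      rw [mul_zero, iterate_map_zero]
      exact zero_mem _
    · intro x y _ _ hx hy c
      obtain ⟨n, hn⟩ := hx c
      obtain ⟨n', hn'⟩ := hy c
      refine ⟨max n n', fun i hi => ?_⟩
      rw [mul_add, iterate_map_add']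
      exact add_mem (hn i (le_of_max_le_left hi)) (hn' i (le_of_max_le_right hi))
    · intro a x _ hx c
      obtain ⟨n, hn⟩ := hx (c * a)
      refine ⟨n, fun i hi => ?_⟩
      rw [smul_eq_mul, ← mul_assoc]
      exact hn i hi
  obtain ⟨n, hn⟩ := exists_forall_iterate_mem_map D m hD b
  obtain ⟨n', hn'⟩ := key _ (hn n le_rfl) 1
  refine ⟨n' + n, fun i hi => ?_⟩
  obtain ⟨j, rfl⟩ := Nat.exists_eq_add_of_le' (le_of_add_le_right hi : n ≤ i)
  have := hn' j (by omega)
  rwa [one_mul, ← Function.iterate_add_apply] at this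

/-- The iterated commutator of `E` with `D`. -/
def iteratedBracket (D E : Derivation k B B) : ℕ → Derivation k B B
  | 0 => E
  | n + 1 => ⁅D, iteratedBracket D E n⁆

theorem iterate_apply_eq_sum_iteratedBracket (D E : Derivation k B B) (n : ℕ) (b : B) :
    D^[n] (E b) = ∑ ij ∈ Finset.HasAntidiagonal.antidiagonal n,
      n.choose ij.1 • iteratedBracket D E ij.1 (D^[ij.2] b) := by
  induction n generalizing b with
  | zero => simp [iteratedBracket]
  | succ n ih =>
    rw [Finset.sum_antidiagonal_choose_succ_nsmul
      (fun i j => iteratedBracket D E i (D^[j] b)) n, Function.iterate_succ_apply', ih, map_sum,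
      ← Finset.sum_add_distrib]
    refine Finset.sum_congr rfl fun ij hij => ?_
    rw [← Nat.choose_symm_of_eq_add (Finset.HasAntidiagonal.mem_antidiagonal.1 hij).symm, map_nsmul, ← nsmul_add,
      iteratedBracket, commutator_apply, Function.iterate_succ_apply', add_sub_cancel]

theorem iteratedBracket_apply_eq_sum (D E : Derivation k B B) (n : ℕ) (b : B) :
    iteratedBracket D E n b = ∑ ij ∈ Finset.HasAntidiagonal.antidiagonal n,
      n.choose ij.1 • ((-1 : ℤ) ^ ij.2 • D^[ij.1] (E (D^[ij.2] b))) := by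
  induction n generalizing b with
  | zero => simp [iteratedBracket]
  | succ n ih =>
    rw [Finset.sum_antidiagonal_choose_succ_nsmul
      (fun i j => (-1 : ℤ) ^ j • D^[i] (E (D^[j] b))) n, iteratedBracket, commutator_apply, ih, ih,
      map_sum, ← Finset.sum_sub_distrib, ← Finset.sum_add_distrib]
    refine Finset.sum_congr rfl fun ij hij => ?_
    rw [← Nat.choose_symm_of_eq_add (Finset.HasAntidiagonal.mem_antidiagonal.1 hij).symm, map_nsmul, ← nsmul_add,
      ← nsmul_sub, map_zsmul, Function.iterate_succ_apply' D ij.1,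
      Function.iterate_succ_apply D ij.2, pow_succ]
    congr 1
    rw [mul_neg_one, neg_smul]
    abel

end Fibre

end Derivation

theorem Polynomial.exists_coeff_eq {Q : Type*} [Semiring Q] (u : ℕ → Q)
    (hu : ∃ n, ∀ i ≥ n, u i = 0) : ∃ p : Polynomial Q, ∀ i, p.coeff i = u i := by
  obtain ⟨n, hn⟩ := hu
  refine ⟨∑ i ∈ Finset.range n, Polynomial.monomial i (u i), fun i => ?_⟩
  rw [Polynomial.finsetSum_coeff]
  simp only [Polynomial.coeff_monomial, Finset.sum_ite_eq', Finset.mem_range]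
  split_ifs with h
  · rfl
  · exact (hn i (not_lt.1 h)).symm

theorem Nat.cast_descFactorial_mul_div_factorial {Q : Type*} [Field Q] [CharZero Q] (a : Q)
    (l j : ℕ) : ((l + j).descFactorial j : Q) * (a / ((l + j).factorial : Q)) =
      a / (l.factorial : Q) := by
  have h1 := Nat.factorial_ne_zero l
  have h2 : (l + j).descFactorial j ≠ 0 := by
    rw [Ne, Nat.descFactorial_eq_zero_iff_lt]; omega
  rw [← Nat.factorial_mul_descFactorial (Nat.le_add_left j l), Nat.add_sub_cancel]
  push_cast
  field_simp

namespace Derivation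

/-- The ring homomorphism `b ↦ ∑ (Dⁱ b / i!) Xⁱ`, for a derivation which becomes locally nilpotent
in `Q`. -/
theorem exists_ringHom_polynomial {k B Q : Type*} [CommRing k] [CommRing B] [Algebra k B] [Field Q]
    [CharZero Q] [Algebra B Q] (D : Derivation k B B)
    (hnil : ∀ b, ∃ n : ℕ, ∀ i ≥ n, algebraMap B Q (D^[i] b) = 0) :
    ∃ φ : B →+* Q[X], ∀ b i, (φ b).coeff i = algebraMap B Q (D^[i] b) / (i.factorial : Q) := by
  have hex : ∀ b, ∃ p : Q[X], ∀ i, p.coeff i = algebraMap B Q (D^[i] b) / (i.factorial : Q) := by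
    intro b
    obtain ⟨n, hn⟩ := hnil b
    exact Polynomial.exists_coeff_eq _ ⟨n, fun i hi => by rw [hn i hi, zero_div]⟩
  choose φ hφ using hex
  have hder : ∀ b, derivative (φ b) = φ (D b) := by
    intro b
    ext i
    rw [coeff_derivative, hφ, hφ, Function.iterate_succ_apply, Nat.factorial_succ]
    have := Nat.factorial_ne_zero i
    push_cast
    field_simp
  have hadd : ∀ a b, φ (a + b) = φ a + φ b := by
    intro a b
    ext i
    rw [coeff_add, hφ, hφ, hφ, iterate_map_add' D, map_add, add_div]
  have hmul : ∀ n a b, (φ (a * b)).coeff n = (φ a * φ b).coeff n := by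
    intro n
    induction n with
    | zero => intro a b; simp [mul_coeff_zero, hφ]
    | succ n ih =>
      intro a b
      have h0 : ((n : Q) + 1) ≠ 0 := by exact_mod_cast Nat.succ_ne_zero n
      apply mul_right_cancel₀ h0
      rw [← coeff_derivative, ← coeff_derivative, hder, derivative_mul, leibniz, hadd, coeff_add,
        coeff_add, hder, hder, smul_eq_mul, smul_eq_mul, ih, ih, mul_comm (φ b), add_comm]
  refine ⟨⟨⟨⟨φ, ?_⟩, fun a b => Polynomial.ext fun n => hmul n a b⟩, ?_, hadd⟩, hφ⟩
  · ext i
    rw [hφ, coeff_one]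
    cases i with
    | zero => simp
    | succ i => simp [Function.iterate_succ_apply, iterate_map_zero]
  · ext i
    change (φ 0).coeff i = 0
    rw [hφ, iterate_map_zero, map_zero, zero_div]

section Taylor

variable {k B Q : Type*} [Field k] [CommRing B] [Algebra k B] [Field Q] [Algebra k Q]
  [Algebra B Q] [IsScalarTower k B Q]

theorem exists_submodule_taylor [CharZero Q] (D : Derivation k B B) (S : Finset B)
    (hS : Algebra.adjoin k (S : Set B) = ⊤) (J : Ideal B)
    (hJ : ∀ b, algebraMap B Q b = 0 ↔ b ∈ J)
    (hJD : ∀ b ∈ J, ∀ n, D^[n] b ∈ J)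
    (hnil : ∀ b, ∃ n : ℕ, ∀ i ≥ n, D^[i] b ∈ J)
    (hnil2 : ∀ b, ∃ n : ℕ, ∀ i ≥ n, D^[i] b ∈ J ^ 2)
    (φ : B → Q[X]) (hφ : ∀ b i, (φ b).coeff i = algebraMap B Q (D^[i] b) / (i.factorial : Q))
    (x : B) (E : Derivation k B B) :
    ∃ (W : Submodule Q Q[X]) (_ : FiniteDimensional Q W) (s : Finset ℕ) (p : ℕ → Q[X]),
      Module.finrank Q W ≤ S.card ∧ (∀ i ∈ s, p i ∈ W) ∧
      ∀ j, φ (E (D^[j] x)) = ∑ i ∈ s, X ^ i * derivative^[j] (p i) := by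
  classical
  have hsq : ∀ e : Derivation k B Q, ∀ b ∈ J ^ 2, e b = 0 := by
    intro e b hb
    rw [sq] at hb
    refine Submodule.mul_induction_on hb ?_ ?_
    · intro a ha c hc
      rw [leibniz, Algebra.smul_def, Algebra.smul_def, (hJ a).2 ha, (hJ c).2 hc]
      simp
    · intro a c ha hc
      rw [map_add, ha, hc, add_zero]
  have hEsq : ∀ b ∈ J ^ 2, E b ∈ J := fun b hb =>
    (hJ _).1 (hsq ((Algebra.linearMap B Q).compDer E) b hb)
  have hex : ∀ e : Derivation k B Q, ∃ p : Q[X], ∀ i,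
      p.coeff i = e (D^[i] x) / (i.factorial : Q) := by
    intro e
    obtain ⟨n, hn⟩ := hnil2 x
    exact Polynomial.exists_coeff_eq _ ⟨n, fun i hi => by rw [hsq e _ (hn i hi), zero_div]⟩
  choose P hP using hex
  let L : Derivation k B Q →ₗ[Q] Q[X] :=
    { toFun := P
      map_add' := fun a b => by ext i; simp [hP, add_div]
      map_smul' := fun r a => by ext i; simp [hP, mul_div_assoc] }
  let ev : Derivation k B Q →ₗ[Q] (S → Q) :=
    { toFun := fun e b => e b
      map_add' := fun a b => rfl
      map_smul' := fun r a => rfl }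
  have hev : Function.Injective ev := fun a b hab =>
    ext_of_adjoin_eq_top _ hS fun y hy => congrFun hab ⟨y, hy⟩
  have : FiniteDimensional Q (Derivation k B Q) := FiniteDimensional.of_injective ev hev
  have hrank : Module.finrank Q (Derivation k B Q) ≤ S.card := by
    simpa using LinearMap.finrank_le_finrank_of_injective hev
  have hbr : ∀ b, ∃ n : ℕ, ∀ i ≥ n, iteratedBracket D E i b ∈ J := by
    intro b
    obtain ⟨n, hn⟩ := hnil2 b
    choose N hN using fun c => hnil (E (D^[c] b))
    refine ⟨n + ∑ c ∈ Finset.range n, N c, fun i hi => ?_⟩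
    rw [iteratedBracket_apply_eq_sum]
    refine sum_mem fun ij hij => nsmul_mem (zsmul_mem ?_ _) _
    rw [Finset.HasAntidiagonal.mem_antidiagonal] at hij
    by_cases hc : n ≤ ij.2
    · exact hJD _ (hEsq _ (hn _ hc)) _
    · refine hN _ _ ?_
      have := Finset.single_le_sum (f := N) (fun _ _ => Nat.zero_le _)
        (Finset.mem_range.2 (not_le.1 hc))
      omega
  let ψ : ℕ → Derivation k B Q := fun i =>
    ((i.factorial : k)⁻¹) • (Algebra.linearMap B Q).compDer (iteratedBracket D E i)
  have hψ : ∀ i b, ψ i b = algebraMap B Q (iteratedBracket D E i b) / (i.factorial : Q) := by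
    intro i b
    change ((i.factorial : k)⁻¹) • algebraMap B Q (iteratedBracket D E i b) = _
    rw [Algebra.smul_def, map_inv₀, _root_.map_natCast, div_eq_inv_mul]
  choose M hM using hbr
  let i₀ := ∑ b ∈ S, M b
  have hψ0 : ∀ i ≥ i₀, ψ i = 0 := by
    intro i hi
    refine ext_of_adjoin_eq_top _ hS fun y hy => ?_
    rw [hψ, (hJ _).2 (hM y i _), zero_div]
    · rfl
    · exact (Finset.single_le_sum (f := M) (fun _ _ => Nat.zero_le _) hy).trans hi
  refine ⟨LinearMap.range L, inferInstance, Finset.range i₀, fun i => P (ψ i),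
    (LinearMap.finrank_range_le L).trans hrank, fun i _ => ⟨ψ i, rfl⟩, fun j => ?_⟩
  ext n
  have hPd : ∀ e : Derivation k B Q, ∀ l, (derivative^[j] (P e)).coeff l =
      e (D^[l] (D^[j] x)) / (l.factorial : Q) := by
    intro e l
    rw [coeff_iterate_derivative, hP, ← Function.iterate_add_apply, nsmul_eq_mul,
      Nat.cast_descFactorial_mul_div_factorial]
  rw [hφ, iterate_apply_eq_sum_iteratedBracket, map_sum, finsetSum_coeff, Finset.sum_div]
  have hterm : ∀ ij ∈ Finset.HasAntidiagonal.antidiagonal n,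
      algebraMap B Q (n.choose ij.1 • iteratedBracket D E ij.1 (D^[ij.2] (D^[j] x))) /
        (n.factorial : Q) = ψ ij.1 (D^[ij.2] (D^[j] x)) / (ij.2.factorial : Q) := by
    intro ij hij
    rw [Finset.HasAntidiagonal.mem_antidiagonal] at hij
    rw [hψ, map_nsmul, nsmul_eq_mul]
    have h := Nat.choose_mul_factorial_mul_factorial (show ij.1 ≤ n by omega)
    rw [show n - ij.1 = ij.2 by omega] at h
    have h1 := Nat.factorial_ne_zero ij.1
    have h2 := Nat.factorial_ne_zero ij.2
    have h3 : n.choose ij.1 ≠ 0 := (Nat.choose_pos (by omega)).ne'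
    rw [← h]
    push_cast
    field_simp
  rw [Finset.sum_congr rfl hterm, Finset.Nat.sum_antidiagonal_eq_sum_range_succ
    (fun a b => ψ a (D^[b] (D^[j] x)) / (b.factorial : Q))]
  have hr : ∀ i ∈ Finset.range i₀, (X ^ i * derivative^[j] (P (ψ i))).coeff n =
      if i < n + 1 then ψ i (D^[n - i] (D^[j] x)) / ((n - i).factorial : Q) else 0 := by
    intro i _
    rw [coeff_X_pow_mul', hPd]
    simp only [Nat.lt_succ_iff]
  rw [Finset.sum_congr rfl hr, ← Finset.sum_filter]
  refine (Finset.sum_subset_zero_on_sdiff ?_ ?_ fun _ _ => rfl).symm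
  · intro i hi
    exact Finset.mem_range.2 (Finset.mem_filter.1 hi).2
  · intro i hi
    simp only [Finset.mem_sdiff, Finset.mem_range, Finset.mem_filter, not_and] at hi
    rw [hψ0 i (by by_contra h; exact hi.2 (not_le.1 h) hi.1)]
    simp

end Taylor

end Derivation

theorem Derivation.exists_ringHom_polynomial_of_fibre.{u} {k R : Type*} {B : Type u} [Field k] [CharZero k]
    [CommRing R] [Algebra k R] [CommRing B] [Algebra k B] [Algebra R B] [IsScalarTower k R B]
    (S : Finset B) (hS : Algebra.adjoin k (S : Set B) = ⊤) (m : Ideal R)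
    (hdom : IsDomain (B ⧸ m.map (algebraMap R B))) (D : Derivation R B B)
    (hD : ∀ b, ∃ n : ℕ, 1 ≤ n ∧ D^[n] b ∈ m.map (algebraMap R B)) :
    ∃ (Q : Type u) (_ : Field Q) (_ : CharZero Q) (φ : B →+* Q[X]),
      (∀ b, φ b = 0 ↔ b ∈ m.map (algebraMap R B)) ∧
      (∀ b j, φ (D^[j] b) = derivative^[j] (φ b)) ∧
      ∀ (x : B) (E : Derivation k B B),
        ∃ (W : Submodule Q Q[X]) (_ : FiniteDimensional Q W) (s : Finset ℕ) (p : ℕ → Q[X]),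
          Module.finrank Q W ≤ S.card ∧ (∀ i ∈ s, p i ∈ W) ∧
          ∀ j, φ (E (D^[j] x)) = ∑ i ∈ s, X ^ i * derivative^[j] (p i) := by
  set J := m.map (algebraMap R B) with hJdef
  let Q := FractionRing (B ⧸ J)
  have : IsScalarTower k B Q := IsScalarTower.of_algebraMap_eq fun x => by
    rw [IsScalarTower.algebraMap_apply k (B ⧸ J) Q, IsScalarTower.algebraMap_apply B (B ⧸ J) Q,
      IsScalarTower.algebraMap_apply k B (B ⧸ J)]
  have : CharZero Q := charZero_of_injective_algebraMap (algebraMap k Q).injective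
  have hJ : ∀ b, algebraMap B Q b = 0 ↔ b ∈ J := by
    intro b
    rw [IsScalarTower.algebraMap_apply B (B ⧸ J) Q,
      map_eq_zero_iff _ (IsFractionRing.injective (B ⧸ J) Q)]
    exact Ideal.Quotient.eq_zero_iff_mem
  have hnil := exists_forall_iterate_mem_map D m hD
  obtain ⟨φ, hφ⟩ := exists_ringHom_polynomial (Q := Q) (D.restrictScalars k) fun b => by
    obtain ⟨n, hn⟩ := hnil b
    exact ⟨n, fun i hi => (hJ _).2 (hn i hi)⟩
  replace hφ : ∀ b i, (φ b).coeff i = algebraMap B Q (D^[i] b) / (i.factorial : Q) := hφ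
  refine ⟨Q, inferInstance, inferInstance, φ, fun b => ?_, fun b j => ?_, fun x E =>
    exists_submodule_taylor (D.restrictScalars k) S hS J hJ
      (fun b hb n => iterate_mem_map D m n hb) hnil (exists_forall_iterate_mem_map_sq D m hD)
      φ hφ x E⟩
  · constructor
    · intro h
      have := hφ b 0
      rw [h] at this
      rw [← hJ]
      simpa using this.symm
    · intro h
      ext i
      rw [hφ, (hJ _).2 (iterate_mem_map D m i h)]
      simp
  · ext l
    rw [hφ, coeff_iterate_derivative, hφ, nsmul_eq_mul, Nat.cast_descFactorial_mul_div_factorial,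
      Function.iterate_add_apply]

theorem ValuationSubring.exists_mem_or_eq_sum {F V ι : Type*} [Field F] [AddCommGroup V] [Module F V]
    (O : ValuationSubring F) (f : V →ₗ[F] F) (s : Finset ι) (ℓ : ι → V →ₗ[F] F)
    (U : Submodule F V) :
    (∃ v ∈ U, f v = 1 ∧ ∀ i ∈ s, ℓ i v ∈ O) ∨
      ∃ c : ι → F, (∀ i, O.valuation (c i) < 1) ∧ ∀ v ∈ U, f v = ∑ i ∈ s, c i * ℓ i v := by
  classical
  induction hn : s.card generalizing s U with
  | zero =>
    rw [Finset.card_eq_zero] at hn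
    subst hn
    by_cases h : ∃ v ∈ U, f v ≠ 0
    · obtain ⟨v, hv, hfv⟩ := h
      exact Or.inl ⟨(f v)⁻¹ • v, U.smul_mem _ hv, by simp [hfv], by simp⟩
    · push Not at h
      exact Or.inr ⟨0, by simp, fun v hv => by simp [h v hv]⟩
  | succ n ih =>
    by_cases h : ∃ v ∈ U, ∃ i ∈ s, ℓ i v ≠ 0
    · obtain ⟨v, hv, i, hi, hiv⟩ := h
      obtain ⟨i₀, hi₀, hmax⟩ := s.exists_max_image (fun i => O.valuation (ℓ i v)) ⟨i, hi⟩
      have h0 : ℓ i₀ v ≠ 0 := by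
        intro h0
        have := hmax i hi
        rw [h0, map_zero, le_zero_iff, map_eq_zero] at this
        exact hiv this
      set u := (ℓ i₀ v)⁻¹ • v with hu
      have huU : u ∈ U := U.smul_mem _ hv
      have hui₀ : ℓ i₀ u = 1 := by simp [hu, h0]
      have huO : ∀ i ∈ s, ℓ i u ∈ O := by
        intro i hi
        rw [← O.valuation_le_one_iff, hu, map_smul, smul_eq_mul, map_mul, map_inv₀,
          inv_mul_le_one₀ (by simpa [zero_lt_iff] using h0)]
        exact hmax i hi
      by_cases hfu : O.valuation (f u) < 1
      · obtain ⟨w, hw, hfw, hwO⟩ | ⟨c, hc, hfc⟩ := ih (s.erase i₀) (U ⊓ LinearMap.ker (ℓ i₀))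
          (by rw [Finset.card_erase_of_mem hi₀, hn, Nat.add_sub_cancel])
        · refine Or.inl ⟨w, hw.1, hfw, fun i hi => ?_⟩
          by_cases hii : i = i₀
          · rw [hii, LinearMap.mem_ker.1 hw.2]; exact O.zero_mem
          · exact hwO i (Finset.mem_erase.2 ⟨hii, hi⟩)
        · right
          set μ := f u - ∑ i ∈ s.erase i₀, c i * ℓ i u with hμ
          have hμ1 : O.valuation μ < 1 := by
            refine Valuation.map_sub_lt _ hfu (Valuation.map_sum_lt _ one_ne_zero fun i hi => ?_)
            rw [map_mul]
            exact mul_lt_one_of_lt_of_le (hc i)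
              ((O.valuation_le_one_iff _).2 (huO i (Finset.mem_of_mem_erase hi)))
          refine ⟨fun i => if i = i₀ then μ else c i, fun i => ?_, fun w hw => ?_⟩
          · dsimp only
            split_ifs
            exacts [hμ1, hc i]
          · have hw' := hfc (w - ℓ i₀ w • u) ⟨U.sub_mem hw (U.smul_mem _ huU), by simp [hui₀]⟩
            rw [← Finset.add_sum_erase _ _ hi₀]
            have hsum : ∑ i ∈ s.erase i₀, (if i = i₀ then μ else c i) * ℓ i w =
                ∑ i ∈ s.erase i₀, c i * ℓ i w :=
              Finset.sum_congr rfl fun i hi => by rw [if_neg (Finset.ne_of_mem_erase hi)]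
            rw [hsum]
            simp only [if_pos]
            have hsub : ∑ i ∈ s.erase i₀, c i * ℓ i (w - ℓ i₀ w • u) =
                ∑ i ∈ s.erase i₀, c i * ℓ i w - ℓ i₀ w * ∑ i ∈ s.erase i₀, c i * ℓ i u := by
              rw [Finset.mul_sum, ← Finset.sum_sub_distrib]
              refine Finset.sum_congr rfl fun i _ => ?_
              rw [map_sub, map_smul, smul_eq_mul]; ring
            rw [hsub, map_sub, map_smul, smul_eq_mul] at hw'
            rw [hμ]
            linear_combination hw'
      · have hfu0 : f u ≠ 0 := by rintro h; simp [h] at hfu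
        refine Or.inl ⟨(f u)⁻¹ • u, U.smul_mem _ huU, by simp [hfu0], fun i hi => ?_⟩
        rw [map_smul, smul_eq_mul]
        refine O.mul_mem _ _ ?_ (huO i hi)
        rw [← O.valuation_le_one_iff, map_inv₀]
        exact inv_le_one_of_one_le₀ (not_lt.1 hfu)
    · push Not at h
      by_cases hf : ∃ v ∈ U, f v ≠ 0
      · obtain ⟨v, hv, hfv⟩ := hf
        refine Or.inl ⟨(f v)⁻¹ • v, U.smul_mem _ hv, by simp [hfv], fun i hi => ?_⟩
        rw [h _ (U.smul_mem _ hv) i hi]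
        exact O.zero_mem
      · push Not at hf
        exact Or.inr ⟨0, by simp, fun v hv => by simp [hf v hv]⟩

theorem Algebra.FormallySmooth.of_field_of_charZero (K L : Type*) [Field K] [Field L] [CharZero K]
    [Algebra K L] : Algebra.FormallySmooth K L := by
  obtain ⟨ι, v, hv⟩ := exists_isTranscendenceBasis' K L
  have := hv.isAlgebraic_field
  exact .of_algebraicIndependent_of_isSeparable hv.1

theorem Algebra.FormallySmooth.of_domain_of_charZero (A F : Type*) [CommRing A] [IsDomain A]
    [Field F] [CharZero F] [Algebra A F] [FaithfulSMul A F] : Algebra.FormallySmooth A F := by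
  let K := FractionRing A
  let _ : Algebra K F := FractionRing.liftAlgebra A F
  have : IsScalarTower A K F := FractionRing.isScalarTower_liftAlgebra A F
  have : CharZero K := (algebraMap K F).charZero
  have : Algebra.FormallySmooth A K := .of_isLocalization (nonZeroDivisors A)
  have := Algebra.FormallySmooth.of_field_of_charZero K F
  exact .comp A K F

theorem RingHom.isNilpotent_ker_of_mul_eq_zero {A B : Type*} [CommRing A] [CommRing B]
    (g : A →+* B) (h : ∀ a b, g a = 0 → g b = 0 → a * b = 0) : IsNilpotent (RingHom.ker g) := by
  refine ⟨2, ?_⟩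
  rw [pow_two, Ideal.zero_eq_bot, eq_bot_iff, Ideal.mul_le]
  exact fun a ha b hb => Ideal.mem_bot.2 (h a b ha hb)

namespace Derivation

theorem exists_extension {L A F : Type*} [CommRing L] [CommRing A] [IsDomain A] [Field F]
    [CharZero F] [Algebra L A] [Algebra A F] [Algebra L F] [IsScalarTower L A F]
    [FaithfulSMul A F] (d : Derivation L A F) :
    ∃ E : Derivation L F F, ∀ a, E (algebraMap A F a) = d a := by
  have := Algebra.FormallySmooth.of_domain_of_charZero A F
  let f : A →+* TrivSqZeroExt F F :=
    { toFun := fun a => TrivSqZeroExt.inl (algebraMap A F a) + TrivSqZeroExt.inr (d a)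
      map_one' := by
        apply TrivSqZeroExt.ext <;> simp only [TrivSqZeroExt.fst_add, TrivSqZeroExt.snd_add,
          TrivSqZeroExt.fst_inl, TrivSqZeroExt.snd_inl, TrivSqZeroExt.fst_inr,
          TrivSqZeroExt.snd_inr, TrivSqZeroExt.fst_one, TrivSqZeroExt.snd_one, map_one,
          d.map_one_eq_zero, add_zero]
      map_mul' := fun a b => by
        apply TrivSqZeroExt.ext <;> simp only [TrivSqZeroExt.fst_add, TrivSqZeroExt.snd_add,
          TrivSqZeroExt.fst_inl, TrivSqZeroExt.snd_inl, TrivSqZeroExt.fst_inr,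
          TrivSqZeroExt.snd_inr, TrivSqZeroExt.fst_mul, TrivSqZeroExt.snd_mul, map_mul,
          d.leibniz, add_zero, zero_add, Algebra.smul_def, op_smul_eq_mul,
          Algebra.algebraMap_self, RingHom.id_apply]
        ring
      map_zero' := by
        apply TrivSqZeroExt.ext <;> simp only [TrivSqZeroExt.fst_add, TrivSqZeroExt.snd_add,
          TrivSqZeroExt.fst_inl, TrivSqZeroExt.snd_inl, TrivSqZeroExt.fst_inr,
          TrivSqZeroExt.snd_inr, TrivSqZeroExt.fst_zero, TrivSqZeroExt.snd_zero, map_zero,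
          add_zero]
      map_add' := fun a b => by
        apply TrivSqZeroExt.ext <;> simp only [TrivSqZeroExt.fst_add, TrivSqZeroExt.snd_add,
          TrivSqZeroExt.fst_inl, TrivSqZeroExt.snd_inl, TrivSqZeroExt.fst_inr,
          TrivSqZeroExt.snd_inr, map_add, add_zero, zero_add] }
  let _ : Algebra A (TrivSqZeroExt F F) := f.toAlgebra
  have hf : ∀ a, algebraMap A (TrivSqZeroExt F F) a = TrivSqZeroExt.inl (algebraMap A F a) +
    TrivSqZeroExt.inr (d a) := fun a => rfl
  let g : TrivSqZeroExt F F →ₐ[A] F :=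
    { (TrivSqZeroExt.fstHom F F F).toRingHom with
      commutes' := fun a => by
        change TrivSqZeroExt.fst (algebraMap A (TrivSqZeroExt F F) a) = _
        rw [hf, TrivSqZeroExt.fst_add, TrivSqZeroExt.fst_inl, TrivSqZeroExt.fst_inr, add_zero] }
  have hg : ∀ t, g t = t.fst := fun t => rfl
  have hgs : Function.Surjective g := fun x => ⟨TrivSqZeroExt.inl x, by simp [hg]⟩
  have hgn : IsNilpotent (RingHom.ker (g : TrivSqZeroExt F F →+* F)) :=
    RingHom.isNilpotent_ker_of_mul_eq_zero _ fun a b ha hb => by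
      have ha' : a.fst = 0 := ha
      have hb' : b.fst = 0 := hb
      apply TrivSqZeroExt.ext <;> simp [ha', hb']
  let l := Algebra.FormallySmooth.liftOfSurjective (AlgHom.id A F) g hgs hgn
  have hl : ∀ x, (l x).fst = x := fun x =>
    Algebra.FormallySmooth.liftOfSurjective_apply (AlgHom.id A F) g hgs hgn x
  have hla : ∀ a, (l (algebraMap A F a)).snd = d a := fun a => by
    rw [l.commutes, hf, TrivSqZeroExt.snd_add, TrivSqZeroExt.snd_inl, TrivSqZeroExt.snd_inr, zero_add]
  have hlL : ∀ r : L, (l (algebraMap L F r)).snd = 0 := fun r => by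
    rw [IsScalarTower.algebraMap_apply L A F, hla, d.map_algebraMap]
  have hm : ∀ x y, (l (x * y)).snd = x * (l y).snd + y * (l x).snd := fun x y => by
    rw [map_mul, TrivSqZeroExt.snd_mul, hl, hl]; simp [mul_comm]
  refine ⟨Derivation.mk'
    { toFun := fun x => (l x).snd
      map_add' := fun x y => by rw [map_add, TrivSqZeroExt.snd_add]
      map_smul' := fun r x => by
        rw [Algebra.smul_def, hm, hlL]; simp [Algebra.smul_def] } ?_, hla⟩
  intro x y
  exact hm x y

theorem exists_apply_eq_of_algebraicIndependent {L F ι : Type*} [Field L] [Field F] [CharZero F]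
    [Algebra L F] {y : ι → F} (hy : AlgebraicIndependent L y) (a : ι → F) :
    ∃ E : Derivation L F F, ∀ i, E (y i) = a i := by
  let _ : Algebra (MvPolynomial ι L) F := (MvPolynomial.aeval y).toRingHom.toAlgebra
  have halg : ∀ p, algebraMap (MvPolynomial ι L) F p = MvPolynomial.aeval y p := fun _ => rfl
  have : IsScalarTower L (MvPolynomial ι L) F := .of_algebraMap_eq fun r => by
    rw [halg]; simp
  have : FaithfulSMul (MvPolynomial ι L) F :=
    (faithfulSMul_iff_algebraMap_injective _ _).2 hy
  obtain ⟨E, hE⟩ := exists_extension (MvPolynomial.mkDerivation L a)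
  refine ⟨E, fun i => ?_⟩
  have := hE (MvPolynomial.X i)
  rwa [halg, MvPolynomial.aeval_X, MvPolynomial.mkDerivation_X] at this

theorem exists_apply_eq_of_transcendental {L F : Type*} [Field L] [Field F] [CharZero F]
    [Algebra L F] {t : F} (ht : Transcendental L t) (a : F) :
    ∃ E : Derivation L F F, E t = a := by
  obtain ⟨E, hE⟩ := exists_apply_eq_of_algebraicIndependent (y := fun _ : Unit => t)
    ((algebraicIndependent_unique_type_iff).2 ht) fun _ => a
  exact ⟨E, hE ()⟩

end Derivation

namespace Derivation

open IsDedekindDomain WithZero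

section

variable {k F : Type*} [CommRing k] [Field F] [Algebra k F] {Γ : Type*}
  [LinearOrderedCommGroupWithZero Γ] (v : Valuation F Γ) (E : Derivation k F F)

theorem valuation_mul_le {C : Γ} {a b : F} (ha : v a ≤ 1) (hb : v b ≤ 1) (hEa : v (E a) ≤ C)
    (hEb : v (E b) ≤ C) : v (E (a * b)) ≤ C := by
  rw [E.leibniz, smul_eq_mul, smul_eq_mul]
  refine (v.map_add _ _).trans (max_le ?_ ?_)
  · rw [map_mul]; exact (mul_le_of_le_one_left' ha).trans hEb
  · rw [map_mul]; exact (mul_le_of_le_one_left' hb).trans hEa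

theorem valuation_aeval_sub_le {K : Type*} [Field K] [Algebra K F]
    (hE : ∀ a, v (E (algebraMap K F a)) ≤ 1) {f : F}
    (hf : v f ≤ 1) (P : K[X]) :
    v (E (aeval f P) - aeval f (derivative P) * E f) ≤ 1 := by
  induction P using Polynomial.induction_on' with
  | add p q hp hq =>
    have : E (aeval f (p + q)) - aeval f (derivative (p + q)) * E f =
      (E (aeval f p) - aeval f (derivative p) * E f) +
        (E (aeval f q) - aeval f (derivative q) * E f) := by
      simp only [map_add]; ring
    rw [this]
    exact (v.map_add _ _).trans (max_le hp hq)
  | monomial n a =>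
    have : E (aeval f (monomial n a)) - aeval f (derivative (monomial n a)) * E f =
        f ^ n * E (algebraMap K F a) := by
      rw [aeval_monomial, derivative_monomial, aeval_monomial, E.leibniz, E.leibniz_pow]
      simp only [smul_eq_mul, nsmul_eq_mul, map_mul, _root_.map_natCast]
      ring
    rw [this, map_mul, map_pow]
    exact mul_le_one' (pow_le_one' hf n) (hE a)

end

theorem valuation_apply_le {k K A F : Type*} [CommRing k] [Field K] [CommRing A]
    [IsDedekindDomain A] [Field F] [CharZero F] [Algebra k F] [Algebra K A] [Algebra A F]
    [Algebra K F] [IsScalarTower K A F] [IsFractionRing A F] [Algebra.FiniteType K A]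
    (v : HeightOneSpectrum A) (E : Derivation k F F)
    (hE : ∀ a, v.valuation F (E (algebraMap K F a)) ≤ 1) {π : F}
    (hπ : v.valuation F π = exp (-1 : ℤ)) (hEπ : E π = 0) (f : F) :
    v.valuation F (E f) ≤ v.valuation F f := by
  have : CharZero K := (algebraMap K F).charZero
  have hπ0 : π ≠ 0 := by
    rintro rfl
    rw [map_zero] at hπ
    exact exp_ne_zero hπ.symm
  have hlift : ∀ C : ℤᵐ⁰, 1 ≤ C → (∀ a : A, v.valuation F (E (algebraMap A F a)) ≤ C) →
      ∀ x : F, v.valuation F x ≤ 1 → v.valuation F (E x) ≤ C := by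
    intro C hC h x hx
    obtain ⟨n, d, hnd⟩ := v.exists_primeCompl_mul_eq_of_integer x hx
    have hd : v.valuation F (algebraMap A F d) = 1 := v.valuation_eq_one_iff_notMem.2 d.2
    have h1 : algebraMap A F d * E x = E (algebraMap A F n) - x * E (algebraMap A F d) := by
      rw [← hnd, E.leibniz, smul_eq_mul, smul_eq_mul]; ring
    have h2 := congrArg (v.valuation F) h1
    rw [map_mul, hd, one_mul] at h2
    rw [h2]
    refine (Valuation.map_sub _ _ _).trans (max_le (h n) ?_)
    rw [map_mul]
    exact (mul_le_of_le_one_left' hx).trans (h d)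
  have hdesc : ∀ C : ℕ, (∀ x : F, v.valuation F x ≤ 1 → v.valuation F (E x) ≤ exp ((C : ℤ) + 1)) →
      ∀ a : A, v.valuation F (E (algebraMap A F a)) ≤ exp (C : ℤ) := by
    intro C hC a
    let _ : Field (A ⧸ v.asIdeal) := Ideal.Quotient.field v.asIdeal
    have : Module.Finite K (A ⧸ v.asIdeal) := finite_of_finite_type_of_isJacobsonRing K _
    let P := minpoly K (Ideal.Quotient.mk v.asIdeal a)
    have h_int : IsIntegral K (Ideal.Quotient.mk v.asIdeal a) := Algebra.IsIntegral.isIntegral _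
    have hmk : ∀ Q : K[X], Ideal.Quotient.mk v.asIdeal (aeval a Q) =
        aeval (Ideal.Quotient.mk v.asIdeal a) Q := fun Q =>
      (aeval_algHom_apply (Ideal.Quotient.mkₐ K v.asIdeal) a Q).symm
    have hF : ∀ Q : K[X], aeval (algebraMap A F a) Q = algebraMap A F (aeval a Q) := fun Q =>
      aeval_algebraMap_apply F a Q
    have h0 : v.valuation F (aeval (algebraMap A F a) P) < 1 := by
      rw [hF]
      refine (v.valuation_lt_one_iff_mem _).2 ?_
      rw [← Ideal.Quotient.eq_zero_iff_mem, hmk, minpoly.aeval]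
    have h1 : v.valuation F (aeval (algebraMap A F a) (derivative P)) = 1 := by
      rw [hF]
      refine v.valuation_eq_one_iff_notMem.2 fun h => ?_
      rw [← Ideal.Quotient.eq_zero_iff_mem, hmk] at h
      exact (minpoly.irreducible h_int).separable.aeval_derivative_ne_zero (minpoly.aeval _ _) h
    have h2 := valuation_aeval_sub_le (v.valuation F) E hE (v.valuation_le_one a) P
    have h3 : aeval (algebraMap A F a) P = π * (aeval (algebraMap A F a) P / π) := by
      field_simp
    have h4 : v.valuation F (aeval (algebraMap A F a) P / π) ≤ 1 := by
      rw [map_div₀, hπ]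
      refine div_le_one_of_le₀ ?_ zero_le
      by_cases hz : v.valuation F (aeval (algebraMap A F a) P) = 0
      · rw [hz]; exact zero_le
      · rw [← log_le_iff_le_exp hz]
        have := (log_lt_iff_lt_exp (a := (0 : ℤ)) hz).2 (by simpa using h0)
        lia
    have h5 : v.valuation F (E (aeval (algebraMap A F a) P)) ≤ exp (C : ℤ) := by
      rw [h3, E.leibniz, hEπ, smul_zero, add_zero, smul_eq_mul, map_mul, hπ]
      calc _ ≤ exp (-1 : ℤ) * exp ((C : ℤ) + 1) := mul_le_mul_right (hC _ h4) _
        _ = exp (C : ℤ) := by rw [← exp_add]; congr 1; ring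
    have h6 : aeval (algebraMap A F a) (derivative P) * E (algebraMap A F a) =
        E (aeval (algebraMap A F a) P) - (E (aeval (algebraMap A F a) P) -
          aeval (algebraMap A F a) (derivative P) * E (algebraMap A F a)) := by ring
    have h7 := congrArg (v.valuation F) h6
    rw [map_mul, h1, one_mul] at h7
    rw [h7]
    refine (Valuation.map_sub _ _ _).trans (max_le h5 (h2.trans ?_))
    rw [← exp_zero, exp_le_exp]
    exact Int.natCast_nonneg C
  have hex : ∃ C : ℕ, ∀ a : A, v.valuation F (E (algebraMap A F a)) ≤ exp (C : ℤ) := by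
    obtain ⟨S, hS⟩ := ‹Algebra.FiniteType K A›.out
    let c : A → ℕ := fun a => (log (v.valuation F (E (algebraMap A F a)))).toNat
    have hc : ∀ a, v.valuation F (E (algebraMap A F a)) ≤ exp (c a : ℤ) := fun a =>
      le_exp_of_log_le (Int.self_le_toNat _)
    refine ⟨S.sup c, fun a => ?_⟩
    have h1C : (1 : ℤᵐ⁰) ≤ exp ((S.sup c : ℕ) : ℤ) := by
      rw [← exp_zero, exp_le_exp]; exact Int.natCast_nonneg _
    have ha : a ∈ Algebra.adjoin K (S : Set A) := hS ▸ trivial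
    induction ha using Algebra.adjoin_induction with
    | mem x hx =>
      exact (hc x).trans (exp_le_exp.2 (by exact_mod_cast Finset.le_sup (f := c) hx))
    | algebraMap r =>
      rw [← IsScalarTower.algebraMap_apply K A F]; exact (hE r).trans h1C
    | add x y _ _ hx hy =>
      rw [map_add, map_add]; exact (Valuation.map_add _ _ _).trans (max_le hx hy)
    | mul x y _ _ hx hy =>
      rw [map_mul]
      exact valuation_mul_le _ E (v.valuation_le_one x) (v.valuation_le_one y) hx hy
  have hbase : ∀ a : A, v.valuation F (E (algebraMap A F a)) ≤ 1 := by
    obtain ⟨C, hC⟩ := hex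
    induction C with
    | zero => simpa using hC
    | succ C ih =>
      refine ih (hdesc C (hlift _ ?_ (by simpa using hC)))
      rw [← exp_zero, exp_le_exp]; positivity
  have hle := hlift 1 le_rfl hbase
  rcases eq_or_ne f 0 with rfl | hf
  · simp
  have hvf : v.valuation F f ≠ 0 := (Valuation.ne_zero_iff _).2 hf
  obtain ⟨n, hn⟩ : ∃ n : ℤ, v.valuation F f = v.valuation F (π ^ n) := by
    refine ⟨-log (v.valuation F f), ?_⟩
    rw [map_zpow₀, hπ, ← exp_zsmul]
    simp [hvf]
  have hEπn : E (π ^ n) = 0 := by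
    rw [E.leibniz_zpow, hEπ]; simp
  have hπn : v.valuation F (π ^ n) ≠ 0 := hn ▸ hvf
  have hu : v.valuation F (f / π ^ n) ≤ 1 := by
    rw [map_div₀, hn, div_self hπn]
  have hf' : f = π ^ n * (f / π ^ n) := by
    have : π ^ n ≠ 0 := zpow_ne_zero _ hπ0
    field_simp
  have hEf : E f = π ^ n * E (f / π ^ n) := by
    conv_lhs => rw [hf']
    rw [E.leibniz, hEπn]; simp
  rw [hEf, map_mul, hn]
  exact mul_le_of_le_one_right' (hle _ hu)

end Derivation

theorem FiniteDimensional.of_essFiniteType_of_isAlgebraic {k P L F : Type*} [Field k] [CommRing P]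
    [IsDomain P] [Field L] [Field F] [CharZero F] [Algebra k F] [Algebra k P] [Algebra P F]
    [IsScalarTower k P F] [Algebra P L] [IsFractionRing P L] [Algebra L F] [IsScalarTower P L F]
    [Algebra.EssFiniteType k F] {S : Set F} (hS : IntermediateField.adjoin k S = ⊤)
    (hP : ∀ s ∈ S, IsAlgebraic P s) : FiniteDimensional L F := by
  let _ : Algebra k L := ((algebraMap P L).comp (algebraMap k P)).toAlgebra
  have : IsScalarTower k P L := .of_algebraMap_eq fun _ => rfl
  have : IsScalarTower k L F := .of_algebraMap_eq fun x => by
    rw [IsScalarTower.algebraMap_apply k P L, ← IsScalarTower.algebraMap_apply P L F,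
      ← IsScalarTower.algebraMap_apply k P F]
  have : CharZero L := (algebraMap L F).charZero
  have : Algebra.EssFiniteType L F := .of_comp k L F
  have htop : (algebraicClosure L F).restrictScalars k = ⊤ := by
    rw [eq_top_iff, ← hS, IntermediateField.adjoin_le_iff]
    intro s hs
    exact mem_algebraicClosure_iff.2 ((hP s hs).extendScalars (IsFractionRing.injective P L))
  have : Algebra.IsAlgebraic L F := ⟨fun x => by
    have : x ∈ (algebraicClosure L F).restrictScalars k := htop ▸ IntermediateField.mem_top
    exact mem_algebraicClosure_iff.1 this⟩
  have := Algebra.FormallyEtale.of_isSeparable L F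
  exact Algebra.FormallyUnramified.finite_of_free L F

theorem exists_integralClosure_norm {A K F : Type*} [CommRing A] [IsDomain A]
    [IsIntegrallyClosed A] [IsNoetherianRing A] [Field K] [Field F] [CharZero F] [Algebra A K]
    [IsFractionRing A K] [Algebra A F] [Algebra K F] [IsScalarTower A K F]
    [FiniteDimensional K F] :
    ∃ N : integralClosure A F →* A, (∀ x, x ≠ 0 → N x ≠ 0) ∧
      (∀ x, ∃ w : integralClosure A F, algebraMap A F (N x) = x * w) ∧
      ∀ a, ∃ n, N (algebraMap A _ a) = a ^ n := by
  have : CharZero K := (algebraMap K F).charZero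
  have := integralClosure.isFractionRing_of_finite_extension (A := A) K F
  have : IsIntegrallyClosed (integralClosure A F) :=
    integralClosure.isIntegrallyClosedOfFiniteExtension K
  have : Module.Finite A (integralClosure A F) := IsIntegralClosure.finite A K F _
  have : FaithfulSMul A F := .trans A K F
  have : FaithfulSMul A (integralClosure A F) := .tower_bot A _ F
  have : Module.IsTorsionFree A (integralClosure A F) := inferInstance
  have hN := Algebra.algebraMap_intNorm (A := A) (K := K) (L := F) (B := integralClosure A F)
  refine ⟨Algebra.intNorm A (integralClosure A F), fun x hx h => hx ?_, fun x => ?_, fun a => ?_⟩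
  · have := hN x
    rw [h, map_zero] at this
    have := Algebra.norm_eq_zero_iff.1 this.symm
    exact Subtype.ext this
  · obtain ⟨w, hw⟩ := Algebra.dvd_algebraMap_intNorm_self A (integralClosure A F) x
    exact ⟨w, by rw [IsScalarTower.algebraMap_apply A (integralClosure A F) F, hw]; rfl⟩
  · refine ⟨Module.finrank K F, IsFractionRing.injective A K ?_⟩
    rw [hN, ← IsScalarTower.algebraMap_apply, IsScalarTower.algebraMap_apply A K F,
      Algebra.norm_algebraMap, map_pow]

theorem RingHom.IsIntegralElem.of_eq_comp {A B F : Type*} [CommRing A] [CommRing B] [CommRing F]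
    {f : A →+* F} {g : B →+* F} (e : A →+* B) (h : f = g.comp e) {x : F}
    (hx : f.IsIntegralElem x) : g.IsIntegralElem x := by
  obtain ⟨p, hp, hpx⟩ := hx
  exact ⟨p.map e, hp.map e, by rw [eval₂_map, ← h, hpx]⟩

open IsDedekindDomain in
theorem Polynomial.exists_heightOneSpectrum_integralClosure.{u, v} {K : Type u} {F : Type v}
    [Field K] [Field F] [CharZero F] [Algebra K F] [Algebra K[X] F] [IsScalarTower K K[X] F]
    [FaithfulSMul K[X] F] {L : Type*} [Field L] [Algebra K[X] L] [IsFractionRing K[X] L]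
    [Algebra L F] [IsScalarTower K[X] L F] [FiniteDimensional L F] {l : F}
    (hl : IsIntegral K[X] l) (hl0 : l ≠ 0) (hl' : ¬ IsIntegral K[X] l⁻¹) :
    ∃ (A : Type v) (_ : CommRing A) (_ : IsDedekindDomain A) (_ : Algebra K A) (_ : Algebra A F)
      (_ : IsScalarTower K A F) (_ : IsFractionRing A F) (_ : Algebra.FiniteType K A)
      (v : HeightOneSpectrum A), v.valuation F l < 1 ∧
      ∀ t, IsIntegral K[X] t → v.valuation F t ≤ 1 := by
  have : CharZero L := (algebraMap L F).charZero
  have hAD : IsDedekindDomain (integralClosure K[X] F) :=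
    integralClosure.isDedekindDomain K[X] L F
  have hAFr : IsFractionRing (integralClosure K[X] F) F :=
    integralClosure.isFractionRing_of_finite_extension L F
  have : Module.Finite K[X] (integralClosure K[X] F) := IsIntegralClosure.finite K[X] L F _
  have hAF : Algebra.FiniteType K (integralClosure K[X] F) :=
    .trans (S := K[X]) inferInstance inferInstance
  have hnu : ¬ IsUnit (⟨l, hl⟩ : integralClosure K[X] F) := by
    intro hu
    obtain ⟨w, hw⟩ := hu.exists_right_inv
    have hwl : (w : F) = l⁻¹ := eq_inv_of_mul_eq_one_right (congrArg Subtype.val hw)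
    exact hl' (hwl ▸ w.2)
  obtain ⟨M, hM, hlM⟩ := exists_max_ideal_of_mem_nonunits hnu
  let v : HeightOneSpectrum (integralClosure K[X] F) := ⟨M, hM.isPrime, fun h => hl0 (by
    rw [h, Ideal.mem_bot] at hlM
    exact congrArg Subtype.val hlM)⟩
  refine ⟨integralClosure K[X] F, inferInstance, hAD, inferInstance, inferInstance, inferInstance,
    hAFr, hAF, v, ?_, fun t ht => ?_⟩
  · exact (v.valuation_lt_one_iff_mem (K := F) ⟨l, hl⟩).2 hlM
  · exact v.valuation_le_one (K := F) ⟨t, ht⟩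

open IsDedekindDomain in
theorem AlgebraicIndependent.exists_heightOneSpectrum.{u, v} {k : Type u} {F : Type v} [Field k]
    [Field F] [CharZero F] [Algebra k F] [Algebra.EssFiniteType k F] {σ : Type} {y : σ → F}
    (hy : AlgebraicIndependent k y) {S : Set F} (hS : IntermediateField.adjoin k S = ⊤)
    (hSy : ∀ s ∈ S, ((MvPolynomial.aeval y : MvPolynomial σ k →ₐ[k] F) :
      MvPolynomial σ k →+* F).IsIntegralElem s) {l : F} (i : σ)
    (hly : ((MvPolynomial.aeval y : MvPolynomial σ k →ₐ[k] F) :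
      MvPolynomial σ k →+* F).IsIntegralElem l)
    (hl : ∀ h : MvPolynomial σ k, h ≠ 0 → h.degreeOf i = 0 →
      ¬ ((MvPolynomial.aeval y : MvPolynomial σ k →ₐ[k] F) :
        MvPolynomial σ k →+* F).IsIntegralElem (MvPolynomial.aeval y h * l⁻¹)) :
    ∃ (K : Type u) (_ : Field K) (_ : Algebra K F) (A : Type v) (_ : CommRing A)
      (_ : IsDedekindDomain A) (_ : Algebra K A) (_ : Algebra A F) (_ : IsScalarTower K A F)
      (_ : IsFractionRing A F) (_ : Algebra.FiniteType K A) (v : HeightOneSpectrum A),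
      v.valuation F l < 1 ∧
      (∀ t, ((MvPolynomial.aeval y : MvPolynomial σ k →ₐ[k] F) :
        MvPolynomial σ k →+* F).IsIntegralElem t → v.valuation F t ≤ 1) ∧
      ∀ f, f ∈ IntermediateField.adjoin k (y '' {i}ᶜ) ↔ ∃ a : K, algebraMap K F a = f := by
  classical
  let τ := {j : σ // j ≠ i}
  let R := MvPolynomial τ k
  let K := FractionRing R
  let φ : R →ₐ[k] F := MvPolynomial.aeval fun j : τ => y j
  have hφ : Function.Injective φ := hy.comp (Subtype.val : τ → σ) Subtype.val_injective
  let _ : Algebra R F := φ.toRingHom.toAlgebra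
  have hRF : ∀ r, algebraMap R F r = φ r := fun _ => rfl
  have : IsScalarTower k R F := .of_algebraMap_eq fun c => (φ.commutes c).symm
  have : FaithfulSMul R F := (faithfulSMul_iff_algebraMap_injective _ _).2 hφ
  let _ : Algebra K F := FractionRing.liftAlgebra R F
  have : IsScalarTower R K F := FractionRing.isScalarTower_liftAlgebra R F
  have hRK : ∀ r : R, algebraMap K F (algebraMap R K r) = φ r := fun r =>
    (IsScalarTower.algebraMap_apply R K F r).symm
  have : IsScalarTower k K F := .of_algebraMap_eq fun c => by
    rw [IsScalarTower.algebraMap_apply k R K, ← IsScalarTower.algebraMap_apply R K F,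
      ← IsScalarTower.algebraMap_apply k R F]
  let _ : Algebra K[X] F := (aeval (R := K) (y i)).toRingHom.toAlgebra
  have hPF : ∀ p : K[X], algebraMap K[X] F p = aeval (y i) p := fun _ => rfl
  have : IsScalarTower K K[X] F := .of_algebraMap_eq fun c => by rw [hPF]; simp
  have : IsScalarTower k K[X] F := .of_algebraMap_eq fun c => by
    rw [IsScalarTower.algebraMap_apply k K K[X], ← IsScalarTower.algebraMap_apply K K[X] F,
      ← IsScalarTower.algebraMap_apply k K F]
  -- the ring homomorphisms between the two presentations of the polynomial ring
  let e : R[X] →+* MvPolynomial σ k :=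
    eval₂RingHom (MvPolynomial.rename Subtype.val : R →ₐ[k] MvPolynomial σ k).toRingHom
      (MvPolynomial.X i)
  let e' : MvPolynomial σ k →ₐ[k] R[X] :=
    MvPolynomial.aeval fun j => if h : j = i then X else C (MvPolynomial.X ⟨j, h⟩)
  have heC : ∀ r, e (C r) = MvPolynomial.rename Subtype.val r := fun r => eval₂_C _ _
  have heX : e X = MvPolynomial.X i := eval₂_X _ _
  have he'r : ∀ r : R, e' (MvPolynomial.rename Subtype.val r) = C r := fun r => by
    rw [MvPolynomial.aeval_rename]
    have : ((fun j : σ => if h : j = i then X else C (MvPolynomial.X ⟨j, h⟩ : R)) ∘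
        (Subtype.val : τ → σ)) = fun j => C (MvPolynomial.X j) := by
      funext j
      simp [j.2]
    rw [this]
    exact (MvPolynomial.aeval_algebraMap_apply R[X] (MvPolynomial.X : τ → R) r).trans
      (congrArg C (MvPolynomial.aeval_X_left_apply r))
  have he'e : ∀ p, e' (e p) = p := fun p => by
    induction p using Polynomial.induction_on' with
    | add p q hp hq => rw [map_add, map_add, hp, hq]
    | monomial n r =>
      rw [← C_mul_X_pow_eq_monomial, map_mul, map_pow, heC, heX, map_mul, map_pow, he'r]
      simp [e']
  have hye : ∀ p, MvPolynomial.aeval y (e p) = aeval (y i) p := fun p => by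
    induction p using Polynomial.induction_on' with
    | add p q hp hq => rw [map_add, map_add, hp, hq, map_add]
    | monomial n r =>
      rw [← C_mul_X_pow_eq_monomial, map_mul, map_pow, heC, heX, map_mul, map_pow, map_mul,
        map_pow, MvPolynomial.aeval_X, aeval_X, aeval_C, MvPolynomial.aeval_rename]
      rfl
  have hye' : ∀ p, MvPolynomial.aeval y p = aeval (y i) (e' p) := fun p => by
    have : MvPolynomial.aeval y = ((aeval (R := R) (y i)).restrictScalars k).comp e' := by
      refine MvPolynomial.algHom_ext fun j => ?_
      by_cases h : j = i
      · simp [e', h]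
      · simp only [e', MvPolynomial.aeval_X, AlgHom.comp_apply, dif_neg h,
          AlgHom.restrictScalars_apply, aeval_C, hRF, φ]
        exact (MvPolynomial.aeval_X (R := k) (fun j : τ => y j) ⟨j, h⟩).symm
    rw [this]; rfl
  have hRX : ∀ p : R[X], aeval (y i) p = algebraMap K[X] F (p.map (algebraMap R K)) := by
    intro p
    rw [hPF, aeval_map_algebraMap]
  have htr : Transcendental R (y i) := by
    rw [transcendental_iff_injective]
    intro p q hpq
    rw [← he'e p, ← he'e q]
    congr 1
    apply hy
    rw [hye, hye]; exact hpq
  have htrK : Transcendental K (y i) := fun h =>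
    htr ((IsFractionRing.isAlgebraic_iff R K F).2 h)
  have : FaithfulSMul K[X] F :=
    (faithfulSMul_iff_algebraMap_injective _ _).2 (transcendental_iff_injective.1 htrK)
  have h_int : ∀ t, ((MvPolynomial.aeval y : MvPolynomial σ k →ₐ[k] F) :
      MvPolynomial σ k →+* F).IsIntegralElem t → IsIntegral K[X] t := fun t ht =>
    RingHom.IsIntegralElem.of_eq_comp
      ((mapRingHom (algebraMap R K)).comp (e' : MvPolynomial σ k →+* R[X]))
      (RingHom.ext fun p => (hye' p).trans (hRX _)) ht
  let _ : Algebra (FractionRing K[X]) F := FractionRing.liftAlgebra K[X] F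
  have : IsScalarTower K[X] (FractionRing K[X]) F := FractionRing.isScalarTower_liftAlgebra K[X] F
  have : CharZero (FractionRing K[X]) := (algebraMap (FractionRing K[X]) F).charZero
  have : FiniteDimensional (FractionRing K[X]) F :=
    .of_essFiniteType_of_isAlgebraic (P := K[X]) hS fun s hs => (h_int s (hSy s hs)).isAlgebraic
  have hl0 : l ≠ 0 := by
    rintro rfl
    refine hl 1 one_ne_zero ?_ ?_
    · exact MvPolynomial.degreeOf_C (1 : k) i
    · rw [inv_zero, mul_zero]
      exact RingHom.isIntegralElem_zero _
  have hnu : ¬ IsIntegral K[X] l⁻¹ := by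
    intro hli
    let _ : Algebra R[X] F := (aeval (R := R) (y i)).toRingHom.toAlgebra
    let _ : Algebra R[X] K[X] := (mapRingHom (algebraMap R K)).toAlgebra
    have : IsScalarTower R[X] K[X] F := .of_algebraMap_eq hRX
    have : IsLocalization ((nonZeroDivisors R).map (C : R →+* R[X])) K[X] :=
      Polynomial.isLocalization _ _
    obtain ⟨⟨_, h, hh, rfl⟩, hm⟩ := IsIntegral.exists_multiple_integral_of_isLocalization
      ((nonZeroDivisors R).map (C : R →+* R[X])) _ hli
    have hm' : (algebraMap R[X] F).IsIntegralElem (algebraMap R[X] F (C h) * l⁻¹) := by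
      rw [← Algebra.smul_def]; exact hm
    refine hl (MvPolynomial.rename Subtype.val h) ?_ ?_ ?_
    · rw [Ne, ← map_zero (MvPolynomial.rename (Subtype.val : τ → σ)),
        (MvPolynomial.rename_injective _ Subtype.val_injective).eq_iff]
      exact nonZeroDivisors.ne_zero hh
    · by_contra hd
      obtain ⟨j, -, hj⟩ := MvPolynomial.mem_vars_rename _ _
        (MvPolynomial.mem_vars_iff_degreeOf_ne_zero.2 hd)
      exact j.2 hj
    · rw [← heC, hye]
      exact RingHom.IsIntegralElem.of_eq_comp e (RingHom.ext fun p => (hye p).symm) hm'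
  obtain ⟨A, _, hAD, iKA, iAF, hKAF, hAFr, hAF, v, hvl, hv⟩ :=
    Polynomial.exists_heightOneSpectrum_integralClosure (L := FractionRing K[X]) (h_int l hly)
      hl0 hnu
  have hR : ∀ r : R, φ r ∈ IntermediateField.adjoin k (y '' {i}ᶜ) := by
    intro r
    induction r using MvPolynomial.induction_on with
    | C c => rw [MvPolynomial.algHom_C]; exact IntermediateField.algebraMap_mem _ c
    | add p q hp hq => rw [map_add]; exact add_mem hp hq
    | mul_X p j hp =>
      rw [map_mul]
      refine mul_mem hp (IntermediateField.subset_adjoin k _ ?_)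
      exact ⟨j, j.2, (MvPolynomial.aeval_X (R := k) (fun j : τ => y j) j).symm⟩
  refine ⟨K, inferInstance, inferInstance, A, inferInstance, hAD, iKA, iAF, hKAF, hAFr, hAF, v,
    hvl, fun t ht => hv t (h_int t ht), fun f => ⟨fun hf => ?_, ?_⟩⟩
  · have : IntermediateField.adjoin k (y '' {i}ᶜ) ≤ (IsScalarTower.toAlgHom k K F).fieldRange := by
      rw [IntermediateField.adjoin_le_iff]
      rintro _ ⟨j, hj, rfl⟩
      exact ⟨algebraMap R K (MvPolynomial.X ⟨j, hj⟩), (hRK _).trans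
        (MvPolynomial.aeval_X (R := k) (fun j : τ => y j) ⟨j, hj⟩)⟩
    exact this hf
  · rintro ⟨a, rfl⟩
    obtain ⟨r, s, hs, rfl⟩ := IsFractionRing.div_surjective (A := R) a
    rw [map_div₀, hRK, hRK]
    exact div_mem (hR r) (hR s)

theorem AlgebraicIndependent.exists_forall_not_isIntegralElem {k F : Type*} [Field k]
    [Field F] [CharZero F] [Algebra k F] [Algebra.EssFiniteType k F] {σ : Type*} [Finite σ]
    {y : σ → F} (hy : AlgebraicIndependent k y) {S : Set F}
    (hS : IntermediateField.adjoin k S = ⊤)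
    (hSy : ∀ s ∈ S, ((MvPolynomial.aeval y : MvPolynomial σ k →ₐ[k] F) :
      MvPolynomial σ k →+* F).IsIntegralElem s) (O : ValuationSubring F)
    (hkO : ∀ c : k, algebraMap k F c ∈ O) (hyO : ∀ j, y j ∈ O) {l : F} (hl0 : l ≠ 0)
    (hlO : O.valuation l < 1)
    (hly : ((MvPolynomial.aeval y : MvPolynomial σ k →ₐ[k] F) :
      MvPolynomial σ k →+* F).IsIntegralElem l) :
    ∃ i, ∀ h : MvPolynomial σ k, h ≠ 0 → h.degreeOf i = 0 →
      ¬ ((MvPolynomial.aeval y : MvPolynomial σ k →ₐ[k] F) :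
        MvPolynomial σ k →+* F).IsIntegralElem (MvPolynomial.aeval y h * l⁻¹) := by
  let φ : MvPolynomial σ k →ₐ[k] F := MvPolynomial.aeval y
  let _ : Algebra (MvPolynomial σ k) F := φ.toRingHom.toAlgebra
  have hφ : ∀ p, algebraMap (MvPolynomial σ k) F p = φ p := fun _ => rfl
  have : IsScalarTower k (MvPolynomial σ k) F := .of_algebraMap_eq fun c => (φ.commutes c).symm
  have : FaithfulSMul (MvPolynomial σ k) F := (faithfulSMul_iff_algebraMap_injective _ _).2 hy
  let K := FractionRing (MvPolynomial σ k)
  let _ : Algebra K F := FractionRing.liftAlgebra (MvPolynomial σ k) F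
  have : IsScalarTower (MvPolynomial σ k) K F :=
    FractionRing.isScalarTower_liftAlgebra (MvPolynomial σ k) F
  have : FiniteDimensional K F := .of_essFiniteType_of_isAlgebraic (P := MvPolynomial σ k) hS
    fun s hs => IsIntegral.isAlgebraic (R := MvPolynomial σ k) (hSy s hs)
  obtain ⟨N, hN0, hNw, hNa⟩ :=
    exists_integralClosure_norm (A := MvPolynomial σ k) (K := K) (F := F)
  have hφO : ∀ p, φ p ∈ O := fun p => by
    induction p using MvPolynomial.induction_on with
    | C c => rw [MvPolynomial.algHom_C]; exact hkO c
    | add p q hp hq => rw [map_add]; exact add_mem hp hq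
    | mul_X p j hp => rw [map_mul, MvPolynomial.aeval_X]; exact mul_mem hp (hyO j)
  have hwO : ∀ w : integralClosure (MvPolynomial σ k) F, (w : F) ∈ O := fun w => by
    have hw : IsIntegral O (w : F) := RingHom.IsIntegralElem.of_eq_comp
      ((φ : MvPolynomial σ k →+* F).codRestrict O.toSubring hφO) rfl w.2
    obtain ⟨z, hz⟩ := IsIntegrallyClosed.isIntegral_iff.1 hw
    rw [← hz]
    exact z.2
  let l' : integralClosure (MvPolynomial σ k) F := ⟨l, hly⟩
  have hl'0 : l' ≠ 0 := fun h => hl0 (congrArg Subtype.val h)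
  have hvars : (N l').vars ≠ ∅ := by
    intro hv
    rw [MvPolynomial.vars_eq_empty_iff_eq_C] at hv
    obtain ⟨w, hw⟩ := hNw l'
    have hc0 : MvPolynomial.coeff 0 (N l') ≠ 0 := fun h => hN0 _ hl'0 (by rw [hv, h, map_zero])
    rw [hv, hφ, MvPolynomial.algHom_C] at hw
    have h1 : O.valuation (algebraMap k F (MvPolynomial.coeff 0 (N l'))) < 1 := by
      rw [hw, map_mul]
      exact mul_lt_one_of_nonneg_of_lt_one_left zero_le hlO
        ((O.valuation_le_one_iff _).2 (hwO w))
    have h2 := (O.valuation_le_one_iff _).2 (hkO (MvPolynomial.coeff 0 (N l'))⁻¹)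
    have h3 : O.valuation (algebraMap k F (MvPolynomial.coeff 0 (N l'))) *
        O.valuation (algebraMap k F (MvPolynomial.coeff 0 (N l'))⁻¹) = 1 := by
      rw [← map_mul, ← map_mul, mul_inv_cancel₀ hc0, map_one, map_one]
    exact absurd h3 (mul_lt_one_of_nonneg_of_lt_one_left zero_le h1 h2).ne
  obtain ⟨i, hi⟩ := Finset.nonempty_iff_ne_empty.2 hvars
  rw [MvPolynomial.mem_vars_iff_degreeOf_ne_zero] at hi
  refine ⟨i, fun h hh hd h_int => hi ?_⟩
  let μ : integralClosure (MvPolynomial σ k) F := ⟨_, h_int⟩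
  obtain ⟨n, hn⟩ := hNa h
  have hmul : l' * μ = algebraMap (MvPolynomial σ k) _ h := Subtype.ext (by
    change l * (MvPolynomial.aeval y h * l⁻¹) = MvPolynomial.aeval y h
    field_simp)
  rw [← hmul, map_mul] at hn
  have hμ : N μ ≠ 0 := fun h0 => pow_ne_zero n hh (by rw [← hn, h0, mul_zero])
  have := congrArg (MvPolynomial.degreeOf i) hn
  rw [MvPolynomial.degreeOf_mul_eq (hN0 _ hl'0) hμ, MvPolynomial.degreeOf_pow_eq _ _ _ hh, hd]
    at this
  omega

open IsDedekindDomain in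
theorem ValuationSubring.exists_heightOneSpectrum.{u, v} {k : Type u} {F : Type v} [Field k]
    [Field F] [CharZero F] [Algebra k F] [Algebra.EssFiniteType k F] (O : ValuationSubring F)
    (hkO : ∀ c : k, algebraMap k F c ∈ O) {l : F} (hl0 : l ≠ 0) (hlO : O.valuation l < 1)
    {T : Set F} (hT : T.Finite) (hTO : T ⊆ O) :
    ∃ (d : ℕ) (y : Fin d → F) (i : Fin d) (K : Type u) (_ : Field K) (_ : Algebra K F)
      (A : Type v) (_ : CommRing A) (_ : IsDedekindDomain A) (_ : Algebra K A) (_ : Algebra A F)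
      (_ : IsScalarTower K A F) (_ : IsFractionRing A F) (_ : Algebra.FiniteType K A)
      (v : HeightOneSpectrum A), AlgebraicIndependent k y ∧ v.valuation F l < 1 ∧
      (∀ t ∈ T, v.valuation F t ≤ 1) ∧
      ∀ f, f ∈ IntermediateField.adjoin k (y '' {i}ᶜ) ↔ ∃ a : K, algebraMap K F a = f := by
  classical
  obtain ⟨S, hS⟩ := IntermediateField.fg_top k F
  let S' : Finset F := S.image fun s => if s ∈ O then s else s⁻¹
  have hS' : IntermediateField.adjoin k (S' : Set F) = ⊤ := by
    refine top_unique ?_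
    rw [← hS, IntermediateField.adjoin_le_iff]
    intro s hs
    have hm : (if s ∈ O then s else s⁻¹) ∈ IntermediateField.adjoin k (S' : Set F) :=
      IntermediateField.subset_adjoin k _ (Finset.mem_coe.2 (Finset.mem_image_of_mem _ hs))
    split_ifs at hm
    · exact hm
    · exact inv_inv s ▸ inv_mem hm
  let G : Finset F := insert l (S' ∪ hT.toFinset)
  have hGO : ∀ g ∈ G, g ∈ O := by
    intro g hg
    simp only [G, S', Finset.mem_insert, Finset.mem_union, Finset.mem_image,
      Set.Finite.mem_toFinset] at hg
    rcases hg with rfl | ⟨s, -, rfl⟩ | hg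
    · exact (O.valuation_le_one_iff _).1 hlO.le
    · split_ifs with h
      · exact h
      · exact (O.mem_or_inv_mem s).resolve_left h
    · exact hTO hg
  let C₀ := Algebra.adjoin k (G : Set F)
  have : Algebra.FiniteType k C₀ := (Subalgebra.fg_iff_finiteType _).1 ⟨G, rfl⟩
  have hCO : ∀ c ∈ C₀, c ∈ O := fun c hc => by
    induction hc using Algebra.adjoin_induction with
    | mem g hg => exact hGO g hg
    | algebraMap c => exact hkO c
    | add a b _ _ ha hb => exact O.add_mem _ _ ha hb
    | mul a b _ _ ha hb => exact O.mul_mem _ _ ha hb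
  obtain ⟨d, g, hg, hfin⟩ := exists_finite_inj_algHom_of_fg k C₀
  let y : Fin d → F := fun j => g (MvPolynomial.X j)
  have hyg : MvPolynomial.aeval y = C₀.val.comp g :=
    MvPolynomial.algHom_ext fun j => MvPolynomial.aeval_X _ _
  have hy : AlgebraicIndependent k y := by
    rw [AlgebraicIndependent, hyg]
    exact Subtype.val_injective.comp hg
  have hGy : ∀ s ∈ G, ((MvPolynomial.aeval y : MvPolynomial (Fin d) k →ₐ[k] F) :
      MvPolynomial (Fin d) k →+* F).IsIntegralElem s := fun s hs => by
    obtain ⟨p, hp, hps⟩ := hfin.to_isIntegral ⟨s, Algebra.subset_adjoin hs⟩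
    refine ⟨p, hp, ?_⟩
    rw [hyg]
    have := congrArg C₀.val hps
    rw [map_zero] at this
    rw [← this]
    exact (Polynomial.hom_eval₂ p (g : MvPolynomial (Fin d) k →+* C₀) C₀.val.toRingHom
      ⟨s, Algebra.subset_adjoin hs⟩).symm
  have hSy : ∀ s ∈ (S' : Set F), ((MvPolynomial.aeval y : MvPolynomial (Fin d) k →ₐ[k] F) :
      MvPolynomial (Fin d) k →+* F).IsIntegralElem s := fun s hs =>
    hGy s (Finset.mem_insert_of_mem (Finset.mem_union_left _ hs))
  have hly := hGy l (Finset.mem_insert_self _ _)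
  obtain ⟨i, hi⟩ := hy.exists_forall_not_isIntegralElem hS' hSy O hkO
    (fun j => hCO _ (g (MvPolynomial.X j)).2) hl0 hlO hly
  obtain ⟨K, iK, iKF, A, iA, hA, iKA, iAF, hKAF, hAF, hft, v, hvl, hv, hK⟩ :=
    hy.exists_heightOneSpectrum hS' hSy i hly hi
  exact ⟨d, y, i, K, iK, iKF, A, iA, hA, iKA, iAF, hKAF, hAF, hft, v, hy, hvl, fun t ht =>
    hv t (hGy t (Finset.mem_insert_of_mem (Finset.mem_union_right _ (hT.mem_toFinset.2 ht)))), hK⟩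

theorem Derivation.apply_mem_intermediateField_adjoin {k L F : Type*} [Field k] [Field L] [Field F]
    [Algebra k F] [Algebra L F] (E : Derivation k F F) {S : Set F}
    (hL : ∀ c : L, E (algebraMap L F c) ∈ IntermediateField.adjoin L S)
    (hS : ∀ s ∈ S, E s ∈ IntermediateField.adjoin L S) {a : F}
    (ha : a ∈ IntermediateField.adjoin L S) : E a ∈ IntermediateField.adjoin L S := by
  induction ha using IntermediateField.adjoin_induction with
  | mem s hs => exact hS s hs
  | algebraMap c => exact hL c
  | add a b _ _ ha hb => rw [map_add]; exact add_mem ha hb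
  | inv a ha' ha =>
    rw [Derivation.leibniz_inv, smul_eq_mul]
    exact mul_mem (neg_mem (pow_mem (inv_mem ha') 2)) ha
  | mul a b ha' hb' ha hb =>
    rw [Derivation.leibniz, smul_eq_mul, smul_eq_mul]
    exact add_mem (mul_mem ha' hb) (mul_mem hb' ha)

theorem Derivation.exists_of_range_subset {k K F : Type*} [Field k] [Field K] [Field F]
    [Algebra k F] [Algebra K F] (h : ∀ c : k, ∃ a : K, algebraMap K F a = algebraMap k F c)
    (E : Derivation K F F) : ∃ E' : Derivation k F F, ∀ x, E' x = E x :=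
  have hsmul : ∀ (c : k) (x : F), E (c • x) = c • E x := fun c x => by
    obtain ⟨a, ha⟩ := h c
    simp only [Algebra.smul_def c, ← ha]
    rw [← Algebra.smul_def, map_smul, Algebra.smul_def]
  ⟨Derivation.mk' { toFun := E, map_add' := map_add E, map_smul' := hsmul } E.leibniz, fun _ => rfl⟩

open IsDedekindDomain in
theorem IsDedekindDomain.HeightOneSpectrum.transcendental_of_valuation_lt_one {K A F : Type*}
    [Field K] [CommRing A] [IsDedekindDomain A] [Field F] [Algebra K A] [Algebra A F]
    [Algebra K F] [IsScalarTower K A F] [IsFractionRing A F] (v : HeightOneSpectrum A) {p : F}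
    (hp0 : p ≠ 0) (hp : v.valuation F p < 1) : Transcendental K p := by
  intro halg
  have h_int : IsIntegral A p⁻¹ := (halg.inv.isIntegral).tower_top
  obtain ⟨a, ha⟩ := IsIntegrallyClosed.isIntegral_iff.1 h_int
  have h1 : v.valuation F p⁻¹ ≤ 1 := ha ▸ v.valuation_le_one a
  have h2 : v.valuation F p * v.valuation F p⁻¹ = 1 := by
    rw [← map_mul, mul_inv_cancel₀ hp0, map_one]
  exact absurd h2 (mul_lt_one_of_nonneg_of_lt_one_left zero_le hp h1).ne

open IsDedekindDomain in
theorem Derivation.exists_apply_ne_sum {k F ι : Type*} [Field k] [Field F] [CharZero F]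
    [Algebra k F] [Algebra.EssFiniteType k F] (O : ValuationSubring F) {z : F}
    (hz : Transcendental k z) (hzO : ∀ a ∈ IntermediateField.adjoin k {z}, a ∈ O)
    (s : Finset ι) (c f : ι → F) (hc : ∀ i, O.valuation (c i) < 1) :
    ∃ E : Derivation k F F, E z ≠ ∑ i ∈ s, c i * (E (f i) / f i) := by
  classical
  by_contra! hrel
  have : CharZero k := (algebraMap k F).charZero
  obtain ⟨E₀, hE₀⟩ := Derivation.exists_apply_eq_of_transcendental hz (1 : F)
  have hs : s.Nonempty := by
    by_contra hs
    rw [Finset.not_nonempty_iff_eq_empty] at hs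
    have := hrel E₀
    rw [hs, hE₀, Finset.sum_empty] at this
    exact one_ne_zero this
  obtain ⟨i₀, hi₀, hmax⟩ := s.exists_max_image (fun i => O.valuation (c i)) hs
  have hc0 : c i₀ ≠ 0 := by
    intro h0
    have h := hrel E₀
    rw [hE₀, Finset.sum_eq_zero] at h
    · exact one_ne_zero h
    · intro i hi
      have := hmax i hi
      rw [h0, map_zero, le_zero_iff, map_eq_zero] at this
      rw [this, zero_mul]
  let k₀ := IntermediateField.adjoin k {z}
  have : Algebra.EssFiniteType k₀ F := .of_comp k k₀ F
  obtain ⟨d, y, i, K, _, _, A, _, _, _, _, _, _, _, v, hy, hv, hvT, hK⟩ :=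
    O.exists_heightOneSpectrum (k := k₀) (fun a => hzO _ a.2) hc0 (hc i₀)
      (T := (s.image fun j => c j / c i₀ : Finset F)) (Finset.finite_toSet _) (by
        intro t ht
        obtain ⟨j, hj, rfl⟩ := Finset.mem_image.1 (Finset.mem_coe.1 ht)
        rw [SetLike.mem_coe, ← O.valuation_le_one_iff, map_div₀]
        exact div_le_one_of_le₀ (hmax j hj) zero_le)
  have hvc : ∀ j ∈ s, v.valuation F (c j) < 1 := fun j hj => by
    rw [← div_mul_cancel₀ (c j) hc0, map_mul]
    exact mul_lt_one_of_nonneg_of_lt_one_right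
      (hvT _ (Finset.mem_coe.2 (Finset.mem_image_of_mem _ hj))) zero_le hv
  have hvK : ∀ a : K, v.valuation F (algebraMap K F a) ≤ 1 := fun a => by
    rw [IsScalarTower.algebraMap_apply K A F]
    exact v.valuation_le_one _
  obtain ⟨D', hD'⟩ := Derivation.exists_apply_eq_of_algebraicIndependent hy fun j => E₀ (y j)
  let E₁ : Derivation k F F := E₀ - D'.restrictScalars k
  have hE₁ : ∀ x, E₁ x = E₀ x - D' x := fun _ => rfl
  have hE₁z : E₁ z = 1 := by
    have : D' z = 0 := D'.map_algebraMap
      (⟨z, IntermediateField.subset_adjoin k _ (Set.mem_singleton z)⟩ : k₀)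
    rw [hE₁, hE₀, this, sub_zero]
  have hE₁k : ∀ a ∈ k₀, E₁ a ∈ k₀ := fun a ha =>
    E₁.apply_mem_intermediateField_adjoin (fun c => by rw [E₁.map_algebraMap]; exact zero_mem _)
      (fun t ht => by rw [Set.mem_singleton_iff.1 ht, hE₁z]; exact one_mem _) ha
  have hE₁K : ∀ a : K, ∃ a' : K, algebraMap K F a' = E₁ (algebraMap K F a) := fun a =>
    (hK _).1 (E₁.apply_mem_intermediateField_adjoin
      (fun c => IntermediateField.algebraMap_mem _ (⟨_, hE₁k _ c.2⟩ : k₀))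
      (by
        rintro _ ⟨j, -, rfl⟩
        rw [hE₁, hD', sub_self]
        exact zero_mem _) ((hK _).2 ⟨a, rfl⟩))
  obtain ⟨p, hp⟩ := v.valuation_exists_uniformizer F
  have hp0 : p ≠ 0 := by
    rintro rfl
    rw [map_zero] at hp
    exact WithZero.exp_ne_zero hp.symm
  have hp1 : v.valuation F p < 1 := by
    rw [hp, ← WithZero.exp_zero, WithZero.exp_lt_exp]
    decide
  have : CharZero K := (algebraMap K F).charZero
  obtain ⟨d₀, hd₀⟩ := Derivation.exists_apply_eq_of_transcendental
    (v.transcendental_of_valuation_lt_one (K := K) hp0 hp1) (1 : F)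
  obtain ⟨d₁, hd₁⟩ := Derivation.exists_of_range_subset (k := k) (fun a =>
    (hK _).1 (IntermediateField.algebraMap_mem _ (algebraMap k k₀ a))) d₀
  let E : Derivation k F F := E₁ - E₁ p • d₁
  have hE : ∀ x, E x = E₁ x - E₁ p * d₁ x := fun _ => rfl
  have hEK : ∀ a : K, E (algebraMap K F a) = E₁ (algebraMap K F a) := fun a => by
    rw [hE, hd₁, d₀.map_algebraMap, mul_zero, sub_zero]
  have hEz : E z = 1 := by
    obtain ⟨a, ha⟩ := (hK z).1 (IntermediateField.algebraMap_mem _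
      (⟨z, IntermediateField.subset_adjoin k _ (Set.mem_singleton z)⟩ : k₀))
    rw [← ha, hEK, ha, hE₁z]
  have hval := Derivation.valuation_apply_le v E (fun a => by
    obtain ⟨a', ha'⟩ := hE₁K a
    rw [hEK, ← ha']
    exact hvK a') hp (by rw [hE, hd₁, hd₀, mul_one, sub_self])
  have h1 : v.valuation F (∑ i ∈ s, c i * (E (f i) / f i)) < 1 := by
    refine Valuation.map_sum_lt _ one_ne_zero fun j hj => ?_
    rw [map_mul, map_div₀]
    exact mul_lt_one_of_nonneg_of_lt_one_left zero_le (hvc j hj)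
      (div_le_one_of_le₀ (hval _) zero_le)
  rw [← hrel E, hEz, map_one] at h1
  exact lt_irrefl _ h1

theorem Derivation.exists_apply_eq_one_and_forall_mem {k F ι : Type*} [Field k] [Field F]
    [CharZero F] [Algebra k F] [Algebra.EssFiniteType k F] (O : ValuationSubring F) {z : F}
    (hz : Transcendental k z) (hzO : ∀ a ∈ IntermediateField.adjoin k {z}, a ∈ O)
    (s : Finset ι) (f : ι → F) :
    ∃ E : Derivation k F F, E z = 1 ∧ ∀ i ∈ s, E (f i) / f i ∈ O := by
  let ev : F → Derivation k F F →ₗ[F] F := fun x =>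
    { toFun := fun E => E x
      map_add' := fun _ _ => rfl
      map_smul' := fun _ _ => rfl }
  rcases O.exists_mem_or_eq_sum (ev z) s (fun i => (f i)⁻¹ • ev (f i)) ⊤ with
    ⟨E, -, hE, hEs⟩ | ⟨c, hc, hcE⟩
  · refine ⟨E, hE, fun i hi => ?_⟩
    rw [div_eq_inv_mul]
    exact hEs i hi
  · obtain ⟨E, hE⟩ := Derivation.exists_apply_ne_sum O hz hzO s c f hc
    refine (hE ((hcE E trivial).trans (Finset.sum_congr rfl fun i _ => ?_))).elim
    rw [div_eq_inv_mul]
    rfl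

theorem Polynomial.degree_le_degree_iff_of_mul_eq_mul {K : Type*} [Field K] {a b c d : K[X]}
    (hb : b ≠ 0) (hd : d ≠ 0) (h : a * d = c * b) :
    a.degree ≤ b.degree ↔ c.degree ≤ d.degree := by
  by_cases ha : a = 0
  · have hc : c = 0 := by simpa [ha, hb] using h.symm
    simp [ha, hc]
  have hc : c ≠ 0 := by
    rintro rfl
    simp_all
  have := congrArg natDegree h
  rw [natDegree_mul ha hd, natDegree_mul hc hb] at this
  rw [degree_eq_natDegree ha, degree_eq_natDegree hb, degree_eq_natDegree hc,
    degree_eq_natDegree hd, Nat.cast_le, Nat.cast_le]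
  omega

open Filter in
theorem Ultrafilter.exists_valuationSubring_polynomial {B F ι : Type*} [CommRing B] [IsDomain B]
    [Field F] [Algebra B F] [IsFractionRing B F] (l : Ultrafilter ι) {K : ι → Type*}
    [∀ i, Field (K i)] (φ : ∀ i, B →+* (K i)[X]) (hφ : ∀ b ≠ 0, ∀ᶠ i in l, φ i b ≠ 0) :
    ∃ O : ValuationSubring F, ∀ a b : B, b ≠ 0 →
      (algebraMap B F a / algebraMap B F b ∈ O ↔ ∀ᶠ i in l, (φ i a).degree ≤ (φ i b).degree) ∧
      (O.valuation (algebraMap B F a / algebraMap B F b) < 1 ↔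
        ∀ᶠ i in l, (φ i a).degree < (φ i b).degree) := by
  have hinj := IsFractionRing.injective B F
  have hne : ∀ b : B, b ≠ 0 → algebraMap B F b ≠ 0 := fun b hb h =>
    hb (hinj (h.trans (map_zero _).symm))
  have hfrac : ∀ x : F, ∃ a b : B, b ≠ 0 ∧ algebraMap B F a / algebraMap B F b = x := fun x => by
    obtain ⟨a, b, hb, h⟩ := IsFractionRing.div_surjective (A := B) x
    exact ⟨a, b, nonZeroDivisors.ne_zero hb, h⟩
  let P : F → Prop := fun x => ∃ a b : B, b ≠ 0 ∧ algebraMap B F a / algebraMap B F b = x ∧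
    ∀ᶠ i in l, (φ i a).degree ≤ (φ i b).degree
  have hP : ∀ a b : B, b ≠ 0 → (P (algebraMap B F a / algebraMap B F b) ↔
      ∀ᶠ i in l, (φ i a).degree ≤ (φ i b).degree) := by
    refine fun a b hb => ⟨?_, fun h => ⟨a, b, hb, rfl, h⟩⟩
    rintro ⟨c, d, hd, hcd, h⟩
    rw [div_eq_div_iff (hne d hd) (hne b hb), ← map_mul, ← map_mul] at hcd
    have hcd := hinj hcd
    filter_upwards [h, hφ b hb, hφ d hd] with i hi hbi hdi
    exact (degree_le_degree_iff_of_mul_eq_mul hdi hbi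
      (by rw [← map_mul, ← map_mul, hcd])).1 hi
  let O : ValuationSubring F :=
    { carrier := {x | P x}
      mul_mem' := by
        rintro _ _ ⟨a, b, hb, rfl, h⟩ ⟨c, d, hd, rfl, h'⟩
        refine ⟨a * c, b * d, mul_ne_zero hb hd, by rw [map_mul, map_mul, div_mul_div_comm], ?_⟩
        filter_upwards [h, h'] with i hi hi'
        rw [map_mul, map_mul, degree_mul, degree_mul]
        exact add_le_add hi hi'
      one_mem' := ⟨1, 1, one_ne_zero, by simp, by simp⟩
      add_mem' := by
        rintro _ _ ⟨a, b, hb, rfl, h⟩ ⟨c, d, hd, rfl, h'⟩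
        refine ⟨a * d + b * c, b * d, mul_ne_zero hb hd, ?_, ?_⟩
        · rw [div_add_div _ _ (hne b hb) (hne d hd)]
          simp only [map_add, map_mul]
        filter_upwards [h, h'] with i hi hi'
        simp only [map_add, map_mul]
        refine (degree_add_le _ _).trans ?_
        simp only [degree_mul]
        exact max_le (by gcongr) (by gcongr)
      zero_mem' := ⟨0, 1, one_ne_zero, by simp, by simp⟩
      neg_mem' := by
        rintro _ ⟨a, b, hb, rfl, h⟩
        exact ⟨-a, b, hb, by rw [map_neg, neg_div], by simpa using h⟩
      mem_or_inv_mem' := by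
        intro x
        obtain ⟨a, b, hb, rfl⟩ := hfrac x
        by_cases ha : a = 0
        · exact Or.inl ⟨0, 1, one_ne_zero, by simp [ha], by simp⟩
        rw [inv_div]
        rcases Ultrafilter.eventually_or.1 (Eventually.of_forall fun i =>
          le_total (φ i a).degree (φ i b).degree : ∀ᶠ i in l, _) with h | h
        · exact Or.inl ⟨a, b, hb, rfl, h⟩
        · exact Or.inr ⟨b, a, ha, rfl, h⟩ }
  have hO : ∀ a b : B, b ≠ 0 → (algebraMap B F a / algebraMap B F b ∈ O ↔
      ∀ᶠ i in l, (φ i a).degree ≤ (φ i b).degree) := hP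
  refine ⟨O, fun a b hb => ⟨hO a b hb, ?_⟩⟩
  by_cases ha : a = 0
  · simp only [ha, map_zero, zero_div, zero_lt_one, degree_zero, true_iff]
    filter_upwards [hφ b hb] with i hi
    exact bot_lt_iff_ne_bot.2 fun h => hi (degree_eq_bot.1 h)
  · have hx := div_ne_zero (hne a ha) (hne b hb)
    have := one_le_inv₀ (zero_lt_iff.2 ((O.valuation.ne_zero_iff).2 (inv_ne_zero hx)))
    rw [← map_inv₀, inv_inv, O.valuation_le_one_iff, inv_div, hO b a ha] at this
    rw [← not_le, this, ← Ultrafilter.eventually_not]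
    simp only [not_le]

theorem Ideal.isMaximal_comap_of_finiteType (k : Type*) {R B : Type*} [Field k] [CommRing R]
    [CommRing B] [Algebra k R] [Algebra k B] [Algebra.FiniteType k B] [Algebra R B]
    [IsScalarTower k R B] (n : Ideal B) [hn : n.IsMaximal] :
    (n.comap (algebraMap R B)).IsMaximal := by
  let _ : Field (B ⧸ n) := Ideal.Quotient.field n
  have : Module.Finite k (B ⧸ n) := finite_of_finite_type_of_isJacobsonRing k (B ⧸ n)
  have h_int : (algebraMap R (B ⧸ n)).IsIntegral := fun x =>
    (Algebra.IsIntegral.isIntegral (R := k) x).tower_top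
  have := Ideal.isMaximal_comap_of_isIntegral_of_isMaximal' _ h_int (⊥ : Ideal (B ⧸ n))
  rwa [IsScalarTower.algebraMap_eq R B (B ⧸ n), ← Ideal.comap_comap,
    Ideal.Quotient.algebraMap_eq, ← RingHom.ker_eq_comap_bot, Ideal.mk_ker] at this

open Filter in
theorem Ideal.exists_ultrafilter_isMaximal (k : Type*) {R B : Type*} [Field k] [CommRing R]
    [CommRing B] [IsDomain B] [Algebra k R] [Algebra k B] [Algebra.FiniteType k B] [Algebra R B]
    [IsScalarTower k R B] (hinj : Function.Injective (algebraMap R B)) {s : R} (hs : s ≠ 0) :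
    ∃ l : Ultrafilter {m : Ideal R // m.IsMaximal ∧ s ∉ m},
      ∀ b : B, b ≠ 0 → ∀ᶠ m in (l : Filter {m : Ideal R // m.IsMaximal ∧ s ∉ m}),
        b ∉ m.1.map (algebraMap R B) := by
  classical
  have key : ∀ b : B, b ≠ 0 →
      ∃ m : {m : Ideal R // m.IsMaximal ∧ s ∉ m}, b ∉ m.1.map (algebraMap R B) := by
    intro b hb
    have hsb : b * algebraMap R B s ≠ 0 :=
      mul_ne_zero hb fun h => hs (hinj (h.trans (map_zero _).symm))
    have : IsJacobsonRing B := isJacobsonRing_of_finiteType (A := k)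
    have hJ : (⊥ : Ideal B).jacobson = ⊥ := ‹IsJacobsonRing B›.out Ideal.isPrime_bot.isRadical
    have hn : b * algebraMap R B s ∉ (⊥ : Ideal B).jacobson := by rwa [hJ, Ideal.mem_bot]
    rw [Ideal.jacobson, Ideal.mem_sInf] at hn
    push Not at hn
    obtain ⟨n, ⟨-, hn⟩, hbn⟩ := hn
    refine ⟨⟨n.comap (algebraMap R B), n.isMaximal_comap_of_finiteType k, fun h => hbn ?_⟩,
      fun h => hbn ?_⟩
    · exact n.mul_mem_left _ h
    · exact n.mul_mem_right _ (Ideal.map_comap_le h)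
  let U : B → Set {m : Ideal R // m.IsMaximal ∧ s ∉ m} := fun b =>
    {m | b ∉ m.1.map (algebraMap R B)}
  obtain ⟨l, hl⟩ := Ultrafilter.exists_ultrafilter_of_finite_inter_nonempty (U '' {b | b ≠ 0})
    (by
      intro T hT
      suffices ∃ b ≠ 0, U b ⊆ ⋂₀ T by
        obtain ⟨b, hb, hbT⟩ := this
        exact (key b hb).imp fun m hm => hbT hm
      induction T using Finset.induction_on with
      | empty => exact ⟨1, one_ne_zero, by simp⟩
      | insert V T _ ih =>
        rw [Finset.coe_insert, Set.insert_subset_iff] at hT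
        obtain ⟨⟨c, hc, rfl⟩, hT⟩ := hT
        obtain ⟨b, hb, hbT⟩ := ih hT
        refine ⟨c * b, mul_ne_zero hc hb, ?_⟩
        rw [Finset.coe_insert, Set.sInter_insert]
        refine Set.subset_inter (fun m hm h => hm (Ideal.mul_mem_right _ _ h))
          (subset_trans (fun m hm h => hm (Ideal.mul_mem_left _ _ h)) hbT))
  exact ⟨l, fun b hb => hl (Set.mem_image_of_mem _ hb)⟩

theorem ValuationSubring.transcendental_of_forall_valuation_sub_eq_one {k F : Type*} [Field k]
    [IsAlgClosed k] [Field F] [Algebra k F] (O : ValuationSubring F)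
    (hk : ∀ a : k, algebraMap k F a ∈ O) {z : F}
    (hz : ∀ a : k, O.valuation (z - algebraMap k F a) = 1) :
    Transcendental k z ∧ ∀ a ∈ IntermediateField.adjoin k {z}, a ∈ O := by
  have hk1 : ∀ a : k, a ≠ 0 → O.valuation (algebraMap k F a) = 1 := fun a ha => by
    refine le_antisymm ((O.valuation_le_one_iff _).2 (hk a)) ?_
    have h := (O.valuation_le_one_iff _).2 (hk a⁻¹)
    rw [map_inv₀, map_inv₀] at h
    have h0 : O.valuation (algebraMap k F a) ≠ 0 := by simpa using ha
    exact (inv_le_one₀ (zero_lt_iff.2 h0)).1 h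
  have hP : ∀ P : k[X], P ≠ 0 → O.valuation (aeval z P) = 1 := fun P hP => by
    rw [(IsAlgClosed.splits P).eq_prod_roots]
    simp only [map_mul, aeval_C, map_multiset_prod, Multiset.map_map]
    rw [hk1 _ (leadingCoeff_ne_zero.2 hP), one_mul]
    refine Multiset.prod_eq_one fun x hx => ?_
    obtain ⟨a, -, rfl⟩ := Multiset.mem_map.1 hx
    simpa using hz a
  refine ⟨?_, fun a ha => ?_⟩
  · rintro ⟨P, hP0, hPz⟩
    have := hP P hP0
    rw [hPz, map_zero] at this
    exact zero_ne_one this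
  · obtain ⟨r, s, rfl⟩ := (IntermediateField.mem_adjoin_simple_iff _ _).1 ha
    by_cases hr : r = 0
    · simp [hr]
    by_cases hs : s = 0
    · simp [hs]
    rw [← O.valuation_le_one_iff, map_div₀, hP r hr, hP s hs, div_one]

theorem Polynomial.coeff_iterate_derivative_natDegree_sub {K : Type*} [Field K] (p : K[X]) {j : ℕ}
    (hj : j ≤ p.natDegree) : (derivative^[j] p).coeff (p.natDegree - j) =
      (p.natDegree.descFactorial j : K) * p.leadingCoeff := by
  rw [coeff_iterate_derivative, Nat.sub_add_cancel hj, nsmul_eq_mul]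
  rfl

theorem Polynomial.degree_iterate_derivative_of_le {K : Type*} [Field K] [CharZero K] {p : K[X]}
    {j : ℕ} (hp : p ≠ 0) (hj : j ≤ p.natDegree) :
    (derivative^[j] p).degree = (p.natDegree - j : ℕ) := by
  refine degree_eq_of_le_of_coeff_ne_zero
    (degree_le_of_natDegree_le (natDegree_iterate_derivative p j)) ?_
  rw [coeff_iterate_derivative_natDegree_sub p hj]
  refine mul_ne_zero (Nat.cast_ne_zero.2 fun h => ?_) (leadingCoeff_ne_zero.2 hp)
  exact absurd hj (not_le.2 (Nat.descFactorial_eq_zero_iff_lt.1 h))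

theorem Polynomial.degree_lt_of_natDegree_le_of_coeff_eq_zero {R : Type*} [Semiring R] {p : R[X]}
    {n : ℕ} (h : p.natDegree ≤ n) (hn : p.coeff n = 0) : p.degree < n := by
  rw [degree_lt_iff_coeff_zero]
  intro m hm
  rcases hm.eq_or_lt with rfl | hm
  · exact hn
  · exact coeff_eq_zero_of_natDegree_lt (h.trans_lt hm)

section

variable {K : Type*} [Field K] {p : K[X]}

theorem Polynomial.degree_iterate_derivative_relation_lt [CharZero K] {j : ℕ} (hp : p ≠ 0)
    (hj : j + 1 ≤ p.natDegree) (h2 : 2 ≤ p.natDegree) :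
    (p * derivative^[j + 1] p * derivative^[1] p +
      ((j : K[X]) - 1) * (derivative^[j] p * (derivative^[1] p * derivative^[1] p)) -
      (j : K[X]) * (p * derivative^[2] p * derivative^[j] p)).degree <
      (derivative^[j] p * (derivative^[1] p * derivative^[1] p)).degree := by
  have hd : ∀ i, (derivative^[i] p).natDegree ≤ p.natDegree - i := natDegree_iterate_derivative p
  have h11 := natDegree_mul_le_of_le (hd 1) (hd 1)
  have e2 : p.natDegree + (p.natDegree - (j + 1)) + (p.natDegree - 1) =
      (p.natDegree - j) + ((p.natDegree - 1) + (p.natDegree - 1)) := by omega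
  have e3 : p.natDegree + (p.natDegree - (j + 1)) + (p.natDegree - 1) =
      p.natDegree + (p.natDegree - 2) + (p.natDegree - j) := by omega
  have hlt : (derivative^[j] p * (derivative^[1] p * derivative^[1] p)).degree =
      (p.natDegree + (p.natDegree - (j + 1)) + (p.natDegree - 1) : ℕ) := by
    rw [degree_mul, degree_mul, degree_iterate_derivative_of_le hp (by omega),
      degree_iterate_derivative_of_le hp (by omega), e2]
    rfl
  have hj1 : (j : K[X]) - 1 = C ((j : K) - 1) := by simp
  have n1 : (p * derivative^[j + 1] p * derivative^[1] p).natDegree ≤ _ :=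
    natDegree_mul_le_of_le (natDegree_mul_le_of_le le_rfl (hd (j + 1))) (hd 1)
  have n2 := natDegree_mul_le_of_le (hd j) h11
  have n3 := natDegree_mul_le_of_le (natDegree_mul_le_of_le (le_refl p.natDegree) (hd 2)) (hd j)
  rw [hlt, hj1, ← C_eq_natCast]
  have c1 := coeff_mul_add_eq_of_natDegree_le
    (natDegree_mul_le_of_le (le_refl p.natDegree) (hd (j + 1))) (hd 1)
  have c2 := coeff_mul_add_eq_of_natDegree_le (hd j) h11
  have c3 := coeff_mul_add_eq_of_natDegree_le
    (natDegree_mul_le_of_le (le_refl p.natDegree) (hd 2)) (hd j)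
  rw [coeff_mul_add_eq_of_natDegree_le le_rfl (hd _)] at c1 c3
  rw [coeff_mul_add_eq_of_natDegree_le (hd 1) (hd 1), ← e2] at c2
  rw [← e3] at c3
  refine degree_lt_of_natDegree_le_of_coeff_eq_zero
    ((natDegree_sub_le _ _).trans (max_le ((natDegree_add_le _ _).trans (max_le n1
      ((natDegree_C_mul_le _ _).trans (n2.trans e2.ge))))
      ((natDegree_C_mul_le _ _).trans (n3.trans e3.ge)))) ?_
  rw [coeff_sub, coeff_add, coeff_C_mul, coeff_C_mul, c1, c2, c3,
    coeff_iterate_derivative_natDegree_sub p (by omega : 1 ≤ p.natDegree),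
    coeff_iterate_derivative_natDegree_sub p h2, coeff_iterate_derivative_natDegree_sub p hj,
    coeff_iterate_derivative_natDegree_sub p (by omega : j ≤ p.natDegree), coeff_natDegree,
    Nat.descFactorial_one, Nat.descFactorial_succ,
    show p.natDegree.descFactorial 2 = (p.natDegree - 1) * p.natDegree by
      simp [Nat.descFactorial_succ], Nat.cast_mul, Nat.cast_mul, Nat.cast_sub (by omega),
    Nat.cast_sub (by omega), Nat.cast_one]
  ring

theorem Polynomial.degree_sq_sub_le (p : K[X]) (h2 : 2 ≤ p.natDegree) (hp : p ≠ 0) [CharZero K] :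
    (derivative^[1] p * derivative^[1] p - p * derivative^[2] p).degree ≤
      (derivative^[1] p * derivative^[1] p).degree := by
  refine (degree_sub_le _ _).trans (max_le le_rfl ?_)
  rw [degree_mul, degree_mul, degree_iterate_derivative_of_le hp h2,
    degree_iterate_derivative_of_le hp (by omega), degree_eq_natDegree hp, ← Nat.cast_add,
    ← Nat.cast_add, Nat.cast_le]
  omega

theorem Polynomial.degree_le_sq_sub [CharZero K] (hp : p ≠ 0) (h2 : 2 ≤ p.natDegree) {a : K}
    (ha : a * p.natDegree ≠ 1) :
    (derivative^[1] p * derivative^[1] p).degree ≤ (derivative^[1] p * derivative^[1] p -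
      p * derivative^[2] p - C a * (derivative^[1] p * derivative^[1] p)).degree := by
  have hd : ∀ i, (derivative^[i] p).natDegree ≤ p.natDegree - i := natDegree_iterate_derivative p
  rw [degree_mul, degree_iterate_derivative_of_le hp (by omega), ← Nat.cast_add]
  refine le_degree_of_ne_zero ?_
  have e : (p.natDegree - 1) + (p.natDegree - 1) = p.natDegree + (p.natDegree - 2) := by omega
  rw [coeff_sub, coeff_sub, coeff_C_mul, coeff_mul_add_eq_of_natDegree_le (hd 1) (hd 1), e,
    coeff_mul_add_eq_of_natDegree_le le_rfl (hd 2),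
    coeff_iterate_derivative_natDegree_sub p (by omega),
    coeff_iterate_derivative_natDegree_sub p h2, coeff_natDegree, Nat.descFactorial_one,
    show p.natDegree.descFactorial 2 = (p.natDegree - 1) * p.natDegree by
      simp [Nat.descFactorial_succ], Nat.cast_mul, Nat.cast_sub (by omega), Nat.cast_one]
  have hl := leadingCoeff_ne_zero.2 hp
  have hn : (p.natDegree : K) ≠ 0 := Nat.cast_ne_zero.2 (by omega)
  rw [show (p.natDegree : K) * p.leadingCoeff * (p.natDegree * p.leadingCoeff) -
      p.leadingCoeff * ((p.natDegree - 1) * p.natDegree * p.leadingCoeff) -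
      a * (p.natDegree * p.leadingCoeff * (p.natDegree * p.leadingCoeff)) =
      p.leadingCoeff ^ 2 * p.natDegree * (1 - a * p.natDegree) by ring]
  exact mul_ne_zero (mul_ne_zero (pow_ne_zero 2 hl) hn) (sub_ne_zero.2 ha.symm)

end

theorem Derivation.exists_algebraMap_apply_eq_mul {k B F : Type*} [CommRing k] [CommRing B]
    [Algebra k B] [Algebra.FiniteType k B] [Field F] [Algebra k F] [Algebra B F]
    [IsScalarTower k B F] [IsDomain B] [IsFractionRing B F] (E : Derivation k F F) :
    ∃ q : B, q ≠ 0 ∧ ∃ E' : Derivation k B B,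
      ∀ b, algebraMap B F (E' b) = algebraMap B F q * E (algebraMap B F b) := by
  obtain ⟨S, hS⟩ := Algebra.FiniteType.out (R := k) (A := B)
  have hinj : Function.Injective (algebraMap B F) := IsFractionRing.injective B F
  obtain ⟨q, hq⟩ := IsLocalization.exist_integer_multiples (nonZeroDivisors B) S
    (fun b => E (algebraMap B F b))
  have hall : ∀ b, ∃ c, algebraMap B F c = algebraMap B F q * E (algebraMap B F b) := fun b => by
    have hb : b ∈ Algebra.adjoin k (S : Set B) := by rw [hS]; trivial
    induction hb using Algebra.adjoin_induction with
    | mem b hb =>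
      obtain ⟨c, hc⟩ := hq b hb
      exact ⟨c, by rw [hc, Algebra.smul_def]⟩
    | algebraMap r =>
      exact ⟨0, by rw [← IsScalarTower.algebraMap_apply, E.map_algebraMap, mul_zero, map_zero]⟩
    | add a b _ _ ha hb =>
      obtain ⟨c, hc⟩ := ha
      obtain ⟨d, hd⟩ := hb
      exact ⟨c + d, by rw [map_add, hc, hd, map_add, map_add, mul_add]⟩
    | mul a b _ _ ha hb =>
      obtain ⟨c, hc⟩ := ha
      obtain ⟨d, hd⟩ := hb
      refine ⟨a * d + b * c, ?_⟩
      rw [map_add, map_mul, map_mul, hc, hd, map_mul, E.leibniz, smul_eq_mul, smul_eq_mul]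
      ring
  choose e he using hall
  refine ⟨q, nonZeroDivisors.ne_zero q.2, Derivation.mk'
    { toFun := e
      map_add' := fun a b => hinj (by rw [map_add, he, he, he, map_add, map_add, mul_add])
      map_smul' := fun r a => hinj (by
        rw [RingHom.id_apply, Algebra.smul_def, Algebra.smul_def, map_mul, he, he, map_mul,
          ← IsScalarTower.algebraMap_apply, E.leibniz, E.map_algebraMap, smul_zero, add_zero,
          smul_eq_mul]
        ring) }
    fun a b => hinj ?_, fun b => he b⟩
  simp only [LinearMap.coe_mk, AddHom.coe_mk, smul_eq_mul, map_add, map_mul, he, E.leibniz]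
  ring

theorem Derivation.apply_relation_div {k F : Type*} [CommRing k] [Field F] [Algebra k F]
    (E : Derivation k F F) {q : F} (hq : q ≠ 0) (y e : ℕ → F) (he : ∀ i, e i = q * E (y i))
    (j : ℕ) (h1 : y 1 ≠ 0) (hj : y j ≠ 0)
    (hz : E ((y 1 * y 1 - y 0 * y 2) / (y 1 * y 1)) = 1) :
    E ((y 0 * y (j + 1) * y 1 + ((j : F) - 1) * (y j * (y 1 * y 1)) - (j : F) * (y 0 * y 2 * y j)) /
      (y j * (y 1 * y 1))) =
    (y 0 * y 1 * y j * e (j + 1) - y 0 * y 1 * y (j + 1) * e j + y 1 * y (j + 1) * y j * e 0 -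
      y 0 * y (j + 1) * y j * e 1 + (j : F) * (q * (y j * y j) * (y 1 * y 1))) /
      (q * (y j * y j) * (y 1 * y 1)) := by
  have h : (y 0 * y (j + 1) * y 1 + ((j : F) - 1) * (y j * (y 1 * y 1)) -
      (j : F) * (y 0 * y 2 * y j)) / (y j * (y 1 * y 1)) = y 0 * y (j + 1) / (y j * y 1) - 1 +
      (j : F) * ((y 1 * y 1 - y 0 * y 2) / (y 1 * y 1)) := by
    field_simp
    ring
  rw [h, E.map_add, E.map_sub, E.map_one_eq_zero, sub_zero, E.leibniz, hz, E.map_natCast,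
    E.leibniz_div, E.leibniz, E.leibniz, he, he, he, he]
  simp only [smul_eq_mul]
  field_simp
  ring

open Filter in
theorem Derivation.false_of_ultrafilter {k B ι : Type*} [Field k] [IsAlgClosed k] [CharZero k]
    [CommRing B] [IsDomain B] [Algebra k B] [Algebra.FiniteType k B] (l : Ultrafilter ι)
    {K : ι → Type*} [∀ i, Field (K i)] [∀ i, CharZero (K i)] (φ : ∀ i, B →+* (K i)[X])
    (hφ : ∀ b ≠ 0, ∀ᶠ i in l, φ i b ≠ 0) (D : Derivation k B B)
    (hφD : ∀ i b j, φ i (D^[j] b) = derivative^[j] (φ i b)) (x : B) (hx : ∀ j, D^[j] x ≠ 0)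
    (g : ℕ) (hW : ∀ i (E : Derivation k B B), ∃ (W : Submodule (K i) (K i)[X])
      (_ : FiniteDimensional (K i) W) (s : Finset ℕ) (p : ℕ → (K i)[X]),
      Module.finrank (K i) W ≤ g ∧ (∀ n ∈ s, p n ∈ W) ∧
      ∀ j, φ i (E (D^[j] x)) = ∑ n ∈ s, X ^ n * derivative^[j] (p n)) : False := by
  let F := FractionRing B
  have hinj : Function.Injective (algebraMap B F) := IsFractionRing.injective B F
  have : Algebra.EssFiniteType k F := by
    have : Algebra.EssFiniteType B F := Algebra.EssFiniteType.of_isLocalization F (nonZeroDivisors B)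
    exact Algebra.EssFiniteType.comp k B F
  have : CharZero F := charZero_of_injective_algebraMap (algebraMap k F).injective
  obtain ⟨O, hO⟩ := l.exists_valuationSubring_polynomial (F := F) φ hφ
  have hdeg : ∀ N, ∀ᶠ i in l, N ≤ (φ i x).natDegree := fun N => by
    filter_upwards [hφ _ (hx N)] with i hi
    by_contra! h
    exact hi (by rw [hφD, iterate_derivative_eq_zero h])
  have hC : ∀ i (a : k), φ i (algebraMap k B a) = C ((φ i (algebraMap k B a)).coeff 0) :=
    fun i a => by
      refine eq_C_of_natDegree_eq_zero (derivative_eq_zero.1 ?_)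
      have := hφD i (algebraMap k B a) 1
      rw [Function.iterate_one, D.map_algebraMap, map_zero] at this
      exact this.symm
  let y : ℕ → B := fun j => D^[j] x
  have hy : ∀ j, algebraMap B F (y j) ≠ 0 := fun j => by simpa using hx j
  have hyφ : ∀ i j, φ i (y j) = derivative^[j] (φ i x) := fun i j => hφD i x j
  have hy11 : y 1 * y 1 ≠ 0 := mul_ne_zero (hx 1) (hx 1)
  let z : F := algebraMap B F (y 1 * y 1 - y 0 * y 2) / algebraMap B F (y 1 * y 1)
  have hk : ∀ a : k, algebraMap k F a ∈ O := fun a => by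
    have h : algebraMap k F a = algebraMap B F (algebraMap k B a) / algebraMap B F 1 := by
      rw [map_one, div_one, ← IsScalarTower.algebraMap_apply]
    rw [h, (hO _ 1 one_ne_zero).1]
    refine Eventually.of_forall fun i => ?_
    rw [hC, map_one, degree_one]
    exact degree_C_le
  have hz : ∀ a : k, O.valuation (z - algebraMap k F a) = 1 := fun a => by
    have h : z - algebraMap k F a = algebraMap B F (y 1 * y 1 - y 0 * y 2 -
        algebraMap k B a * (y 1 * y 1)) / algebraMap B F (y 1 * y 1) := by
      have : algebraMap B F (y 1 * y 1) ≠ 0 := by simpa using hy 1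
      rw [eq_div_iff this, sub_mul, div_mul_cancel₀ _ this, map_sub _ (_ - _),
        map_mul _ (algebraMap k B a), ← IsScalarTower.algebraMap_apply]
    have hzO : z ∈ O := (hO _ _ hy11).1.2 <| by
      filter_upwards [hdeg 2] with i hi
      rw [map_sub, map_mul, map_mul, hyφ, hyφ, hyφ]
      exact degree_sq_sub_le _ hi (by rintro h; simp [h] at hi)
    refine le_antisymm ((O.valuation_le_one_iff _).2 (O.sub_mem hzO (hk a)))
      (not_lt.1 fun hlt => ?_)
    rw [h, (hO _ _ hy11).2] at hlt
    obtain ⟨N, hN⟩ : ∃ N : ℕ, ∀ n ≥ N, a * n ≠ 1 := by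
      by_cases h : ∃ n : ℕ, a * n = 1
      · obtain ⟨n, hn⟩ := h
        refine ⟨n + 1, fun m hm h => ?_⟩
        have := mul_left_cancel₀ (left_ne_zero_of_mul_eq_one hn) (h.trans hn.symm)
        have := Nat.cast_injective this
        omega
      · exact ⟨0, fun n _ hn => h ⟨n, hn⟩⟩
    obtain ⟨i, hi, hi2⟩ := (hlt.and (hdeg (max 2 N))).exists
    have hi0 := (le_max_left _ _).trans hi2
    refine absurd hi (not_lt.2 ?_)
    rw [map_sub, map_sub, map_mul, map_mul, map_mul, map_mul, hyφ, hyφ, hyφ, hC]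
    refine degree_le_sq_sub (by rintro h; simp [h] at hi0) hi0 fun h => ?_
    refine hN _ ((le_max_right _ _).trans hi2) (((φ i).comp (algebraMap k B)).injective ?_)
    rw [map_mul, map_one, _root_.map_natCast, RingHom.comp_apply, hC, ← C_eq_natCast, ← C_mul, h,
      C_1]
  obtain ⟨hzt, hzO⟩ := O.transcendental_of_forall_valuation_sub_eq_one hk hz
  let M : ℕ → B := fun j => y 0 * y (j + 1) * y 1 + ((j : B) - 1) * (y j * (y 1 * y 1)) -
    (j : B) * (y 0 * y 2 * y j)
  have hyj : ∀ j, y j * (y 1 * y 1) ≠ 0 := fun j => mul_ne_zero (hx j) hy11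
  have hM : ∀ j, O.valuation (algebraMap B F (M j) / algebraMap B F (y j * (y 1 * y 1))) < 1 :=
    fun j => (hO _ _ (hyj j)).2.2 <| by
      filter_upwards [hdeg (j + 1), hdeg 2] with i hi h2
      have := degree_iterate_derivative_relation_lt (by rintro h; simp [h] at h2) hi h2
      simpa only [M, map_sub, map_add, map_mul, _root_.map_natCast, map_one, hyφ,
        Function.iterate_zero, id_eq] using this
  obtain ⟨E, hEz, hE⟩ := Derivation.exists_apply_eq_one_and_forall_mem O hzt hzO
    ((Finset.range (g + 3)).disjSum (Finset.range (g + 2))) (Sum.elim (fun j => algebraMap B F (y j))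
      fun j => algebraMap B F (M j) / algebraMap B F (y j * (y 1 * y 1)))
  obtain ⟨q, hq, E', hE'⟩ := E.exists_algebraMap_apply_eq_mul (B := B)
  have hqF : algebraMap B F q ≠ 0 := by simpa using hq
  have h1 : ∀ᶠ i in l, ∀ j ∈ Finset.range (g + 3),
      (φ i (E' (y j))).degree ≤ (φ i (q * y j)).degree := by
    refine (Finset.eventually_all _).2 fun j hj => (hO _ _ (mul_ne_zero hq (hx j))).1.1 ?_
    have := hE (Sum.inl j) (by simpa using hj)
    rw [hE', map_mul, mul_div_mul_left _ _ hqF]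
    exact this
  let P : ℕ → B := fun j => y 0 * y 1 * y j * E' (y (j + 1)) - y 0 * y 1 * y (j + 1) * E' (y j) +
    y 1 * y (j + 1) * y j * E' (y 0) - y 0 * y (j + 1) * y j * E' (y 1) +
    (j : B) * (q * (y j * y j) * (y 1 * y 1))
  have h2 : ∀ᶠ i in l, ∀ j ∈ Finset.range (g + 2),
      (φ i (P j)).degree < (φ i (q * (y j * y j) * (y 1 * y 1))).degree := by
    refine (Finset.eventually_all _).2 fun j hj =>
      (hO _ _ (mul_ne_zero (mul_ne_zero hq (mul_ne_zero (hx j) (hx j))) hy11)).2.1 ?_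
    have hm := hE (Sum.inr j) (by simpa using hj)
    have key := E.apply_relation_div hqF (fun j => algebraMap B F (y j))
      (fun j => algebraMap B F (E' (y j))) (fun j => hE' (y j)) j (hy 1) (hy j)
      (by simpa [z] using hEz)
    simp only [Sum.elim_inr] at hm
    have hP : algebraMap B F (P j) / algebraMap B F (q * (y j * y j) * (y 1 * y 1)) =
        E (algebraMap B F (M j) / algebraMap B F (y j * (y 1 * y 1))) := by
      simpa only [P, M, map_sub, map_add, map_mul, _root_.map_natCast, map_one] using key.symm
    rw [hP]
    by_cases h0 : algebraMap B F (M j) / algebraMap B F (y j * (y 1 * y 1)) = 0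
    · rw [h0, map_zero, map_zero]
      exact zero_lt_one
    · rw [← div_mul_cancel₀ (E _) h0, map_mul]
      exact (mul_le_of_le_one_left' ((O.valuation_le_one_iff _).2 hm)).trans_lt (hM j)
  obtain ⟨i, ⟨⟨h1i, h2i⟩, hgi⟩, hqi⟩ := (((h1.and h2).and (hdeg (g + 3))).and (hφ q hq)).exists
  obtain ⟨W, hWf, s, p, hWg, hpW, hp⟩ := hW i E'
  have hx0 : φ i x ≠ 0 := by rintro h; simp [h] at hgi
  have hdy : ∀ j ≤ g + 2, (φ i (y j)).natDegree = (φ i x).natDegree - j := fun j hj => by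
    rw [hyφ]
    exact natDegree_eq_of_degree_eq_some (degree_iterate_derivative_of_le hx0 (by omega))
  refine false_of_iterate_derivative W hWg s p hpW (φ i x) (φ i q) hqi hgi (fun j => φ i (y j))
    (fun j => φ i (E' (y j))) (hyφ i) hp (fun j hj => ?_) fun j hj => ?_
  · have := natDegree_le_natDegree (h1i j (Finset.mem_range.2 (by omega)))
    rw [map_mul] at this
    have h' := this.trans natDegree_mul_le
    rw [hdy j hj] at h'
    omega
  · have := h2i j (Finset.mem_range.2 (by omega))
    have hne : ∀ j ≤ g + 2, φ i (y j) ≠ 0 := fun j hj h0 => by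
      have := hdy j hj
      rw [h0, natDegree_zero] at this
      omega
    have hj0 := hne j (by omega)
    have h10 := hne 1 (by omega)
    have hjj := mul_ne_zero hj0 hj0
    have h11 := mul_ne_zero h10 h10
    rw [map_mul, map_mul, map_mul, map_mul, degree_eq_natDegree (mul_ne_zero
      (mul_ne_zero hqi hjj) h11), natDegree_mul (mul_ne_zero hqi hjj) h11, natDegree_mul hqi hjj,
      natDegree_mul hj0 hj0, natDegree_mul h10 h10, hdy j (by omega), hdy 1 (by omega)] at this
    have := coeff_eq_zero_of_degree_lt this
    simpa only [P, map_sub, map_add, map_mul, _root_.map_natCast] using this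

/-- **Theorem 1.1**: if the derivation induced by an `R`-derivation `D` on every closed
fiber is locally nilpotent, then `D` is locally nilpotent. -/
theorem Derivation.isLocallyNilpotent_of_forall_maximal_isLocallyNilpotent
    (k : Type*) [Field k] [IsAlgClosed k] [CharZero k]
    (R B : Type*) [CommRing R] [IsDomain R] [Algebra k R] [Algebra.FiniteType k R]
    [CommRing B] [IsDomain B] [Algebra k B] [Algebra.FiniteType k B]
    [Algebra R B] [IsScalarTower k R B]
    (hinj : Function.Injective (algebraMap R B))
    (s : R) (hs : s ≠ 0)
    (hfib : ∀ m : Ideal R, m.IsMaximal → s ∉ m →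
      IsDomain (B ⧸ Ideal.map (algebraMap R B) m))
    (D : Derivation R B B)
    (hD : ∀ m : Ideal R, m.IsMaximal → ∀ b : B,
      ∃ n : ℕ, 1 ≤ n ∧ (⇑D)^[n] b ∈ Ideal.map (algebraMap R B) m) :
    D.IsLocallyNilpotent := by
  intro x
  by_contra! hx
  have hx' : ∀ j, D^[j] x ≠ 0 := fun j h0 => hx (j + 1) (by omega) (by
    rw [Function.iterate_succ_apply', h0, map_zero])
  obtain ⟨S, hS⟩ := Algebra.FiniteType.out (R := k) (A := B)
  obtain ⟨l, hl⟩ := Ideal.exists_ultrafilter_isMaximal k (B := B) hinj hs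
  have key := fun m : {m : Ideal R // m.IsMaximal ∧ s ∉ m} =>
    Derivation.exists_ringHom_polynomial_of_fibre S hS m.1 (hfib m.1 m.2.1 m.2.2) D
      (hD m.1 m.2.1)
  choose Q hQ hQ0 φ hφ hφD hW using key
  refine Derivation.false_of_ultrafilter l φ (fun b hb => (hl b hb).mono fun m hm h0 =>
    hm ((hφ m b).1 h0)) (D.restrictScalars k) hφD x hx' S.card fun m E => hW m x E
end

section
/- Let k be an algebraically closed field of characteristic zero, and let R and B be affine domains over k such that B is an R-algebra whose structure map R → B is injective, there exists a nonzero s ∈ R such that B/mB is an integral domain for every maximal ideal m of R with s ∉ m, and the transcendence degree of Frac(B) over Frac(R) is 1 (the relative dimension is one). Let D be an R-derivation of B such that for every maximal ideal m of R the induced derivation D_m on B/mB is surjective as a k-linear map. Then D is locally nilpotent; moreover there exists a nonzero s' ∈ R such that for every maximal ideal m of R with s' ∉ m the fiber ring B/mB is k-isomorphic to a polynomial ring k[x] in one variable (so the morphism Spec B → Spec R is an 𝔸¹-fibration over a nonempty open set). -/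
theorem IsDiscreteValuationRing.exists_derivation_eq_mul {k O F : Type*} [Field k] [CommRing O]
    [IsDomain O] [IsDiscreteValuationRing O] [Algebra k O] [Algebra.EssFiniteType k O]
    [Field F] [Algebra O F] [Algebra k F] [IsScalarTower k O F]
    (hres : ∀ f : O, ∃ c : k, f - algebraMap k O c ∈ IsLocalRing.maximalIdeal O)
    {ϖ : O} (hϖ : Irreducible ϖ) (D : Derivation k O F) (f : O) :
    ∃ g : O, D f = algebraMap O F g * D ϖ := by
  set N : Submodule O F := LinearMap.range D.liftKaehlerDifferential with hN
  have hDN (f : O) : D f ∈ N := ⟨KaehlerDifferential.D k O f, by simp⟩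
  have hspan : N ≤ Submodule.span O (Set.range D) := by
    rw [hN, LinearMap.range_eq_map, ← KaehlerDifferential.span_range_derivation,
      Submodule.map_span, Submodule.span_le]
    rintro _ ⟨_, ⟨f, rfl⟩, rfl⟩
    rw [Derivation.liftKaehlerDifferential_comp_D]
    exact Submodule.subset_span ⟨f, rfl⟩
  have hle : N ≤ Submodule.span O {D ϖ} ⊔ IsLocalRing.maximalIdeal O • N := by
    refine hspan.trans (Submodule.span_le.2 ?_)
    rintro _ ⟨f, rfl⟩
    obtain ⟨c, hc⟩ := hres f
    rw [hϖ.maximalIdeal_eq, Ideal.mem_span_singleton'] at hc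
    obtain ⟨g, hg⟩ := hc
    have hf : f = algebraMap k O c + g * ϖ := by rw [hg]; ring
    rw [hf, map_add, D.map_algebraMap, zero_add, D.leibniz]
    refine add_mem (Submodule.mem_sup_left ?_) (Submodule.mem_sup_right ?_)
    · exact Submodule.smul_mem _ _ (Submodule.mem_span_singleton_self _)
    · refine Submodule.smul_mem_smul ?_ (hDN g)
      rw [hϖ.maximalIdeal_eq]
      exact Ideal.mem_span_singleton_self _
  have hfg : N.FG := by
    rw [hN, LinearMap.range_eq_map]
    exact Module.Finite.fg_top.map _
  have := Submodule.le_of_le_smul_of_le_jacobson_bot hfg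
    (IsLocalRing.maximalIdeal_le_jacobson _) hle (hDN f)
  obtain ⟨g, hg⟩ := Submodule.mem_span_singleton.1 this
  exact ⟨g, by rw [← hg, Algebra.smul_def]⟩

theorem IsDiscreteValuationRing.exists_order_derivation {k O F : Type*} [Field k] [CharZero k]
    [CommRing O] [IsDomain O] [IsDiscreteValuationRing O] [Algebra k O] [Algebra.EssFiniteType k O]
    [Field F] [Algebra O F] [IsFractionRing O F] [Algebra k F] [IsScalarTower k O F]
    (hres : ∀ f : O, ∃ c : k, f - algebraMap k O c ∈ IsLocalRing.maximalIdeal O)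
    (D : Derivation k F F) (hD : D ≠ 0) :
    ∃ v : F → ℤ, (∀ f g, f ≠ 0 → g ≠ 0 → v (f * g) = v f + v g) ∧
      (∀ f, f ≠ 0 → 0 ≤ v f → ∃ g : O, algebraMap O F g = f) ∧
      (∀ f, f ≠ 0 → 0 ≤ v f → ∃ c : k, f - algebraMap k F c = 0 ∨ 0 < v (f - algebraMap k F c)) ∧
      ∃ γ : ℤ, ∀ f, f ≠ 0 → v f ≠ 0 → D f ≠ 0 ∧ v (D f) = v f + γ := by
  obtain ⟨ϖ, hϖ⟩ := IsDiscreteValuationRing.exists_irreducible O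
  set p : F := algebraMap O F ϖ with hp
  have hinj := IsFractionRing.injective O F
  have hp0 : p ≠ 0 := (map_ne_zero_iff _ hinj).2 hϖ.ne_zero
  have hu0 (u : Oˣ) : algebraMap O F u ≠ 0 := (map_ne_zero_iff _ hinj).2 u.ne_zero
  have hex (f : F) : ∃ n : ℤ, f ≠ 0 → ∃ u : Oˣ, f = algebraMap O F u * p ^ n := by
    by_cases hf : f = 0
    · exact ⟨0, fun h ↦ (h hf).elim⟩
    · obtain ⟨n, u, h⟩ := exists_units_eq_smul_zpow_of_irreducible hϖ hf
      exact ⟨n, fun _ ↦ ⟨u, by rw [h, Units.smul_def, Algebra.smul_def]⟩⟩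
  choose v hv using hex
  have hpos (n : ℤ) (u : O) (w : Oˣ) (h : algebraMap O F u * p ^ n = algebraMap O F w) :
      n ≤ 0 := by
    by_contra! hn
    lift n to ℕ using hn.le
    rw [zpow_natCast, hp, ← map_pow, ← map_mul] at h
    have := hinj h
    refine hϖ.not_isUnit (isUnit_of_dvd_unit ?_ w.isUnit)
    rw [← this]
    exact Dvd.dvd.mul_left (dvd_pow_self _ (by omega)) _
  have huniq (f : F) (n : ℤ) (u : Oˣ) (h : f = algebraMap O F u * p ^ n) : v f = n := by
    have hf : f ≠ 0 := by rw [h]; exact mul_ne_zero (hu0 u) (zpow_ne_zero _ hp0)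
    obtain ⟨w, hw⟩ := hv f hf
    have key : ∀ (a b : ℤ) (u w : Oˣ),
        algebraMap O F u * p ^ a = algebraMap O F w * p ^ b → a ≤ b := by
      intro a b u w h
      have := hpos (a - b) u w (by rw [zpow_sub₀ hp0, mul_div_assoc', h]; field_simp)
      omega
    exact le_antisymm (key _ _ w u (hw.symm.trans h)) (key _ _ u w (h.symm.trans hw))
  have hnonneg (f : F) (hf : f ≠ 0) (h0 : 0 ≤ v f) : ∃ g : O, algebraMap O F g = f := by
    obtain ⟨u, hu⟩ := hv f hf
    generalize v f = n at hu h0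
    lift n to ℕ using h0
    exact ⟨u * ϖ ^ n, by rw [hu]; simp [hp]⟩
  have hDO := exists_derivation_eq_mul hres hϖ (D.compAlgebraMap O)
  simp only [Derivation.compAlgebraMap_apply] at hDO
  have hDp : D p ≠ 0 := by
    intro h0
    apply hD
    ext f
    have hz (g : O) : D (algebraMap O F g) = 0 := by
      obtain ⟨b, hb⟩ := hDO g
      rw [hb, ← hp, h0, mul_zero]
    obtain ⟨a, b, hb, rfl⟩ := IsFractionRing.div_surjective (A := O) f
    simp [Derivation.leibniz_div, hz]
  refine ⟨v, fun f g hf hg ↦ ?_, hnonneg, fun f hf h0 ↦ ?_, v (D p) - 1, fun f hf hvf ↦ ?_⟩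
  · obtain ⟨u, hu⟩ := hv f hf
    obtain ⟨w, hw⟩ := hv g hg
    refine huniq _ _ (u * w) ?_
    conv_lhs => rw [hu, hw]
    rw [zpow_add₀ hp0]
    rw [Units.val_mul, map_mul]
    ring
  · obtain ⟨g, rfl⟩ := hnonneg f hf h0
    obtain ⟨c, hc⟩ := hres g
    refine ⟨c, or_iff_not_imp_left.2 fun hne ↦ ?_⟩
    rw [hϖ.maximalIdeal_eq, Ideal.mem_span_singleton'] at hc
    obtain ⟨b, hb⟩ := hc
    by_contra! hlt
    have e : algebraMap O F g - algebraMap k F c = algebraMap O F b * p := by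
      rw [IsScalarTower.algebraMap_apply k O F, ← map_sub, ← hb, map_mul]
    obtain ⟨u, hu⟩ := hv _ hne
    generalize v _ = n at hu hlt
    have := hpos (1 - n) b u (by
      rw [zpow_sub₀ hp0, zpow_one, mul_div_assoc', ← e, hu]; field_simp)
    omega
  · obtain ⟨u, hu⟩ := hv f hf
    set n := v f
    obtain ⟨g, hg⟩ := hDO u
    have hn : (n : k) ≠ 0 := by exact_mod_cast hvf
    have hunit : IsUnit (algebraMap k O n * u + g * ϖ) := by
      by_contra hnu
      have h1 : algebraMap k O n * u + g * ϖ ∈ IsLocalRing.maximalIdeal O := hnu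
      rw [hϖ.maximalIdeal_eq, Ideal.mem_span_singleton] at h1
      have h2 : ϖ ∣ algebraMap k O n * u := (dvd_add_left (Dvd.intro_left _ rfl)).1 h1
      exact hϖ.not_isUnit (isUnit_of_dvd_unit h2 (((Ne.isUnit hn).map _).mul u.isUnit))
    have hDf : D f = algebraMap O F hunit.unit * (D p * p ^ (n - 1)) := by
      conv_lhs => rw [hu]
      rw [D.leibniz, hg, Derivation.leibniz_zpow]
      simp only [IsUnit.unit_spec, map_add, map_mul, ← hp, smul_eq_mul, map_intCast, zsmul_eq_mul]
      rw [zpow_sub_one₀ hp0]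
      field_simp
    obtain ⟨w, hw⟩ := hv _ hDp
    refine ⟨by rw [hDf]; exact mul_ne_zero (hu0 _) (mul_ne_zero hDp (zpow_ne_zero _ hp0)), ?_⟩
    refine huniq _ _ (hunit.unit * w) ?_
    rw [hDf]
    conv_lhs => rw [hw]
    rw [add_sub, zpow_sub_one₀ hp0, zpow_sub_one₀ hp0, zpow_add₀ hp0]
    rw [Units.val_mul, map_mul]
    ring

theorem Derivation.exists_iterate_eq_zero_of_order {k A F : Type*} [Field k] [CommRing A]
    [Field F] [Algebra k A] [Algebra A F] [Algebra k F] [IsScalarTower k A F]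
    (hinj : Function.Injective (algebraMap A F)) (D : Derivation k A A) (E : Derivation k F F)
    (hE : ∀ a, E (algebraMap A F a) = algebraMap A F (D a)) (hD : Function.Surjective D)
    (v : F → ℤ) (hmul : ∀ f g, f ≠ 0 → g ≠ 0 → v (f * g) = v f + v g)
    (hres : ∀ f, f ≠ 0 → 0 ≤ v f →
      ∃ c : k, f - algebraMap k F c = 0 ∨ 0 < v (f - algebraMap k F c))
    (γ : ℤ) (hγ : ∀ f, f ≠ 0 → v f ≠ 0 → E f ≠ 0 ∧ v (E f) = v f + γ)
    {x : A} (hx : D x = 1) (hvx : v (algebraMap A F x) < 0) :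
    (∀ a, D a = 0 → ∃ c, algebraMap k A c = a) ∧ ∀ a, ∃ n, D^[n] a = 0 := by
  have h0 {a : A} : algebraMap A F a = 0 ↔ a = 0 := map_eq_zero_iff _ hinj
  have hone : v 1 = 0 := by
    have := hmul 1 1 one_ne_zero one_ne_zero
    rw [mul_one] at this
    omega
  have hpow (f : F) (hf : f ≠ 0) (n : ℕ) : v (f ^ n) = n * v f := by
    induction n with
    | zero => simp [hone]
    | succ n ih => rw [pow_succ, hmul _ _ (pow_ne_zero _ hf) hf, ih]; push_cast; ring
  have hx0 : x ≠ 0 := by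
    rintro rfl
    rw [map_zero] at hx
    have := congrArg (algebraMap A F) hx
    simp at this
  have hγx : v (algebraMap A F x) + γ = 0 := by
    rw [← (hγ _ (h0.not.2 hx0) hvx.ne).2, hE, hx, map_one, hone]
  -- subtracting the residue does not change the derivative
  have hDsub (a : A) (c : k) : D (a - algebraMap k A c) = D a := by simp
  have hsub (a : A) (c : k) :
      algebraMap A F a - algebraMap k F c = algebraMap A F (a - algebraMap k A c) := by
    rw [map_sub, ← IsScalarTower.algebraMap_apply]
  have havoid (a : A) (ha : D a ≠ 0) : v (algebraMap A F (D a)) ≠ γ := by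
    have ha0 : a ≠ 0 := by rintro rfl; simp at ha
    by_cases hva : v (algebraMap A F a) = 0
    · obtain ⟨c, hc⟩ := hres _ (h0.not.2 ha0) hva.ge
      rw [hsub] at hc
      have hne : a - algebraMap k A c ≠ 0 := by
        intro h
        rw [← hDsub a c, h, map_zero] at ha
        exact ha rfl
      have hpos := hc.resolve_left (h0.not.2 hne)
      have := (hγ _ (h0.not.2 hne) hpos.ne').2
      rw [hE, hDsub] at this
      omega
    · have := (hγ _ (h0.not.2 ha0) hva).2
      rw [hE] at this
      omega
  have hnonpos (a : A) (ha : a ≠ 0) : v (algebraMap A F a) ≤ 0 := by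
    by_contra! hva
    obtain ⟨m, hm⟩ := Int.eq_ofNat_of_zero_le hva.le
    obtain ⟨l, hl⟩ := Int.eq_ofNat_of_zero_le (Int.neg_nonneg_of_nonpos hvx.le)
    obtain ⟨l, rfl⟩ : ∃ l', l = l' + 1 := ⟨l - 1, by omega⟩
    obtain ⟨hDa0, hDa⟩ := hγ _ (h0.not.2 ha) hva.ne'
    rw [hE] at hDa0 hDa
    have ha' := h0.not.2 ha
    have hx' := h0.not.2 hx0
    obtain ⟨g, hg⟩ := hD (D a * (a ^ l * x ^ m))
    have hne : algebraMap A F (D g) ≠ 0 := by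
      rw [hg]
      simp only [map_mul, map_pow]
      exact mul_ne_zero hDa0 (mul_ne_zero (pow_ne_zero _ ha') (pow_ne_zero _ hx'))
    refine havoid g (h0.not.1 hne) ?_
    rw [hg]
    simp only [map_mul, map_pow]
    rw [hmul _ _ hDa0 (mul_ne_zero (pow_ne_zero _ ha') (pow_ne_zero _ hx')),
      hmul _ _ (pow_ne_zero _ ha') (pow_ne_zero _ hx'), hpow _ ha', hpow _ hx', hDa, hm,
      show v (algebraMap A F x) = -((l + 1 : ℕ) : ℤ) by omega]
    push_cast
    ring
  have key (n : ℕ) : ∀ a : A, (a ≠ 0 → -v (algebraMap A F a) < n) → D^[n] a = 0 := by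
    induction n with
    | zero =>
      intro a ha
      by_contra hne
      have := ha hne
      have := hnonpos a hne
      omega
    | succ n ih =>
      intro a ha
      rw [Function.iterate_succ_apply]
      refine ih _ fun hDa ↦ ?_
      have ha0 : a ≠ 0 := by rintro rfl; simp at hDa
      have han := ha ha0
      by_cases hva : v (algebraMap A F a) = 0
      · obtain ⟨c, hc⟩ := hres _ (h0.not.2 ha0) hva.ge
        rw [hsub] at hc
        have hne : a - algebraMap k A c ≠ 0 := by
          intro h
          rw [← hDsub a c, h, map_zero] at hDa
          exact hDa rfl
        have := hnonpos _ hne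
        have := hc.resolve_left (h0.not.2 hne)
        omega
      · have := (hγ _ (h0.not.2 ha0) hva).2
        rw [hE] at this
        push_cast at han
        omega
  refine ⟨fun a ha ↦ ?_, fun a ↦ ⟨(-v (algebraMap A F a)).toNat + 1, ?_⟩⟩
  · by_cases ha0 : a = 0
    · exact ⟨0, by rw [ha0, map_zero]⟩
    have hva : v (algebraMap A F a) = 0 := by
      by_contra hva
      exact (hγ _ (h0.not.2 ha0) hva).1 (by rw [hE, ha, map_zero])
    obtain ⟨c, hc⟩ := hres _ (h0.not.2 ha0) hva.ge
    rw [hsub] at hc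
    refine ⟨c, ?_⟩
    by_contra hne
    have hne' : a - algebraMap k A c ≠ 0 := fun h ↦ hne (sub_eq_zero.1 h).symm
    have := hnonpos _ hne'
    have := hc.resolve_left (h0.not.2 hne')
    omega
  refine key _ a fun _ ↦ ?_
  push_cast
  have := Int.self_le_toNat (-v (algebraMap A F a))
  omega

theorem Derivation.exists_extend_fractionRing {k A F : Type*} [CommRing k] [CommRing A]
    [Nontrivial A] [Field F] [Algebra k A] [Algebra A F] [Algebra k F] [IsScalarTower k A F]
    [IsFractionRing A F] (D : Derivation k A A) :
    ∃ E : Derivation k F F, ∀ a, E (algebraMap A F a) = algebraMap A F (D a) := by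
  let φ : A →ₐ[k] TrivSqZeroExt F F :=
    { toFun := fun a ↦ TrivSqZeroExt.inl (algebraMap A F a) +
        TrivSqZeroExt.inr (algebraMap A F (D a))
      map_one' := by ext <;> simp
      map_mul' := fun a b ↦ by ext <;> simp [-DualNumber.inr_eq_smul_eps]; ring
      map_zero' := by ext <;> simp
      map_add' := fun a b ↦ by ext <;> simp [-DualNumber.inr_eq_smul_eps]
      commutes' := fun c ↦ by
        ext <;> simp [TrivSqZeroExt.algebraMap_eq_inl', IsScalarTower.algebraMap_apply k A F] }
  have hφ (a : nonZeroDivisors A) : IsUnit (φ a) := by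
    rw [TrivSqZeroExt.isUnit_iff_isUnit_fst]
    simp [φ]
  let ψ : F →ₐ[k] TrivSqZeroExt F F := IsLocalization.liftAlgHom (M := nonZeroDivisors A) hφ
  have hψ (a : A) : ψ (algebraMap A F a) = φ a := IsLocalization.lift_eq _ _
  have hfst : (TrivSqZeroExt.fstHom k F F).comp ψ = AlgHom.id k F := by
    refine AlgHom.coe_ringHom_injective (IsLocalization.ringHom_ext (nonZeroDivisors A) ?_)
    ext a
    simp [hψ, φ]
  have hfst' (f : F) : (ψ f).fst = f := DFunLike.congr_fun hfst f
  refine ⟨Derivation.mk' ((TrivSqZeroExt.sndHom F F).restrictScalars k ∘ₗ ψ.toLinearMap) ?_, ?_⟩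
  · intro f g
    simp [hfst', mul_comm]
  · intro a
    simp [hψ, φ, -DualNumber.inr_eq_smul_eps]

theorem IsDedekindDomain.exists_order_derivation {k C F : Type*} [Field k] [IsAlgClosed k]
    [CharZero k] [CommRing C] [IsDedekindDomain C] [Algebra k C] [Algebra.FiniteType k C]
    [Field F] [Algebra C F] [IsFractionRing C F] [Algebra k F] [IsScalarTower k C F]
    {s : C} (hs0 : s ≠ 0) (hs : ¬ IsUnit s) (D : Derivation k F F) (hD : D ≠ 0) :
    ∃ v : F → ℤ, (∀ f g, f ≠ 0 → g ≠ 0 → v (f * g) = v f + v g) ∧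
      v (algebraMap C F s)⁻¹ < 0 ∧
      (∀ f, f ≠ 0 → 0 ≤ v f → ∃ c : k, f - algebraMap k F c = 0 ∨ 0 < v (f - algebraMap k F c)) ∧
      ∃ γ : ℤ, ∀ f, f ≠ 0 → v f ≠ 0 → D f ≠ 0 ∧ v (D f) = v f + γ := by
  obtain ⟨P, hP, hsP⟩ := exists_max_ideal_of_mem_nonunits hs
  have hPbot : P ≠ ⊥ := by
    rintro rfl
    exact hs0 hsP
  let O := Localization.subalgebra.ofField F P.primeCompl P.primeCompl_le_nonZeroDivisors
  have : IsLocalization.AtPrime O P := inferInstanceAs (IsLocalization P.primeCompl O)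
  have : IsDiscreteValuationRing O :=
    IsLocalization.AtPrime.isDiscreteValuationRing_of_dedekind_domain C hPbot O
  have : IsLocalRing O := IsDiscreteValuationRing.toIsLocalRing
  have : Algebra.EssFiniteType C O := Algebra.EssFiniteType.of_isLocalization _ P.primeCompl
  have : Algebra.EssFiniteType k O := Algebra.EssFiniteType.comp k C O
  have hsurj : Function.Surjective (algebraMap k (C ⧸ P)) := by
    let := Ideal.Quotient.field P
    have := finite_of_finite_type_of_isJacobsonRing k (C ⧸ P)
    exact (IsAlgClosed.algebraMap_bijective_of_isIntegral (k := k) (K := C ⧸ P)).2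
  have hres (f : O) : ∃ c : k, f - algebraMap k O c ∈ IsLocalRing.maximalIdeal O := by
    obtain ⟨q, hq⟩ := (IsLocalization.AtPrime.equivQuotMaximalIdeal P O).surjective
      (Ideal.Quotient.mk _ f)
    obtain ⟨c, rfl⟩ := hsurj q
    refine ⟨c, ?_⟩
    rw [← Ideal.Quotient.eq, ← hq, IsScalarTower.algebraMap_apply k C (C ⧸ P),
      Ideal.Quotient.algebraMap_eq, IsLocalization.AtPrime.equivQuotMaximalIdeal_apply_mk,
      ← IsScalarTower.algebraMap_apply]
  obtain ⟨v, h1, h2, h3, h4⟩ := IsDiscreteValuationRing.exists_order_derivation hres D hD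
  refine ⟨v, h1, ?_, h3, h4⟩
  by_contra! hvx
  have hs0' : algebraMap C F s ≠ 0 := (map_ne_zero_iff _ (IsFractionRing.injective C F)).2 hs0
  obtain ⟨g, hg⟩ := h2 _ (inv_ne_zero hs0') hvx
  have hsO : algebraMap C O s ∈ IsLocalRing.maximalIdeal O :=
    (IsLocalization.AtPrime.to_map_mem_maximal_iff O P s).2 hsP
  refine hsO (IsUnit.of_mul_eq_one g (IsFractionRing.injective O F ?_))
  rw [map_mul, hg, ← IsScalarTower.algebraMap_apply, mul_inv_cancel₀ hs0', map_one]

open scoped IntermediateField IntermediateField.algebraAdjoinAdjoin in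
theorem IntermediateField.exists_order_derivation_of_transcendental {k F : Type*} [Field k]
    [IsAlgClosed k] [CharZero k] [Field F] [Algebra k F] [Algebra.EssFiniteType k F] {s : F}
    (hs : Transcendental k s) [Algebra.IsAlgebraic k⟮s⟯ F] (D : Derivation k F F) (hD : D ≠ 0) :
    ∃ v : F → ℤ, (∀ f g, f ≠ 0 → g ≠ 0 → v (f * g) = v f + v g) ∧ v s⁻¹ < 0 ∧
      (∀ f, f ≠ 0 → 0 ≤ v f → ∃ c : k, f - algebraMap k F c = 0 ∨ 0 < v (f - algebraMap k F c)) ∧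
      ∃ γ : ℤ, ∀ f, f ≠ 0 → v f ≠ 0 → D f ≠ 0 ∧ v (D f) = v f + γ := by
  let S := Algebra.adjoin k {s}
  let e : Polynomial k ≃ₐ[k] S :=
    (AlgEquiv.ofInjective _ (transcendental_iff_injective.1 hs)).trans
      (Subalgebra.equivOfEq _ _ (Algebra.adjoin_singleton_eq_range_aeval k s).symm)
  have : IsPrincipalIdealRing S :=
    IsPrincipalIdealRing.of_surjective e.toRingEquiv.toRingHom e.surjective
  have : Algebra.EssFiniteType k⟮s⟯ F := Algebra.EssFiniteType.of_comp k _ _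
  have : FiniteDimensional k⟮s⟯ F := Algebra.finite_of_essFiniteType_of_isAlgebraic
  let C := integralClosure S F
  have : IsDedekindDomain C := integralClosure.isDedekindDomain S k⟮s⟯ F
  have : Module.Finite S C := IsIntegralClosure.finite S k⟮s⟯ F C
  have : IsFractionRing C F := IsIntegralClosure.isFractionRing_of_finite_extension S k⟮s⟯ F C
  have : Algebra.FiniteType k S := Algebra.FiniteType.equiv inferInstance e
  have : Algebra.FiniteType k C := Algebra.FiniteType.trans (S := S) inferInstance inferInstance
  let sS : S := ⟨s, Algebra.self_mem_adjoin_singleton k s⟩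
  have hsS : ¬ IsUnit sS := by
    intro h
    have he : e Polynomial.X = sS := Subtype.ext (by simp [e, sS])
    rw [← he, MulEquiv.isUnit_map] at h
    exact Polynomial.not_isUnit_X h
  have hSC : Function.Injective (algebraMap S C) := fun a b h ↦
    Subtype.ext (congrArg (algebraMap C F) h)
  have : Algebra.IsIntegral S C := IsIntegralClosure.isIntegral_algebra S F
  have : IsLocalHom (algebraMap S C) := (algebraMap_isIntegral_iff.mpr this).isLocalHom hSC
  have hsC : ¬ IsUnit (algebraMap S C sS) := fun h ↦ hsS (isUnit_of_map_unit _ _ h)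
  have hs0 : algebraMap S C sS ≠ 0 := fun h ↦ by
    have h' := congrArg (algebraMap C F) h
    rw [← IsScalarTower.algebraMap_apply, map_zero] at h'
    have h'' : s = 0 := h'
    exact hs (h'' ▸ isAlgebraic_zero)
  have := IsDedekindDomain.exists_order_derivation (k := k) hs0 hsC D hD
  rwa [← IsScalarTower.algebraMap_apply] at this

open Polynomial in
theorem Derivation.transcendental_of_apply_eq_one {k A : Type*} [Field k] [CharZero k]
    [CommRing A] [Nontrivial A] [Algebra k A] (D : Derivation k A A) {x : A} (hx : D x = 1) :
    Transcendental k x := by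
  have key (n : ℕ) : ∀ P : k[X], P.natDegree ≤ n → aeval x P = 0 → P = 0 := by
    induction n with
    | zero =>
      intro P hP h
      rw [eq_C_of_natDegree_le_zero hP, aeval_C, map_eq_zero] at h
      rw [eq_C_of_natDegree_le_zero hP, h, C_0]
    | succ n ih =>
      intro P hP h
      have h' : aeval x (derivative P) = 0 := by
        simpa [hx, h] using (D.map_aeval P x).symm
      have hP' := ih _ ((natDegree_derivative_le P).trans (by omega)) h'
      have hC := eq_C_of_derivative_eq_zero hP'
      rw [hC, aeval_C, map_eq_zero] at h
      rw [hC, h, C_0]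
  rw [transcendental_iff]
  exact fun P hP ↦ key _ P le_rfl hP

open Polynomial in
theorem Polynomial.exists_derivative_eq {k : Type*} [Field k] [CharZero k] (q : k[X]) :
    ∃ Q : k[X], derivative Q = q := by
  induction q using Polynomial.induction_on' with
  | add p q hp hq =>
    obtain ⟨P, rfl⟩ := hp
    obtain ⟨Q, rfl⟩ := hq
    exact ⟨P + Q, derivative_add⟩
  | monomial n a =>
    refine ⟨monomial (n + 1) (a / (n + 1)), ?_⟩
    rw [derivative_monomial]
    have : (n : k) + 1 ≠ 0 := by exact_mod_cast n.succ_ne_zero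
    simp [div_mul_cancel₀ _ this]

open Polynomial IntermediateField in
/-- A surjective derivation of an affine domain of dimension at most one over an algebraically
closed field of characteristic zero is the derivative of a polynomial ring. -/
theorem Derivation.exists_bijective_aeval_of_surjective {k A : Type*} [Field k] [IsAlgClosed k]
    [CharZero k] [CommRing A] [IsDomain A] [Algebra k A] [Algebra.FiniteType k A]
    (htr : Algebra.trdeg k A ≤ 1) (D : Derivation k A A) (hD : Function.Surjective D) :
    ∃ x : A, D x = 1 ∧ Function.Bijective (aeval x : k[X] →ₐ[k] A) := by
  obtain ⟨x, hx⟩ := hD 1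
  have hxt := D.transcendental_of_apply_eq_one hx
  refine ⟨x, hx, transcendental_iff_injective.1 hxt, ?_⟩
  let F := FractionRing A
  have hinj : Function.Injective (algebraMap A F) := IsFractionRing.injective A F
  obtain ⟨E, hE⟩ := D.exists_extend_fractionRing (F := F)
  have : Algebra.EssFiniteType k F := by
    have : Algebra.EssFiniteType A F :=
      Algebra.EssFiniteType.of_isLocalization _ (nonZeroDivisors A)
    exact Algebra.EssFiniteType.comp k A F
  have : Algebra.IsAlgebraic A F := IsLocalization.isAlgebraic F (nonZeroDivisors A)
  let s : F := (algebraMap A F x)⁻¹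
  have hs : s⁻¹ = algebraMap A F x := inv_inv _
  have hst : Transcendental k s := fun h ↦
    (transcendental_algebraMap_iff hinj).2 hxt (hs ▸ h.inv)
  have : Algebra.IsAlgebraic k⟮s⟯ F := by
    have h1 : AlgebraicIndependent k (fun _ : Unit ↦ x) :=
      algebraicIndependent_unique_type_iff.2 hxt
    have h2 := (h1.isTranscendenceBasis_of_lift_trdeg_le_of_finite
      (by simpa using htr)).algebraMap_comp (A := F)
    have h3 := h2.isAlgebraic_field
    have : IntermediateField.adjoin k (Set.range (algebraMap A F ∘ fun _ : Unit ↦ x)) = k⟮s⟯ := by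
      rw [Set.range_comp, Set.range_const, Set.image_singleton]
      refine le_antisymm (adjoin_simple_le_iff.2 ?_) (adjoin_simple_le_iff.2 ?_)
      · exact hs ▸ inv_mem (mem_adjoin_simple_self k s)
      · exact inv_mem (mem_adjoin_simple_self k _)
    rwa [this] at h3
  have hE0 : E ≠ 0 := by
    rintro rfl
    simpa [hx] using hE x
  obtain ⟨v, hmul, hv, hres, γ, hγ⟩ := exists_order_derivation_of_transcendental hst E hE0
  obtain ⟨hker, hnil⟩ := D.exists_iterate_eq_zero_of_order hinj E hE hD v hmul hres γ hγ hx
    (hs ▸ hv)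
  intro a
  obtain ⟨n, hn⟩ := hnil a
  induction n generalizing a with
  | zero => exact ⟨0, by simpa using hn.symm⟩
  | succ n ih =>
    obtain ⟨q, hq⟩ := ih (D a) (by rwa [Function.iterate_succ_apply] at hn)
    obtain ⟨Q, rfl⟩ := exists_derivative_eq q
    obtain ⟨c, hc⟩ := hker (a - aeval x Q) (by
      rw [map_sub, D.map_aeval, hx, smul_eq_mul, mul_one, hq, sub_self])
    exact ⟨Q + C c, by simp [hc]⟩

open Polynomial in
theorem Polynomial.natDegree_le_totalDegree_of_aeval_derivative {k : Type*} [Field k] [CharZero k]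
    (f : k[X]) {P : MvPolynomial (Fin 2) k} (hP : P ≠ 0)
    (h : MvPolynomial.aeval ![f, derivative f] P = 0) : f.natDegree ≤ P.totalDegree := by
  by_contra! hlt
  have hn : 0 < f.natDegree := by omega
  have hf : f ≠ 0 := by rintro rfl; simp at hn
  have hf'd : (derivative f).degree = (f.natDegree - 1 : ℕ) := degree_derivative hn.ne'
  have hf' : derivative f ≠ 0 := by intro h0; rw [h0, degree_zero] at hf'd; cases hf'd
  have hf'n : (derivative f).natDegree = f.natDegree - 1 := natDegree_eq_of_degree_eq_some hf'd
  let t (d : Fin 2 →₀ ℕ) : k[X] := C (P.coeff d) * (f ^ d 0 * derivative f ^ d 1)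
  have ht0 {d} (hd : d ∈ P.support) : t d ≠ 0 :=
    mul_ne_zero (C_ne_zero.2 (MvPolynomial.mem_support_iff.1 hd))
      (mul_ne_zero (pow_ne_zero _ hf) (pow_ne_zero _ hf'))
  have htd {d} (hd : d ∈ P.support) :
      (t d).natDegree = d 0 * f.natDegree + d 1 * (f.natDegree - 1) := by
    rw [natDegree_C_mul (MvPolynomial.mem_support_iff.1 hd),
      natDegree_mul (pow_ne_zero _ hf) (pow_ne_zero _ hf'), natDegree_pow, natDegree_pow, hf'n]
  have hsum : P.support.sum t = 0 := by
    rw [← h, MvPolynomial.aeval_def, MvPolynomial.eval₂_eq']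
    simp [t, Fin.prod_univ_two, Polynomial.algebraMap_eq]
  have hle {d} (hd : d ∈ P.support) : d 0 + d 1 ≤ P.totalDegree := by
    simpa [Finsupp.sum_fintype, Fin.sum_univ_two] using MvPolynomial.le_totalDegree hd
  have hdis : Set.Pairwise {d | d ∈ P.support ∧ t d ≠ 0} (Function.onFun Ne (degree ∘ t)) := by
    rintro d ⟨hd, -⟩ e ⟨he, -⟩ hde heq
    apply hde
    have heq' : (t d).natDegree = (t e).natDegree := natDegree_eq_of_degree_eq heq
    rw [htd hd, htd he] at heq'
    have h1 := hle hd
    have h2 := hle he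
    obtain ⟨n, hn'⟩ : ∃ n, f.natDegree = n + 1 := ⟨f.natDegree - 1, by omega⟩
    rw [hn'] at heq' hlt
    simp only [Nat.add_sub_cancel] at heq'
    have e1 : d 0 + n * (d 0 + d 1) = e 0 + n * (e 0 + e 1) := by linarith
    have hs : d 0 + d 1 = e 0 + e 1 := by
      rcases lt_trichotomy (d 0 + d 1) (e 0 + e 1) with hl | hl | hl
      · nlinarith
      · exact hl
      · nlinarith
    rw [hs] at e1
    ext i
    fin_cases i <;> simp <;> omega
  have := degree_sum_eq_of_disjoint t P.support hdis
  rw [hsum, degree_zero, eq_comm, Finset.sup_eq_bot_iff] at this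
  obtain ⟨d, hd⟩ := MvPolynomial.support_nonempty.2 hP
  exact ht0 hd (degree_eq_bot.1 (this d hd))

theorem Ideal.exists_algHom_ker_eq_of_isAlgClosed {k R : Type*} [Field k] [IsAlgClosed k]
    [CommRing R] [Algebra k R] [Algebra.FiniteType k R] (m : Ideal R) [m.IsMaximal] :
    ∃ φ : R →ₐ[k] k, RingHom.ker φ = m := by
  let : Field (R ⧸ m) := Ideal.Quotient.field m
  have : Algebra.FiniteType k (R ⧸ m) :=
    .of_surjective (Ideal.Quotient.mkₐ k m) Ideal.Quotient.mk_surjective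
  have : Module.Finite k (R ⧸ m) := finite_of_finite_type_of_isJacobsonRing k (R ⧸ m)
  let e := AlgEquiv.ofBijective (Algebra.ofId k (R ⧸ m))
    IsAlgClosed.algebraMap_bijective_of_isIntegral
  refine ⟨e.symm.toAlgHom.comp (Ideal.Quotient.mkₐ k m), ?_⟩
  ext r
  simp [RingHom.mem_ker, Ideal.Quotient.eq_zero_iff_mem]

theorem MvPolynomial.exists_aeval_quotient_map_eq_zero {k R B σ : Type*} [Field k]
    [IsAlgClosed k] [CommRing R] [Algebra k R] [Algebra.FiniteType k R] [CommRing B] [Algebra k B]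
    [Algebra R B] [IsScalarTower k R B] (m : Ideal R) [m.IsMaximal] {P : MvPolynomial σ R}
    {d : σ →₀ ℕ} (hd : P.coeff d ∉ m) {b : σ → B} (h : aeval b P = 0) :
    ∃ Q : MvPolynomial σ k, Q ≠ 0 ∧ Q.totalDegree ≤ P.totalDegree ∧
      aeval (fun i ↦ Ideal.Quotient.mk (m.map (algebraMap R B)) (b i)) Q = 0 := by
  obtain ⟨φ, hφ⟩ := m.exists_algHom_ker_eq_of_isAlgClosed (k := k)
  refine ⟨P.map (φ : R →+* k), fun h0 ↦ hd ?_, Finset.sup_mono (support_map_subset _ _), ?_⟩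
  · rw [← hφ, RingHom.mem_ker]
    simpa [coeff_map] using congrArg (coeff d) h0
  · have hφm (r : R) : algebraMap k (B ⧸ m.map (algebraMap R B)) (φ r) =
        Ideal.Quotient.mk _ (algebraMap R B r) := by
      have : r - algebraMap k R (φ r) ∈ m := by
        rw [← hφ, RingHom.mem_ker]
        simp
      have := Ideal.mem_map_of_mem (algebraMap R B) this
      rw [map_sub, ← IsScalarTower.algebraMap_apply] at this
      exact (Ideal.Quotient.eq.2 this).symm
    rw [aeval_def, eval₂_map]
    have := congrArg (Ideal.Quotient.mk (m.map (algebraMap R B))) h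
    rw [map_zero, aeval_def, ← RingHom.coe_coe, eval₂_comp_left] at this
    rw [← this]
    congr 1
    ext r
    exact hφm r

theorem Algebra.trdeg_le_one_of_adjoin_eq_top {k A : Type*} [Field k] [CommRing A] [IsDomain A]
    [Algebra k A] {S : Set A} (hS : Algebra.adjoin k S = ⊤)
    (h : ∀ a ∈ S, ∀ b ∈ S, ¬ AlgebraicIndependent k ![a, b]) : Algebra.trdeg k A ≤ 1 := by
  have : Algebra.IsAlgebraic (Algebra.adjoin k S) A :=
    ⟨fun a ↦ isAlgebraic_algebraMap (⟨a, hS ▸ Algebra.mem_top⟩ : Algebra.adjoin k S)⟩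
  obtain ⟨t, hts, ht⟩ := exists_isTranscendenceBasis_subset (R := k) S
  rw [← ht.cardinalMk_eq_trdeg, Cardinal.le_one_iff_subsingleton]
  refine ⟨fun a b ↦ ?_⟩
  by_contra hab
  refine h a (hts a.2) b (hts b.2) ?_
  have hinj : Function.Injective ![a, b] := by
    intro i j hij
    fin_cases i <;> fin_cases j <;> simp_all [eq_comm]
  convert! ht.1.comp ![a, b] hinj using 1
  ext i
  fin_cases i <;> rfl

theorem exists_aeval_eq_zero_of_isTranscendenceBasis_unit {R B K L : Type*} [CommRing R]
    [IsDomain R] [CommRing B] [IsDomain B] [Algebra R B] [Field K] [Algebra R K]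
    [IsFractionRing R K] [Field L] [Algebra B L] [IsFractionRing B L] [Algebra K L] [Algebra R L]
    [IsScalarTower R K L] [IsScalarTower R B L] {x : L}
    (hx : IsTranscendenceBasis K (fun _ : Unit ↦ x)) (b c : B) :
    ∃ P : MvPolynomial (Fin 2) R, P ≠ 0 ∧ MvPolynomial.aeval ![b, c] P = 0 := by
  by_contra! h
  have h1 : AlgebraicIndependent R ![b, c] :=
    algebraicIndependent_iff.2 fun P hP ↦ by_contra fun h0 ↦ h P h0 hP
  have h2 := h1.map' (f := IsScalarTower.toAlgHom R B L) (IsFractionRing.injective B L)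
  have : Algebra.IsAlgebraic R K := IsLocalization.isAlgebraic K (nonZeroDivisors R)
  have h3 := (h2.extendScalars K).lift_cardinalMk_le_trdeg
  rw [← hx.lift_cardinalMk_eq_trdeg] at h3
  simp at h3

theorem Ideal.exists_isMaximal_notMem_map {k R B : Type*} [Field k] [CommRing R]
    [CommRing B] [IsDomain B] [Algebra k R] [Algebra k B] [Algebra.FiniteType k B]
    [Algebra R B] [IsScalarTower k R B] (hinj : Function.Injective (algebraMap R B))
    {c : R} (hc : c ≠ 0) {b : B} (hb : b ≠ 0) :
    ∃ m : Ideal R, m.IsMaximal ∧ c ∉ m ∧ b ∉ m.map (algebraMap R B) := by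
  have : IsJacobsonRing B := isJacobsonRing_of_finiteType (A := k)
  have hne : b * algebraMap R B c ≠ 0 := mul_ne_zero hb ((map_ne_zero_iff _ hinj).2 hc)
  have hjac : (⊥ : Ideal B).jacobson = ⊥ :=
    IsJacobsonRing.out ‹_› Ideal.isPrime_bot.isRadical
  obtain ⟨n, hn, hbn⟩ : ∃ n : Ideal B, n.IsMaximal ∧ b * algebraMap R B c ∉ n := by
    by_contra! h
    apply hne
    rw [← Ideal.mem_bot, ← hjac, Ideal.jacobson, Submodule.mem_sInf]
    exact fun n hn ↦ h n hn.2
  let : Field (B ⧸ n) := Ideal.Quotient.field n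
  have : Algebra.FiniteType k (B ⧸ n) :=
    .of_surjective (Ideal.Quotient.mkₐ k n) Ideal.Quotient.mk_surjective
  have : Module.Finite k (B ⧸ n) := finite_of_finite_type_of_isJacobsonRing k (B ⧸ n)
  have hmax : (n.comap (algebraMap R B)).IsMaximal := by
    have : IsScalarTower k R (B ⧸ n) := .of_algebraMap_eq fun x ↦ by
      rw [IsScalarTower.algebraMap_apply k B, IsScalarTower.algebraMap_apply k R B]; rfl
    have : Algebra.IsIntegral R (B ⧸ n) := .tower_top k
    have := Ideal.isMaximal_comap_of_isIntegral_of_isMaximal (R := R) (⊥ : Ideal (B ⧸ n))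
    convert this
    ext r
    rw [mem_comap, mem_comap, mem_bot]
    exact Ideal.Quotient.eq_zero_iff_mem.symm
  exact ⟨_, hmax, fun h ↦ hbn (n.mul_mem_left _ h),
    fun h ↦ hbn (n.mul_mem_right _ (Ideal.map_comap_le h))⟩

theorem Derivation.mem_map_of_mem_map {R B : Type*} [CommRing R] [CommRing B] [Algebra R B]
    (D : Derivation R B B) (m : Ideal R) {b : B} (hb : b ∈ m.map (algebraMap R B)) :
    D b ∈ m.map (algebraMap R B) := by
  refine Submodule.span_induction ?_ (by simp) (fun x y _ _ hx hy ↦ ?_) (fun a x hx hDx ↦ ?_) hb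
  · rintro _ ⟨r, -, rfl⟩
    simp
  · rw [map_add]
    exact add_mem hx hy
  · rw [smul_eq_mul, D.leibniz]
    exact add_mem (Ideal.mul_mem_left _ _ hDx) (Ideal.mul_mem_right _ _ hx)

open Polynomial in
theorem Derivation.iterate_eq_zero_of_natDegree_lt {k A : Type*} [CommRing k] [CommRing A]
    [Algebra k A] (D : Derivation k A A) {x : A} (hx : D x = 1) (n : ℕ) (f : k[X])
    (hf : f.natDegree < n) : D^[n] (aeval x f) = 0 := by
  have key (n : ℕ) : D^[n] (aeval x f) = aeval x (derivative^[n] f) := by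
    induction n with
    | zero => rfl
    | succ n ih =>
      rw [Function.iterate_succ_apply', Function.iterate_succ_apply', ih, D.map_aeval, hx,
        smul_eq_mul, mul_one]
  rw [key, iterate_derivative_eq_zero hf, map_zero]

/-- **Corollary 1.5**: if an `R`-derivation `D` of `B` induces a surjective `k`-linear
derivation on every closed fiber `B/mB` of a dominant morphism of relative dimension one
with irreducible and reduced general fibers, then `D` is locally nilpotent and the
morphism `Spec B → Spec R` is an `𝔸¹`-fibration over a nonempty open subset: general
fibers are polynomial rings `k[x]`. Here `K` and `L` are the fraction fields of `R` and
`B`, and relative dimension one means `trdeg(L/K) = 1`, i.e. `L` admits a one-element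
transcendence basis over `K`. -/
theorem Derivation.isLocallyNilpotent_and_A1_fibration_of_surjective_fibers
    (k : Type*) [Field k] [IsAlgClosed k] [CharZero k]
    (R B : Type*) [CommRing R] [IsDomain R] [Algebra k R] [Algebra.FiniteType k R]
    [CommRing B] [IsDomain B] [Algebra k B] [Algebra.FiniteType k B]
    [Algebra R B] [IsScalarTower k R B]
    (hinj : Function.Injective (algebraMap R B))
    (s : R) (hs : s ≠ 0)
    (hfib : ∀ m : Ideal R, m.IsMaximal → s ∉ m →
      IsDomain (B ⧸ Ideal.map (algebraMap R B) m))
    (K L : Type*) [Field K] [Algebra R K] [IsFractionRing R K]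
    [Field L] [Algebra B L] [IsFractionRing B L]
    [Algebra K L] [Algebra R L] [IsScalarTower R K L] [IsScalarTower R B L]
    (htrdeg : ∃ x : L, IsTranscendenceBasis K (fun _ : Unit => x))
    (D : Derivation R B B)
    (hD : ∀ m : Ideal R, m.IsMaximal → ∀ x : B, ∃ b : B,
      D b - x ∈ Ideal.map (algebraMap R B) m) :
    (∀ b : B, ∃ n : ℕ, 1 ≤ n ∧ (⇑D)^[n] b = 0) ∧
      ∃ s' : R, s' ≠ 0 ∧ ∀ m : Ideal R, m.IsMaximal → s' ∉ m →
        Nonempty ((B ⧸ Ideal.map (algebraMap R B) m) ≃ₐ[k] Polynomial k) := by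
  classical
  obtain ⟨ξ, hξ⟩ := htrdeg
  choose P hP0 hP using
    exists_aeval_eq_zero_of_isTranscendenceBasis_unit (R := R) (B := B) hξ
  have hd (b c : B) : ∃ d, (P b c).coeff d ≠ 0 := MvPolynomial.ne_zero_iff.1 (hP0 b c)
  choose d hd using hd
  obtain ⟨S, hS⟩ : (⊤ : Subalgebra k B).FG := Algebra.FiniteType.out
  let c₀ : R := ∏ p ∈ S ×ˢ S, (P p.1 p.2).coeff (d p.1 p.2)
  have hc₀ : c₀ ≠ 0 := Finset.prod_ne_zero_iff.2 fun p _ ↦ hd p.1 p.2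
  have hfiber (m : Ideal R) (hm : m.IsMaximal) (hsm : s * c₀ ∉ m) :
      ∃ (E : Derivation k (B ⧸ m.map (algebraMap R B)) (B ⧸ m.map (algebraMap R B)))
        (x : B ⧸ m.map (algebraMap R B)),
        (∀ b, E (Ideal.Quotient.mk _ b) = Ideal.Quotient.mk _ (D b)) ∧ E x = 1 ∧
          Function.Bijective (Polynomial.aeval (R := k) x) := by
    have := hfib m hm fun h ↦ hsm (m.mul_mem_right _ h)
    let π : B →ₐ[k] B ⧸ m.map (algebraMap R B) := Ideal.Quotient.mkₐ k _
    have hπ : Function.Surjective π := Ideal.Quotient.mk_surjective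
    have : Algebra.FiniteType k (B ⧸ m.map (algebraMap R B)) := .of_surjective π hπ
    have hker (b : B) (hb : π b = 0) : π (D.restrictScalars k b) = 0 :=
      Ideal.Quotient.eq_zero_iff_mem.2
        (D.mem_map_of_mem_map m (Ideal.Quotient.eq_zero_iff_mem.1 hb))
    let E := Derivation.liftOfSurjective hπ hker
    have hE (b : B) : E (π b) = π (D b) := Derivation.liftOfSurjective_apply hπ hker b
    have hEs : Function.Surjective E := by
      intro y
      obtain ⟨y, rfl⟩ := hπ y
      obtain ⟨b, hb⟩ := hD m hm y
      exact ⟨π b, (hE b).trans (Ideal.Quotient.eq.2 hb)⟩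
    have htr : Algebra.trdeg k (B ⧸ m.map (algebraMap R B)) ≤ 1 := by
      refine Algebra.trdeg_le_one_of_adjoin_eq_top (S := π '' S) ?_ ?_
      · rw [← AlgHom.map_adjoin, hS, Algebra.map_top, AlgHom.range_eq_top]
        exact hπ
      · rintro _ ⟨b, hb, rfl⟩ _ ⟨c, hc, rfl⟩ hind
        have hmem : (P b c).coeff (d b c) ∉ m := fun h ↦ hsm <| m.mul_mem_left _ <|
          m.mem_of_dvd (Finset.dvd_prod_of_mem
            (fun p : B × B ↦ (P p.1 p.2).coeff (d p.1 p.2))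
            (Finset.mk_mem_product hb hc)) h
        obtain ⟨Q, hQ0, -, hQ⟩ :=
          MvPolynomial.exists_aeval_quotient_map_eq_zero (k := k) m hmem (hP b c)
        refine hQ0 (algebraicIndependent_iff.1 hind Q ?_)
        rw [← hQ]
        congr 2
        ext i
        fin_cases i <;> rfl
    obtain ⟨x, hx, hbij⟩ := E.exists_bijective_aeval_of_surjective htr hEs
    exact ⟨E, x, hE, hx, hbij⟩
  refine ⟨fun b ↦ ⟨(P b (D b)).totalDegree + 1, by omega, ?_⟩, s * c₀, mul_ne_zero hs hc₀,
    fun m hm hsm ↦ ?_⟩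
  · by_contra hne
    obtain ⟨m, hm, hcm, hbm⟩ := Ideal.exists_isMaximal_notMem_map (k := k) hinj
      (mul_ne_zero (mul_ne_zero hs hc₀) (hd b (D b))) hne
    obtain ⟨E, x, hE, hx, hbij⟩ := hfiber m hm fun h ↦ hcm (m.mul_mem_right _ h)
    obtain ⟨Q, hQ0, hQdeg, hQ⟩ := MvPolynomial.exists_aeval_quotient_map_eq_zero (k := k) m
      (fun h ↦ hcm (m.mul_mem_left _ h)) (hP b (D b))
    obtain ⟨f, hf⟩ := hbij.2 (Ideal.Quotient.mk _ b)
    have hf' : Polynomial.aeval x f.derivative =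
        Ideal.Quotient.mk (m.map (algebraMap R B)) (D b) := by
      rw [← hE, ← hf, E.map_aeval, hx, smul_eq_mul, mul_one]
    have hQf : MvPolynomial.aeval ![f, f.derivative] Q = 0 := by
      apply hbij.1
      rw [map_zero, ← hQ, ← AlgHom.comp_apply, MvPolynomial.comp_aeval]
      congr 2
      ext i
      fin_cases i
      · exact hf
      · exact hf'
    have hdeg := f.natDegree_le_totalDegree_of_aeval_derivative hQ0 hQf
    have hzero := E.iterate_eq_zero_of_natDegree_lt hx _ f
      (Nat.lt_succ_of_le (hdeg.trans hQdeg))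
    have hsemi : Function.Semiconj (Ideal.Quotient.mk (m.map (algebraMap R B))) D E :=
      fun b ↦ (hE b).symm
    rw [hf, ← (hsemi.iterate_right _).eq] at hzero
    exact hbm (Ideal.Quotient.eq_zero_iff_mem.1 hzero)
  · obtain ⟨-, x, -, -, hbij⟩ := hfiber m hm hsm
    exact ⟨(AlgEquiv.ofBijective _ hbij).symm⟩
end

section
/- Let k be an algebraically closed field of characteristic zero, and let R and B be affine domains over k such that B is an R-algebra whose structure map R → B is injective (Spec B → Spec R dominant). Assume that for every maximal ideal m of R the fiber ring B/mB is a (nonzero) integral domain. Then Frac(R) is algebraically closed in Frac(B): every element of Frac(B) that is algebraic over Frac(R) lies in the image of Frac(R). In particular, in characteristic zero the generic fiber B ⊗_R Frac(R) is geometrically integral over Frac(R). -/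
open scoped TensorProduct

/-- A dominant morphism of finite type between integral affine schemes with Noetherian target
hits every point of some nonempty basic open subset. -/
theorem exists_ne_zero_forall_isPrime_exists_comap_eq
    (A C : Type*) [CommRing A] [IsDomain A] [IsNoetherianRing A] [CommRing C] [IsDomain C]
    [Algebra A C] [Algebra.FiniteType A C] (hinj : Function.Injective (algebraMap A C)) :
    ∃ s : A, s ≠ 0 ∧ ∀ p : Ideal A, p.IsPrime → s ∉ p →
      ∃ q : Ideal C, q.IsPrime ∧ q.comap (algebraMap A C) = p := by
  have hfp : (algebraMap A C).FinitePresentation :=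
    RingHom.FinitePresentation.of_finiteType.mp (RingHom.finiteType_algebraMap.mpr inferInstance)
  obtain ⟨S, hS⟩ := PrimeSpectrum.exists_constructibleSetData_iff.mpr
    (PrimeSpectrum.isConstructible_range_comap hfp)
  have hbot : (⊥ : PrimeSpectrum A) ∈ S.toSet := by
    rw [hS]
    refine ⟨⊥, ?_⟩
    ext1
    exact (RingHom.injective_iff_ker_eq_bot _).mp hinj
  simp only [PrimeSpectrum.ConstructibleSetData.toSet, Set.mem_iUnion] at hbot
  obtain ⟨D, hDS, hg, hf⟩ := hbot
  simp only [PrimeSpectrum.mem_zeroLocus, Set.range_subset_iff, Set.singleton_subset_iff,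
    SetLike.mem_coe] at hg hf
  refine ⟨D.f, by simpa using hf, fun p hp hfp ↦ ?_⟩
  have hmem : (⟨p, hp⟩ : PrimeSpectrum A) ∈ S.toSet := by
    simp only [PrimeSpectrum.ConstructibleSetData.toSet, Set.mem_iUnion]
    refine ⟨D, hDS, ?_, by simpa using hfp⟩
    rintro _ ⟨i, rfl⟩
    have h0 : D.g i = 0 := by simpa using hg i
    simp [h0]
  rw [hS] at hmem
  obtain ⟨q, hq⟩ := hmem
  exact ⟨q.asIdeal, q.isPrime, congrArg PrimeSpectrum.asIdeal hq⟩

/-- A nonzero element of an affine domain over an algebraically closed field is nonzero at some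
rational point. -/
theorem exists_algHom_ne_zero_of_ne_zero
    (k : Type*) [Field k] [IsAlgClosed k] {D : Type*} [CommRing D] [IsDomain D] [Algebra k D]
    [Algebra.FiniteType k D] {d : D} (hd : d ≠ 0) : ∃ φ : D →ₐ[k] k, φ d ≠ 0 := by
  let D' := Localization.Away d
  have : IsDomain D' :=
    IsLocalization.isDomain_localization (powers_le_nonZeroDivisors_of_noZeroDivisors hd)
  have : Algebra.FiniteType k D' := Algebra.FiniteType.trans (S := D) ‹_› inferInstance
  obtain ⟨M, hM⟩ := Ideal.exists_maximal D'
  let : Field (D' ⧸ M) := Ideal.Quotient.field M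
  have : Module.Finite k (D' ⧸ M) := finite_of_finite_type_of_isJacobsonRing k (D' ⧸ M)
  let e : k ≃ₐ[k] (D' ⧸ M) := AlgEquiv.ofBijective (Algebra.ofId k _)
    IsAlgClosed.algebraMap_bijective_of_isIntegral
  let ψ : D →ₐ[k] k :=
    (e.symm.toAlgHom.comp (Ideal.Quotient.mkₐ k M)).comp (IsScalarTower.toAlgHom k D D')
  refine ⟨ψ, IsUnit.ne_zero ?_⟩
  exact (IsLocalization.Away.algebraMap_isUnit (S := D') d).map
    (e.symm.toAlgHom.comp (Ideal.Quotient.mkₐ k M))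

/-- Two generic points of an `R`-algebra `A` that differ at `x` specialize to two
`k`-points that lie in the same fiber over `R`, differ at `x`, and do not kill `d`. -/
theorem exists_algHom_pair_ne
    (k : Type*) [Field k] [IsAlgClosed k] {R A Ω : Type*} [CommRing R] [Algebra k R]
    [Algebra.FiniteType k R] [CommRing A] [Algebra R A] [Algebra.FiniteType R A]
    [Algebra k A] [IsScalarTower k R A] [Field Ω] [Algebra R Ω]
    (j₁ j₂ : A →ₐ[R] Ω) {x d : A} (hx : j₁ x ≠ j₂ x) (h₁ : j₁ d ≠ 0) (h₂ : j₂ d ≠ 0) :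
    ∃ φ₁ φ₂ : A →ₐ[k] k, (∀ r : R, φ₁ (algebraMap R A r) = φ₂ (algebraMap R A r)) ∧
      φ₁ x ≠ φ₂ x ∧ φ₁ d ≠ 0 ∧ φ₂ d ≠ 0 := by
  let P := Algebra.TensorProduct.productMap j₁ j₂
  let : Algebra k Ω := ((algebraMap R Ω).comp (algebraMap k R)).toAlgebra
  have : IsScalarTower k R Ω := .of_algebraMap_eq fun _ ↦ rfl
  have : Algebra.FiniteType R (A ⊗[R] A) := Algebra.FiniteType.trans (S := A) ‹_› inferInstance
  have : Algebra.FiniteType R P.range := .of_surjective P.rangeRestrict P.rangeRestrict_surjective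
  have : Algebra.FiniteType k P.range := .trans (S := R) ‹_› this
  let i₁ : A →ₐ[R] P.range := P.rangeRestrict.comp Algebra.TensorProduct.includeLeft
  let i₂ : A →ₐ[R] P.range := P.rangeRestrict.comp Algebra.TensorProduct.includeRight
  have hi₁ (a : A) : (i₁ a : Ω) = j₁ a := by simp [i₁, P]
  have hi₂ (a : A) : (i₂ a : Ω) = j₂ a := by simp [i₂, P]
  have hne : (i₁ x - i₂ x) * (i₁ d * i₂ d) ≠ 0 := by
    intro h
    have := congrArg Subtype.val h
    simp [hi₁, hi₂, sub_eq_zero, hx, h₁, h₂] at this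
  obtain ⟨ψ, hψ⟩ := exists_algHom_ne_zero_of_ne_zero k hne
  simp only [map_mul, map_sub, mul_ne_zero_iff, sub_ne_zero] at hψ
  refine ⟨ψ.comp (i₁.restrictScalars k), ψ.comp (i₂.restrictScalars k), fun r ↦ ?_, hψ.1,
    hψ.2.1, hψ.2.2⟩
  simp

/-- If the fiber of `R → B` under two `k`-points of `A` is integral and both points lift to a
localization `C ⊇ A` of `B`, then they agree on every element of `A` that remains algebraic
on the fiber. -/
theorem algHom_apply_eq_of_isDomain_fiber
    {k : Type*} [Field k] [IsAlgClosed k] {R A B C : Type*} [CommRing R] [Algebra k R]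
    [CommRing A] [Algebra k A] [Algebra R A] [IsScalarTower k R A]
    [CommRing B] [Algebra k B] [Algebra R B] [IsScalarTower k R B]
    [CommRing C] [Algebra R C] [Algebra A C] [Algebra B C]
    [IsScalarTower R A C] [IsScalarTower R B C]
    (hfib : ∀ m : Ideal R, m.IsMaximal → IsDomain (B ⧸ m.map (algebraMap R B)))
    (c : B) [IsLocalization.Away c C] (φ₁ φ₂ : A →ₐ[k] k)
    (hφ : ∀ r : R, φ₁ (algebraMap R A r) = φ₂ (algebraMap R A r))
    {q₁ q₂ : Ideal C} [q₁.IsPrime] [q₂.IsPrime]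
    (hq₁ : q₁.comap (algebraMap A C) = RingHom.ker φ₁)
    (hq₂ : q₂.comap (algebraMap A C) = RingHom.ker φ₂)
    {x : A} {F : Polynomial R} (hF : Polynomial.aeval x F = 0)
    (hlc : φ₁ (algebraMap R A F.leadingCoeff) ≠ 0) : φ₁ x = φ₂ x := by
  let χ : R →ₐ[k] k := φ₁.comp (IsScalarTower.toAlgHom k R A)
  have hχ (r : R) : χ r = φ₁ (algebraMap R A r) := rfl
  let m : Ideal R := RingHom.ker χ
  have hm : m.IsMaximal :=
    RingHom.ker_isMaximal_of_surjective χ fun a ↦ ⟨algebraMap k R a, by simp⟩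
  let I : Ideal B := m.map (algebraMap R B)
  have : IsDomain (B ⧸ I) := hfib m hm
  have hI (q : Ideal C) (φ : A →ₐ[k] k) (hq : q.comap (algebraMap A C) = RingHom.ker φ)
      (hφ : ∀ r, χ r = φ (algebraMap R A r)) (b : B) (hb : b ∈ I) : algebraMap B C b ∈ q := by
    have : I ≤ q.comap (algebraMap B C) := by
      refine Ideal.map_le_iff_le_comap.mpr fun r hr ↦ ?_
      have : algebraMap R A r ∈ q.comap (algebraMap A C) := by
        rw [hq, RingHom.mem_ker, ← hφ]
        exact hr
      rw [Ideal.mem_comap, Ideal.mem_comap, ← IsScalarTower.algebraMap_apply]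
      rwa [Ideal.mem_comap, ← IsScalarTower.algebraMap_apply] at this
    exact this hb
  let E := FractionRing (B ⧸ I)
  let g : B →ₐ[k] E := (IsScalarTower.toAlgHom k (B ⧸ I) E).comp (Ideal.Quotient.mkₐ k I)
  have hg (b : B) : g b = 0 ↔ b ∈ I := by
    rw [← Ideal.Quotient.eq_zero_iff_mem]
    exact FaithfulSMul.algebraMap_eq_zero_iff (B ⧸ I) E
  have hc : IsUnit (g c) := by
    rw [isUnit_iff_ne_zero, Ne, hg]
    intro h
    exact ‹q₁.IsPrime›.ne_top <| Ideal.eq_top_of_isUnit_mem _ (hI q₁ φ₁ hq₁ hχ c h)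
      (IsLocalization.Away.algebraMap_isUnit c)
  let G : C →+* E := IsLocalization.Away.lift c (g := g.toRingHom) hc
  have hG (b : B) : G (algebraMap B C b) = g b := IsLocalization.Away.lift_eq c hc b
  have hGR : G.comp (algebraMap R C) = (algebraMap k E).comp χ.toRingHom := by
    ext r
    have : algebraMap R B (r - algebraMap k R (χ r)) ∈ I :=
      Ideal.mem_map_of_mem _ (by simp [m, RingHom.mem_ker])
    rw [← hg, map_sub, map_sub, ← IsScalarTower.algebraMap_apply, AlgHom.commutes,
      sub_eq_zero] at this
    rw [RingHom.comp_apply, IsScalarTower.algebraMap_apply R B C, hG, this]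
    rfl
  have hFk : F.map χ.toRingHom ≠ 0 := by
    intro h
    apply hlc
    rw [← hχ, Polynomial.leadingCoeff]
    exact (Polynomial.coeff_map _ _).symm.trans (by rw [h, Polynomial.coeff_zero])
  have hroot : Polynomial.aeval (G (algebraMap A C x)) (F.map χ.toRingHom) = 0 := by
    rw [Polynomial.aeval_def, Polynomial.eval₂_map, ← hGR, ← Polynomial.hom_eval₂,
      ← Polynomial.aeval_def, Polynomial.aeval_algebraMap_apply, hF, map_zero, map_zero]
  obtain ⟨a, ha⟩ : ∃ a : k, algebraMap k E a = G (algebraMap A C x) := by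
    have := IntermediateField.eq_bot_of_isAlgClosed_of_isAlgebraic (algebraicClosure k E)
    have hmem : G (algebraMap A C x) ∈ algebraicClosure k E :=
      mem_algebraicClosure_iff.mpr ⟨_, hFk, hroot⟩
    rwa [this, IntermediateField.mem_bot] at hmem
  obtain ⟨⟨b, y⟩, hb⟩ := IsLocalization.surj (Submonoid.powers c) (algebraMap A C x)
  have hbI : b - algebraMap k B a * y ∈ I := by
    have := congrArg G hb
    simp only [map_mul, hG] at this
    rw [← hg, map_sub, map_mul, AlgHom.commutes, ha, ← this, sub_self]
  have key (q : Ideal C) [q.IsPrime] (φ : A →ₐ[k] k)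
      (hq : q.comap (algebraMap A C) = RingHom.ker φ)
      (hφ : ∀ r, χ r = φ (algebraMap R A r)) : φ x = a := by
    have h := hI q φ hq hφ _ hbI
    have hk : algebraMap B C (algebraMap k B a) = algebraMap A C (algebraMap k A a) := by
      rw [IsScalarTower.algebraMap_apply k R B, IsScalarTower.algebraMap_apply k R A,
        ← IsScalarTower.algebraMap_apply R B C, ← IsScalarTower.algebraMap_apply R A C]
    rw [map_sub, ← hb, map_mul, hk, ← sub_mul, ← map_sub] at h
    have h' : x - algebraMap k A a ∈ q.comap (algebraMap A C) :=
      (Ideal.mul_unit_mem_iff_mem _ (IsLocalization.map_units C y)).mp h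
    rw [hq, RingHom.mem_ker, map_sub, AlgHom.commutes, sub_eq_zero] at h'
    exact h'
  rw [key q₁ φ₁ hq₁ hχ, key q₂ φ₂ hq₂ fun r ↦ (hχ r).trans (hφ r)]

/-- An element that is algebraic over a perfect field `K` but does not lie in `K` has two
distinct conjugates. -/
theorem exists_algHom_pair_apply_ne {K L : Type*} [Field K] [PerfectField K] [Field L]
    [Algebra K L] (x : algebraicClosure K L) (hx : ∀ y : K, algebraMap K L y ≠ x) :
    ∃ j₁ j₂ : algebraicClosure K L →ₐ[K] AlgebraicClosure K, j₁ x ≠ j₂ x := by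
  let j : algebraicClosure K L →ₐ[K] AlgebraicClosure K := IsAlgClosed.lift
  have : IsGalois K (AlgebraicClosure K) := { }
  obtain ⟨τ, hτ⟩ : ∃ τ : Gal(AlgebraicClosure K/K), τ (j x) ≠ j x := by
    by_contra! h
    obtain ⟨y, hy⟩ := (InfiniteGalois.mem_range_algebraMap_iff_fixed (k := K) (j x)).mpr h
    rw [← j.commutes] at hy
    exact hx y (congrArg Subtype.val (j.injective hy))
  exact ⟨j, τ.toAlgHom.comp j, hτ.symm⟩

/-- If every closed fiber of `R → B` is integral, then an element of a localization `C` of `B`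
that is algebraic over `Frac R` lies in `Frac R`. -/
theorem exists_algebraMap_eq_of_isAlgebraic_of_isLocalization_away
    {k R B C K L : Type*} [Field k] [IsAlgClosed k]
    [CommRing R] [IsDomain R] [Algebra k R] [Algebra.FiniteType k R]
    [CommRing B] [Algebra k B] [Algebra.FiniteType k B]
    [Algebra R B] [IsScalarTower k R B]
    (hfib : ∀ m : Ideal R, m.IsMaximal → IsDomain (B ⧸ m.map (algebraMap R B)))
    [Field K] [PerfectField K] [Algebra R K] [IsFractionRing R K]
    [Field L] [Algebra K L] [Algebra R L] [IsScalarTower R K L]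
    [CommRing C] [IsDomain C] [Algebra R C] [Algebra B C] [IsScalarTower R B C]
    (c : B) [IsLocalization.Away c C]
    (f : C →ₐ[R] L) (hf : Function.Injective f) (x : C) (hx : IsAlgebraic K (f x)) :
    ∃ y : K, algebraMap K L y = f x := by
  by_contra! hxK
  let M := algebraicClosure K L
  let xM : M := ⟨f x, mem_algebraicClosure_iff.mpr hx⟩
  obtain ⟨j₁, j₂, hj⟩ := exists_algHom_pair_apply_ne xM hxK
  let A : Subalgebra R C := Algebra.adjoin R {x}
  let xA : A := ⟨x, Algebra.self_mem_adjoin_singleton R x⟩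
  have hAM : A ≤ (M.toSubalgebra.restrictScalars R).comap f :=
    Algebra.adjoin_le (Set.singleton_subset_iff.mpr xM.2)
  let ι : A →ₐ[R] M := (f.comp A.val).codRestrict (M.toSubalgebra.restrictScalars R)
    fun a ↦ hAM a.2
  have hι : Function.Injective ι := fun a b h ↦ Subtype.ext (hf (congrArg Subtype.val h))
  have : Algebra.FiniteType R A := A.fg_iff_finiteType.mp
    (by simpa using Subalgebra.fg_adjoin_finset {x})
  let : Algebra k C := ((algebraMap R C).comp (algebraMap k R)).toAlgebra
  have : IsScalarTower k R C := .of_algebraMap_eq fun _ ↦ rfl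
  have : IsScalarTower k B C := .of_algebraMap_eq fun a ↦ by
    rw [IsScalarTower.algebraMap_apply k R B, ← IsScalarTower.algebraMap_apply R B C]
    rfl
  have : Algebra.FiniteType B C := IsLocalization.finiteType_of_monoid_fg (Submonoid.powers c) C
  have : Algebra.FiniteType k C := .trans (S := B) ‹_› this
  have : Algebra.FiniteType A C := .of_restrictScalars_finiteType k A C
  have : IsNoetherianRing R := Algebra.FiniteType.isNoetherianRing k R
  have : IsNoetherianRing A := Algebra.FiniteType.isNoetherianRing R A
  obtain ⟨s, hs, hsC⟩ :=
    exists_ne_zero_forall_isPrime_exists_comap_eq A C Subtype.val_injective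
  have hxR : IsAlgebraic R xA := by
    rw [← isAlgebraic_algHom_iff (f.comp A.val) (hf.comp Subtype.val_injective)]
    exact (IsFractionRing.isAlgebraic_iff R K L).mpr hx
  obtain ⟨F, hF0, hF⟩ := hxR
  have hd : s * algebraMap R A F.leadingCoeff ≠ 0 := by
    refine mul_ne_zero hs fun h ↦ hF0 (Polynomial.leadingCoeff_eq_zero.mp ?_)
    have : algebraMap R L F.leadingCoeff = 0 := by
      rw [← f.commutes, ← A.val.commutes, h, map_zero, map_zero]
    rw [IsScalarTower.algebraMap_apply R K L] at this
    exact IsFractionRing.injective R K ((algebraMap K L).injective (by simpa using this))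
  obtain ⟨φ₁, φ₂, hφ, hne, h₁, h₂⟩ := exists_algHom_pair_ne k
    ((j₁.restrictScalars R).comp ι) ((j₂.restrictScalars R).comp ι) (x := xA) hj
    (d := s * algebraMap R A F.leadingCoeff)
    (fun h ↦ hd (hι (j₁.injective (h.trans (by simp)))))
    (fun h ↦ hd (hι (j₂.injective (h.trans (by simp)))))
  rw [map_mul, mul_ne_zero_iff] at h₁ h₂
  obtain ⟨q₁, hq₁, hq₁'⟩ := hsC _ (RingHom.ker_isPrime φ₁) h₁.1
  obtain ⟨q₂, hq₂, hq₂'⟩ := hsC _ (RingHom.ker_isPrime φ₂) h₂.1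
  exact hne (algHom_apply_eq_of_isDomain_fiber hfib c φ₁ φ₂ hφ hq₁' hq₂' hF h₁.2)

/-- If every closed fiber of `R → B` is integral, then `Frac R` is algebraically closed in
`Frac B`. -/
theorem exists_algebraMap_eq_of_isAlgebraic_of_isDomain_fiber
    (k : Type*) [Field k] [IsAlgClosed k] [CharZero k]
    {R B : Type*} [CommRing R] [IsDomain R] [Algebra k R] [Algebra.FiniteType k R]
    [CommRing B] [IsDomain B] [Algebra k B] [Algebra.FiniteType k B]
    [Algebra R B] [IsScalarTower k R B]
    (hfib : ∀ m : Ideal R, m.IsMaximal → IsDomain (B ⧸ m.map (algebraMap R B)))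
    {K L : Type*} [Field K] [Algebra R K] [IsFractionRing R K]
    [Field L] [Algebra B L] [IsFractionRing B L]
    [Algebra K L] [Algebra R L] [IsScalarTower R K L] [IsScalarTower R B L]
    (x : L) (hx : IsAlgebraic K x) : ∃ y : K, algebraMap K L y = x := by
  have : CharZero R := charZero_of_injective_algebraMap (algebraMap k R).injective
  have : CharZero K := charZero_of_injective_algebraMap (IsFractionRing.injective R K)
  obtain ⟨b, c, hc, rfl⟩ := IsFractionRing.div_surjective B x
  have hcp : Submonoid.powers c ≤ nonZeroDivisors B := Submonoid.powers_le.mpr hc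
  let C := Localization.subalgebra.ofField L _ hcp
  have : IsLocalization.Away c C := Localization.subalgebra.isLocalization_ofField L _ hcp
  exact exists_algebraMap_eq_of_isAlgebraic_of_isLocalization_away (k := k) hfib c
    (C.val.restrictScalars R) Subtype.val_injective
    ⟨_, b, c, Submonoid.mem_powers c, div_eq_mul_inv _ _⟩ hx

/-- If `K` is algebraically closed in `L`, then minimal polynomials over `K` stay minimal
over `L`. -/
theorem minpoly_eq_map_of_forall_isAlgebraic {K L Ω : Type*} [Field K] [Field L] [Field Ω]
    [Algebra K L] [Algebra L Ω] [Algebra K Ω] [IsScalarTower K L Ω]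
    (h : ∀ x : L, IsAlgebraic K x → ∃ y : K, algebraMap K L y = x) {θ : Ω} (hθ : IsIntegral K θ) :
    minpoly L θ = (minpoly K θ).map (algebraMap K L) := by
  have hL : IsIntegral L θ := hθ.tower_top
  have hlift : minpoly L θ ∈ Polynomial.lifts (algebraMap K L) :=
    (Polynomial.lifts_iff_coeff_lifts _).mpr fun n ↦ h _ (Polynomial.isIntegral_coeff_of_dvd _ _
      (minpoly.monic hθ) (minpoly.monic hL) (minpoly.dvd_map_of_isScalarTower K L θ) n).isAlgebraic
  obtain ⟨q, hq, -, hqm⟩ := Polynomial.lifts_and_degree_eq_and_monic hlift (minpoly.monic hL)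
  refine (Polynomial.eq_of_monic_of_dvd_of_natDegree_le (minpoly.monic hL)
    ((minpoly.monic hθ).map _) (minpoly.dvd_map_of_isScalarTower K L θ) ?_).symm
  rw [← hq]
  refine Polynomial.natDegree_le_of_dvd (Polynomial.map_dvd _ (minpoly.dvd K θ ?_))
    (hqm.map _).ne_zero
  rw [← Polynomial.aeval_map_algebraMap L, hq, minpoly.aeval]

/-- Over a perfect field `K`, an extension `L` in which `K` is algebraically closed is linearly
disjoint from every algebraic extension. -/
theorem linearDisjoint_of_forall_isAlgebraic {K L Ω : Type*} [Field K] [PerfectField K]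
    [Field L] [Field Ω] [Algebra K L] [Algebra L Ω] [Algebra K Ω] [IsScalarTower K L Ω]
    (h : ∀ x : L, IsAlgebraic K x → ∃ y : K, algebraMap K L y = x)
    (F : IntermediateField K Ω) [Algebra.IsAlgebraic K F] : F.LinearDisjoint L := by
  rw [IntermediateField.linearDisjoint_iff]
  have : Algebra.IsIntegral K F.toSubalgebra := inferInstanceAs (Algebra.IsIntegral K F)
  refine Subalgebra.LinearDisjoint.of_linearDisjoint_finite_left _ _ fun A hA _ ↦ ?_
  let E : IntermediateField K Ω := A.toIntermediateField' <|
    (isField_of_isIntegral_of_isField' (Field.toIsField K))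
  have : FiniteDimensional K E := ‹Module.Finite K A›
  let pb := Field.powerBasisOfFiniteOfSeparable K E
  have hθi : IsIntegral K (pb.gen : Ω) := (IsIntegral.of_finite K pb.gen).map E.val
  suffices E.LinearDisjoint L from (IntermediateField.linearDisjoint_iff _ _).mp this
  refine .of_basis_left pb.basis ?_
  have hmin : (minpoly L (pb.gen : Ω)).natDegree = pb.dim := by
    rw [minpoly_eq_map_of_forall_isAlgebraic h hθi, Polynomial.natDegree_map,
      ← pb.natDegree_minpoly]
    exact congrArg _ (minpoly.algHom_eq E.val E.val.injective pb.gen)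
  have := linearIndependent_pow (K := L) (pb.gen : Ω)
  convert this.comp (finCongr hmin.symm) (Equiv.injective _)
  ext i
  simp

/-- Over a perfect field `K`, an extension `L` in which `K` is algebraically closed is
geometrically integral. -/
theorem isDomain_tensorProduct_of_forall_isAlgebraic {K L : Type*} [Field K] [PerfectField K]
    [Field L] [Algebra K L] (h : ∀ x : L, IsAlgebraic K x → ∃ y : K, algebraMap K L y = x)
    (F : Type*) [Field F] [Algebra K F] [Algebra.IsAlgebraic K F] : IsDomain (F ⊗[K] L) := by
  let fF : F →ₐ[K] AlgebraicClosure L := IsAlgClosed.lift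
  let e : F ≃ₐ[K] fF.fieldRange := AlgEquiv.ofInjectiveField fF
  have : Algebra.IsAlgebraic K fF.fieldRange := e.isAlgebraic
  have := (linearDisjoint_of_forall_isAlgebraic h fF.fieldRange).isDomain
  exact (Algebra.TensorProduct.congr e (AlgEquiv.refl : L ≃ₐ[K] L)).toMulEquiv.isDomain

/-- **Lemma 2.11**: let `R → B` be an injective map of affine domains over an algebraically
closed field `k` of characteristic zero such that every closed fiber `B/mB` is an integral
domain. Then the fraction field `K` of `R` is algebraically closed in the fraction field `L`
of `B`; in particular (characteristic zero) the generic fiber `B ⊗_R K` is geometrically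
integral over `K`. -/
theorem fractionField_algebraicallyClosed_of_integral_fibers
    (k : Type*) [Field k] [IsAlgClosed k] [CharZero k]
    (R B : Type*) [CommRing R] [IsDomain R] [Algebra k R] [Algebra.FiniteType k R]
    [CommRing B] [IsDomain B] [Algebra k B] [Algebra.FiniteType k B]
    [Algebra R B] [IsScalarTower k R B]
    (hinj : Function.Injective (algebraMap R B))
    (hfib : ∀ m : Ideal R, m.IsMaximal →
      IsDomain (B ⧸ Ideal.map (algebraMap R B) m))
    (K L : Type*) [Field K] [Algebra R K] [IsFractionRing R K]
    [Field L] [Algebra B L] [IsFractionRing B L]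
    [Algebra K L] [Algebra R L] [IsScalarTower R K L] [IsScalarTower R B L] :
    (∀ x : L, IsAlgebraic K x → ∃ y : K, algebraMap K L y = x) ∧
      IsDomain ((AlgebraicClosure K) ⊗[K] (K ⊗[R] B)) := by
  have h := exists_algebraMap_eq_of_isAlgebraic_of_isDomain_fiber k hfib (K := K) (L := L)
  refine ⟨h, ?_⟩
  have : CharZero R := charZero_of_injective_algebraMap (algebraMap k R).injective
  have : CharZero K := charZero_of_injective_algebraMap (IsFractionRing.injective R K)
  have := isDomain_tensorProduct_of_forall_isAlgebraic h (AlgebraicClosure K)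
  let g : K ⊗[R] B →ₐ[K] L :=
    Algebra.TensorProduct.lift (Algebra.ofId K L) (IsScalarTower.toAlgHom R B L) fun _ _ ↦ .all _ _
  have hg : Function.Injective g := by
    rw [injective_iff_map_eq_zero]
    intro z hz
    obtain ⟨⟨b, s⟩, hs⟩ := IsLocalizedModule.surj (nonZeroDivisors R) (TensorProduct.mk R K B 1) z
    have hs' : (s : R) • z = (1 : K) ⊗ₜ[R] b := hs
    have hb : algebraMap B L b = 0 := by
      have := congrArg g hs'
      rw [← algebraMap_smul K (s : R) z, map_smul, hz, smul_zero] at this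
      simpa [g] using this.symm
    rw [(FaithfulSMul.algebraMap_eq_zero_iff B L).mp hb, TensorProduct.tmul_zero,
      ← algebraMap_smul K (s : R) z] at hs'
    exact (smul_eq_zero.mp hs').resolve_left
      (IsFractionRing.to_map_ne_zero_of_mem_nonZeroDivisors s.2)
  have hG : Function.Injective (Algebra.TensorProduct.map (.id K (AlgebraicClosure K)) g) :=
    Module.Flat.lTensor_preserves_injective_linearMap g.toLinearMap hg
  exact hG.isDomain (Algebra.TensorProduct.map (.id K (AlgebraicClosure K)) g).toRingHom
end
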